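/- arXiv:2203.07169 — 2 statements merged into one kernel-verified Lean document; each statement's English description precedes it below -/
import Mathlib

section
/- Let n, d be positive integers with n ≥ 2 and d ≥ 2, and let 𝔽_q be a finite field with q elements. Suppose q > ((1+√2)/2)^2 · ((n+1)(d-1)^n)^2 · ((n+1)(d-1)^n - 1)^2 · ((n+1)(d-1)^n - 2)^2. Then there exist homogeneous polynomials F₀, F₁ of degree d in 𝔽_q[x₀,…,xₙ], linearly independent over 𝔽_q, such that for every pair (a₀,a₁) ∈ 𝔽_q² with (a₀,a₁) ≠ (0,0), the hypersurface defined by a₀F₀ + a₁F₁ = 0 in ℙⁿ is smooth; that is, there is no nonzero point v in K^{n+1}, where K is an algebraic closure of 𝔽_q, at which a₀F₀ + a₁F₁ and all of its n+1 formal partial derivatives vanish simultaneously. -/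
open MvPolynomial

set_option linter.unusedSectionVars false
open Finset in
theorem sum_range_shift {M : Type*} [AddCommMonoid M] (g : ℕ → M) (r : ℕ) (hg : ∀ i, g (i + r) = g i)
    (m : ℕ) : ∑ i ∈ range r, g (i + m) = ∑ i ∈ range r, g i := by
  induction m with
  | zero => simp
  | succ m ih =>
    rw [← ih]
    have h1 := Finset.sum_range_succ (fun i => g (i + m)) r
    have h2 := Finset.sum_range_succ' (fun i => g (i + m)) r
    rw [h1] at h2
    have h3 : g (r + m) = g (0 + m) := by rw [add_comm r m, hg]; simp
    rcases r with _ | r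
    · simp
    · rw [Finset.sum_range_succ (fun i => g (i + (m+1))), Finset.sum_range_succ' (fun i => g (i + m))]
      congr 1
      · exact Finset.sum_congr rfl fun i _ => by congr 1; ring
      · rw [← hg (0 + m)]; congr 1; ring

section Trace
variable {k L K : Type*} [Field k] [Fintype k] [Field L] [Finite L] [Algebra k L]
  [Field K] [Algebra k K] [Algebra L K] [IsScalarTower k L K]

theorem frob_indep (r : ℕ) (hr : Module.finrank k L = r) (c : ℕ → K)
    (h : ∀ x : L, ∑ i ∈ Finset.range r, c i * (algebraMap L K x) ^ (Fintype.card k ^ i) = 0) :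
    ∀ i < r, c i = 0 := by
  classical
  have := Fintype.ofFinite L
  set q := Fintype.card k with hq
  have hq1 : 1 < q := Fintype.one_lt_card
  let P : Polynomial K := ∑ i ∈ Finset.range r, Polynomial.monomial (q ^ i) (c i)
  have hcard : Fintype.card L = q ^ r := by
    rw [← hr]; exact Module.card_eq_pow_finrank
  have hP : P = 0 := by
    have hrpos : 0 < r := hr ▸ Module.finrank_pos
    refine Polynomial.eq_zero_of_natDegree_lt_card_of_eval_eq_zero P
      (f := algebraMap L K) (algebraMap L K).injective ?_ ?_
    · intro x
      simpa [P, Polynomial.eval_finsetSum] using h x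
    · rw [hcard]
      refine lt_of_le_of_lt (Polynomial.natDegree_sum_le_of_forall_le (n := q ^ (r-1)) _ _ ?_) ?_
      · intro i hi
        refine (Polynomial.natDegree_monomial_le _).trans ?_
        exact Nat.pow_le_pow_right hq1.le (by have := Finset.mem_range.1 hi; omega)
      · exact Nat.pow_lt_pow_right hq1 (by omega)
  intro i hi
  have := congrArg (fun p => Polynomial.coeff p (q ^ i)) hP
  simp only [P, Polynomial.finsetSum_coeff, Polynomial.coeff_monomial, Polynomial.coeff_zero] at this
  rw [Finset.sum_eq_single i] at this
  · simpa using this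
  · intro j _ hj
    rw [if_neg]
    intro h; exact hj (Nat.pow_right_injective hq1 h)
  · intro h; exact absurd (Finset.mem_range.2 hi) h

variable (k L K) in
noncomputable def fr (i : ℕ) : L →+* K :=
  (((FiniteField.frobeniusAlgHom k K) ^ i : K →ₐ[k] K) : K →+* K).comp (algebraMap L K)

theorem fr_apply (i : ℕ) (x : L) : fr k L K i x = (algebraMap L K x) ^ (Fintype.card k ^ i) := by
  simp [fr, AlgHom.coe_pow, FiniteField.coe_frobeniusAlgHom, pow_iterate]

theorem pow_card_pow_finrank (r : ℕ) (hr : Module.finrank k L = r) (x : L) :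
    x ^ (Fintype.card k ^ r) = x := by
  have := Fintype.ofFinite L
  rw [← hr, ← Module.card_eq_pow_finrank (K := k) (V := L)]
  exact FiniteField.pow_card x

theorem fr_add (r : ℕ) (hr : Module.finrank k L = r) (i : ℕ) (x : L) :
    fr k L K (i + r) x = fr k L K i x := by
  rw [fr_apply, fr_apply, add_comm, pow_add, pow_mul, ← map_pow, pow_card_pow_finrank r hr]

theorem fr_algebraMap (i : ℕ) (x : k) : fr k L K i (algebraMap k L x) = algebraMap k K x := by
  rw [fr_apply, ← IsScalarTower.algebraMap_apply, ← map_pow, FiniteField.pow_card_pow]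

theorem fr_smul (i : ℕ) (c : k) (x : L) : fr k L K i (c • x) = algebraMap k K c * fr k L K i x := by
  rw [Algebra.smul_def, map_mul, fr_algebraMap]

theorem fr_pow_card (i j : ℕ) (x : L) : fr k L K i (x ^ Fintype.card k ^ j) = fr k L K (i + j) x := by
  rw [fr_apply, fr_apply, map_pow, ← pow_mul, ← pow_add, add_comm]

theorem fr_succ (i : ℕ) (x : L) : fr k L K (i+1) x = fr k L K i x ^ Fintype.card k := by
  rw [fr_apply, fr_apply, pow_succ, pow_mul]

theorem trace_fr (r : ℕ) (hr : Module.finrank k L = r) (x : L) :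
    algebraMap k K (Algebra.trace k L x) = ∑ i ∈ Finset.range r, fr k L K i x := by
  rw [IsScalarTower.algebraMap_apply k L K, FiniteField.algebraMap_trace_eq_sum_pow, map_sum, hr]
  exact Finset.sum_congr rfl fun i _ => by rw [fr_apply, map_pow, Fintype.card_eq_nat_card]

noncomputable def traceMap {σ : Type*} (P : MvPolynomial σ L) : MvPolynomial σ k :=
  ∑ m ∈ P.support, monomial m (Algebra.trace k L (coeff m P))

theorem coeff_traceMap {σ : Type*} (P : MvPolynomial σ L) (m : σ →₀ ℕ) :
    coeff m (traceMap (k := k) P) = Algebra.trace k L (coeff m P) := by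
  classical
  simp only [traceMap, coeff_sum, coeff_monomial, Finset.sum_ite_eq', mem_support_iff]
  split_ifs with h
  · rfl
  · simp only [ne_eq, not_not] at h; simp [h]

theorem traceMap_add {σ : Type*} (P Q : MvPolynomial σ L) :
    traceMap (k := k) (P + Q) = traceMap P + traceMap Q := by
  ext m; simp [coeff_traceMap]

theorem traceMap_C_mul {σ : Type*} (c : k) (P : MvPolynomial σ L) :
    traceMap (k := k) (C (algebraMap k L c) * P) = C c * traceMap P := by
  ext m; simp [coeff_traceMap, coeff_C_mul, ← Algebra.smul_def]

theorem traceMap_hom {σ : Type*} {P : MvPolynomial σ L} {d : ℕ} (h : P.IsHomogeneous d) :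
    (traceMap (k := k) P).IsHomogeneous d := by
  intro m hm
  rw [coeff_traceMap] at hm
  apply h
  intro h0; rw [h0] at hm; simp at hm

theorem map_traceMap {σ : Type*} (r : ℕ) (hr : Module.finrank k L = r) (P : MvPolynomial σ L) :
    map (algebraMap k K) (traceMap (k := k) P) = ∑ i ∈ Finset.range r, map (fr k L K i) P := by
  ext m
  simp only [coeff_map, coeff_sum, coeff_traceMap, trace_fr r hr]

end Trace

set_option linter.unusedSectionVars false
section Sing
variable {k L K : Type*} [Field k] [Fintype k] [Field L] [Finite L] [Algebra k L]
  [Field K] [Algebra k K] [Algebra L K] [IsScalarTower k L K]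

noncomputable def lf {r : ℕ} (b : Module.Basis (Fin r) k L) (i : ℕ) : MvPolynomial (Fin r) L :=
  ∑ j, C (b j ^ Fintype.card k ^ i) * X j

noncomputable def Yv (K : Type*) [Field K] [Algebra k K] [Algebra L K] {r : ℕ}
    (b : Module.Basis (Fin r) k L) (v : Fin r → K) (i : ℕ) : K :=
  ∑ j, fr k L K i (b j) * v j

variable {r : ℕ} (b : Module.Basis (Fin r) k L)

theorem fr_pow_card' (i j : ℕ) (x : L) : fr k L K i x ^ Fintype.card k ^ j = fr k L K (i + j) x := by
  rw [← fr_pow_card, map_pow]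

theorem lf_hom (i : ℕ) : (lf b i).IsHomogeneous 1 := by
  unfold lf
  exact IsHomogeneous.sum Finset.univ _ 1 fun j _ => isHomogeneous_C_mul_X _ j

theorem Yv_add (v : Fin r → K) (i : ℕ) : Yv K b v (i + r) = Yv K b v i := by
  have hr : Module.finrank k L = r := by simpa using Module.finrank_eq_card_basis b
  simp [Yv, fr_add r hr]

theorem eval_lf (v : Fin r → K) (i m : ℕ) :
    eval v (map (fr k L K i) (lf b m)) = Yv K b v (i + m) := by
  simp only [lf, Yv, map_sum, map_mul, map_C, map_X, eval_C, eval_X, fr_pow_card]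

theorem pderiv_lf (m : ℕ) (j : Fin r) : pderiv j (lf b m) = C (b j ^ Fintype.card k ^ m) := by
  classical
  simp [lf, pderiv_X, Pi.single_apply]

theorem indep_basis (c : ℕ → K)
    (h : ∀ j, ∑ i ∈ Finset.range r, c i * fr k L K i (b j) = 0) : ∀ i < r, c i = 0 := by
  have hr : Module.finrank k L = r := by simpa using Module.finrank_eq_card_basis b
  refine frob_indep (k := k) (L := L) r hr c fun x => ?_
  have hx := b.sum_repr x
  have : ∀ i, (algebraMap L K x) ^ (Fintype.card k ^ i)
      = ∑ j, algebraMap k K (b.repr x j) * fr k L K i (b j) := by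
    intro i
    rw [← fr_apply, ← hx, map_sum]
    simp [fr_smul]
  simp_rw [this, Finset.mul_sum]
  rw [Finset.sum_comm]
  refine Finset.sum_eq_zero fun j _ => ?_
  have := congrArg (fun z => algebraMap k K (b.repr x j) * z) (h j)
  simp only [Finset.mul_sum, mul_zero] at this
  rw [← this]
  exact Finset.sum_congr rfl fun i _ => by ring

theorem Yv_ne (v : Fin r → K) (hv : v ≠ 0) : ∃ i, Yv K b v i ≠ 0 := by
  by_contra! hY
  let M : Matrix (Fin r) (Fin r) K := fun i j => fr k L K i (b j)
  have h1 : M.det = 0 := Matrix.exists_mulVec_eq_zero_iff.1 ⟨v, hv, by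
    ext i; exact hY i⟩
  obtain ⟨c, hc, hc0⟩ := Matrix.exists_vecMul_eq_zero_iff.2 h1
  apply hc
  have := indep_basis (K := K) b (fun i => if h : i < r then c ⟨i, h⟩ else 0) (fun j => by
    have := congrFun hc0 j
    rw [Finset.sum_range]
    simpa [Matrix.vecMul, dotProduct, M] using this)
  ext i
  simpa using this i i.2

noncomputable def Pol (d m : ℕ) (α a : L) (E : MvPolynomial (Fin r) L) : MvPolynomial (Fin r) L :=
  C α * (lf b 0 ^ (d - 1) * lf b m) + C a * lf b 0 ^ d + E

theorem Pol_hom {d : ℕ} (hd : 1 ≤ d) (m : ℕ) (α a : L) {E : MvPolynomial (Fin r) L}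
    (hE : E.IsHomogeneous d) : (Pol b d m α a E).IsHomogeneous d := by
  refine ((IsHomogeneous.C_mul ?_ _).add (IsHomogeneous.C_mul ?_ _)).add hE
  · have := ((lf_hom b 0).pow (d-1)).mul (lf_hom b m)
    convert this using 1; omega
  · simpa using (lf_hom b 0).pow d

theorem value_eq (d m : ℕ) (α a : L) (E : MvPolynomial (Fin r) L) (v : Fin r → K) :
    eval v (map (algebraMap k K) (traceMap (k := k) (Pol b d m α a E))) =
    ∑ i ∈ Finset.range r, (fr k L K i α * (Yv K b v i ^ (d-1) * Yv K b v (i + m))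
      + fr k L K i a * Yv K b v i ^ d + eval v (map (fr k L K i) E)) := by
  have hr : Module.finrank k L = r := by simpa using Module.finrank_eq_card_basis b
  rw [map_traceMap r hr, map_sum]
  refine Finset.sum_congr rfl fun i _ => ?_
  simp only [Pol, map_add, map_mul, map_pow, eval_lf, map_C, eval_C, add_zero]

theorem partial_eq (d m : ℕ) (hm : m ≤ r) (α a : L) (E : MvPolynomial (Fin r) L)
    (hE : ∀ j, pderiv j E = 0) (v : Fin r → K)
    (h : ∀ j, eval v (map (algebraMap k K) (pderiv j (traceMap (k := k) (Pol b d m α a E)))) = 0)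
    (i : ℕ) :
    fr k L K i α * Yv K b v i ^ (d-1) +
      ((d-1 : ℕ) : K) * fr k L K (i+m) α * Yv K b v (i+m) ^ (d-2) * Yv K b v (i + m + m)
      + (d : K) * fr k L K (i+m) a * Yv K b v (i+m) ^ (d-1) = 0 := by
  have hr : Module.finrank k L = r := by simpa using Module.finrank_eq_card_basis b
  have hr0 : 0 < r := hr ▸ Module.finrank_pos
  let Y := Yv K b v
  let c : ℕ → K := fun i => fr k L K (i+(r-m)) α * Y (i+(r-m)) ^ (d-1) +
      ((d-1 : ℕ) : K) * fr k L K i α * Y i ^ (d-2) * Y (i + m)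
      + (d : K) * fr k L K i a * Y i ^ (d-1)
  have hYr : ∀ i, Y (i + r) = Y i := Yv_add b v
  have hcper : ∀ i, c (i + r) = c i := by
    intro i
    simp only [c]
    rw [show i + r + (r-m) = i + (r - m) + r by ring, show i + r + m = i + m + r by ring]
    simp only [hYr, fr_add r hr]
  have key : ∀ j, ∑ i ∈ Finset.range r, c i * fr k L K i (b j) = 0 := by
    intro j
    rw [← h j, ← pderiv_map, map_traceMap r hr, map_sum, map_sum]
    have e1 : ∀ i, eval v (pderiv j (map (fr k L K i) (Pol b d m α a E))) =
       (fun i => fr k L K (i+(r-m)) α * Y (i+(r-m)) ^ (d-1) * fr k L K i (b j)) (i + m) +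
       (((d-1 : ℕ) : K) * fr k L K i α * Y i ^ (d-2) * Y (i + m)
      + (d : K) * fr k L K i a * Y i ^ (d-1)) * fr k L K i (b j) := by
      intro i
      rw [pderiv_map]
      simp only [Pol, map_add, Derivation.leibniz, pderiv_lf, pderiv_C, Derivation.leibniz_pow, hE,
        smul_eq_mul, nsmul_eq_mul, mul_zero, add_zero, map_mul, map_pow, map_natCast, eval_lf,
        map_C, eval_C, fr_pow_card']
      rw [show i + m + (r - m) = i + r by omega]
      simp only [hYr, fr_add r hr, Y, show d - 1 - 1 = d - 2 from rfl]
      ring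
    simp_rw [e1]
    rw [Finset.sum_add_distrib, sum_range_shift (fun i => fr k L K (i+(r-m)) α * Y (i+(r-m)) ^ (d-1) * fr k L K i (b j)) r _ m, ← Finset.sum_add_distrib]
    · exact Finset.sum_congr rfl fun i _ => by simp only [c]; ring
    · intro i
      rw [show i + r + (r-m) = i + (r - m) + r by ring]
      simp only [hYr, fr_add r hr]
  have hc := indep_basis b c key
  have hcall : ∀ i, c i = 0 := by
    intro i
    have : ∀ t i, c (i + r * t) = c i := by
      intro t
      induction t with
      | zero => simp
      | succ t ih => intro i; rw [mul_add, mul_one, ← add_assoc, hcper, ih]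
    rw [← Nat.mod_add_div i r, this]
    exact hc _ (Nat.mod_lt _ hr0)
  have := hcall (i + m)
  simp only [c] at this
  rw [show i + m + (r - m) = i + r by omega] at this
  simpa only [hYr, fr_add r hr] using this
end Sing

set_option linter.unusedSectionVars false
section Cases
variable {k L K : Type*} [Field k] [Fintype k] [Field L] [Finite L] [Algebra k L]
  [Field K] [Algebra k K] [Algebra L K] [IsScalarTower k L K]
variable {r : ℕ} (b : Module.Basis (Fin r) k L)

/-- `v` is a singular point of `G = 0`. -/
def SingAt (G : MvPolynomial (Fin r) k) (v : Fin r → K) : Prop :=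
  eval v (map (algebraMap k K) G) = 0 ∧ ∀ j, eval v (map (algebraMap k K) (pderiv j G)) = 0

theorem fr_ne {i : ℕ} {x : L} (hx : x ≠ 0) : fr k L K i x ≠ 0 := by
  rwa [Ne, map_eq_zero]

theorem nsA {d : ℕ} (hd : (d : K) ≠ 0) {a : L} (ha : a ≠ 0) {v : Fin r → K} (hv : v ≠ 0) :
    ¬ SingAt (traceMap (k := k) (Pol b d 0 0 a 0)) v := by
  rintro ⟨_, h2⟩
  obtain ⟨i, hi⟩ := Yv_ne b v hv
  have := partial_eq b d 0 (Nat.zero_le _) 0 a 0 (by simp) v h2 i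
  simp [hd, fr_ne ha, hi] at this

theorem periodic_mul {Y : ℕ → K} (hY : ∀ i, Y (i + r) = Y i) (t i : ℕ) : Y (i + r * t) = Y i := by
  induction t with
  | zero => simp
  | succ t ih => rw [mul_add, mul_one, ← add_assoc, hY, ih]

theorem crit_eq {d : ℕ} (hd : 2 ≤ d) (hr0 : 1 ≤ r) (hdK : (d : K) = 0) {α a : L}
    {E : MvPolynomial (Fin r) L}
    (hE : ∀ j, pderiv j E = 0) {v : Fin r → K}
    (h : ∀ j, eval v (map (algebraMap k K) (pderiv j (traceMap (k := k) (Pol b d 1 α a E)))) = 0)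
    (i : ℕ) : fr k L K i α * Yv K b v i ^ (d-1) =
      fr k L K (i+1) α * Yv K b v (i+1) ^ (d-2) * Yv K b v (i + 2) := by
  have := partial_eq b d 1 hr0 α a E hE v h i
  rw [Nat.cast_sub (by omega), hdK] at this
  simp only [Nat.cast_one, add_assoc, one_add_one_eq_two] at this
  linear_combination this

theorem crit_const {d : ℕ} (hd : 2 ≤ d) {A Y : ℕ → K}
    (h : ∀ i, A i * Y i ^ (d-1) = A (i+1) * Y (i+1) ^ (d-2) * Y (i+2)) (i : ℕ) :
    A i * Y i ^ (d-1) * Y (i+1) = A 0 * Y 0 ^ (d-1) * Y 1 := by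
  induction i with
  | zero => rfl
  | succ i ih =>
    rw [← ih, h i, show d - 1 = d - 2 + 1 by omega, pow_succ]
    ring

theorem crit_zero {d : ℕ} (hd : 3 ≤ d) (hr0 : 1 ≤ r) {A Y : ℕ → K} (hA : ∀ i, A i ≠ 0)
    (hY : ∀ i, Y (i + r) = Y i)
    (h : ∀ i, A i * Y i ^ (d-1) = A (i+1) * Y (i+1) ^ (d-2) * Y (i+2)) {i : ℕ} (hi : Y i = 0) :
    ∀ j, Y j = 0 := by
  have step : ∀ i, Y (i+1) = 0 → Y i = 0 := by
    intro i hi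
    have := h i
    rw [hi, zero_pow (by omega), mul_zero, zero_mul] at this
    simpa [hA, show d - 1 ≠ 0 by omega] using this
  have down : ∀ t i, Y (i + t) = 0 → Y i = 0 := by
    intro t
    induction t with
    | zero => simp
    | succ t ih => intro i hi; exact ih i (step _ hi)
  intro j
  refine down (i + r * j - j) j ?_
  have : j ≤ r * j := Nat.le_mul_of_pos_left _ hr0
  rw [show j + (i + r * j - j) = i + r * j by omega, periodic_mul hY, hi]

theorem nsB {d : ℕ} (hd : 2 ≤ d) (hr0 : 1 ≤ r) (hdK : (d : K) = 0) (hrK : (r : K) ≠ 0) {α : L}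
    (hα : α ≠ 0) {v : Fin r → K} (hv : v ≠ 0) :
    ¬ SingAt (traceMap (k := k) (Pol b d 1 α 0 0)) v := by
  rintro ⟨h1, h2⟩
  have hr : Module.finrank k L = r := by simpa using Module.finrank_eq_card_basis b
  obtain ⟨i, hi⟩ := Yv_ne b v hv
  have hc := crit_eq b hd hr0 hdK (by simp) h2
  have hcc := crit_const hd hc
  rw [value_eq] at h1
  simp only [map_zero, zero_mul, add_zero, ← mul_assoc] at h1
  set Y := Yv K b v with hYdef
  have hY : ∀ i, Y (i + r) = Y i := Yv_add b v
  simp only [hcc, Finset.sum_const, Finset.card_range, nsmul_eq_mul, mul_eq_zero, hrK, false_or] at h1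
  have hA : ∀ i, fr k L K i α ≠ 0 := fun i => fr_ne hα
  have h0 : ∀ i, Y i = 0 ∨ Y (i+1) = 0 := by
    intro i
    have := hcc i
    have h1' : fr k L K 0 α * Y 0 ^ (d-1) * Y 1 = 0 := by
      simpa [mul_eq_zero] using h1
    rw [h1'] at this
    simpa [hA, show d - 1 ≠ 0 by omega] using this
  rcases Nat.lt_or_ge 2 d with h3 | h3
  · rcases h0 0 with h | h
    · exact hi (crit_zero h3 hr0 (A := fun i => fr k L K i α) hA hY hc h i)
    · exact hi (crit_zero h3 hr0 (A := fun i => fr k L K i α) hA hY hc h i)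
  · obtain rfl : d = 2 := by omega
    have hodd : r % 2 = 1 := by
      by_contra hcon
      apply hrK
      have : r = 2 * (r / 2) := by omega
      rw [this, Nat.cast_mul, hdK, zero_mul]
    have step : ∀ i, Y i = 0 → Y (i + 2) = 0 := by
      intro i h
      have := hc i
      rw [h] at this
      simpa [hA] using this.symm
    have up : ∀ t i, Y i = 0 → Y (i + 2 * t) = 0 := by
      intro t
      induction t with
      | zero => simp
      | succ t ih => intro i h; exact step _ (ih i h)
    have fin : ∀ i0, Y i0 = 0 → ∀ j, Y j = 0 := by
      intro i0 h j
      have hle : i0 ≤ r * i0 := Nat.le_mul_of_pos_left _ hr0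
      by_cases hp : (j + r * i0 - i0) % 2 = 0
      · rw [← periodic_mul hY i0 j, show j + r * i0 = i0 + 2 * ((j + r * i0 - i0)/2) by omega]
        exact up _ _ h
      · rw [← periodic_mul hY (i0+1) j, mul_add, mul_one,
          show j + (r * i0 + r) = i0 + 2 * ((j + r * i0 + r - i0)/2) by omega]
        exact up _ _ h
    rcases h0 0 with h | h
    · exact hi (fin _ h i)
    · exact hi (fin _ h i)

theorem nsC {h : ℕ} (hrh : r = h + h) {α : L}
    (hα : α + α ^ Fintype.card k ^ h ≠ 0) {v : Fin r → K} (hv : v ≠ 0) :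
    ¬ SingAt (traceMap (k := k) (Pol b 2 h α 0 0)) v := by
  rintro ⟨_, h2⟩
  have hr : Module.finrank k L = r := by simpa using Module.finrank_eq_card_basis b
  obtain ⟨i, hi⟩ := Yv_ne b v hv
  have := partial_eq b 2 h (by omega) α 0 0 (by simp) v h2 i
  rw [show i + h + h = i + r by omega, Yv_add] at this
  have h3 : fr k L K i (α + α ^ Fintype.card k ^ h) ≠ 0 := fr_ne hα
  rw [map_add, fr_pow_card] at h3
  simp at this
  rw [← add_mul] at this
  exact (mul_ne_zero h3 hi) this

theorem Pol_comb (d m : ℕ) (s t α₀ α₁ a₀ a₁ : L) (E₀ E₁ : MvPolynomial (Fin r) L) :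
    C s * Pol b d m α₀ a₀ E₀ + C t * Pol b d m α₁ a₁ E₁ =
      Pol b d m (s * α₀ + t * α₁) (s * a₀ + t * a₁) (C s * E₀ + C t * E₁) := by
  simp only [Pol, map_add, map_mul]; ring

theorem traceMap_comb (s t : k) (P₀ P₁ : MvPolynomial (Fin r) L) :
    C s * traceMap (k := k) P₀ + C t * traceMap (k := k) P₁ =
    traceMap (k := k) (C (algebraMap k L s) * P₀ + C (algebraMap k L t) * P₁) := by
  rw [traceMap_add, traceMap_C_mul, traceMap_C_mul]

/-- Existence of a pencil. -/
def HasPencil (k K : Type*) [Field k] [Field K] [Algebra k K] (r d : ℕ) : Prop :=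
  ∃ F₀ F₁ : MvPolynomial (Fin r) k,
      F₀.IsHomogeneous d ∧ F₁.IsHomogeneous d ∧
      ∀ a₀ a₁ : k, (a₀, a₁) ≠ (0, 0) → ∀ v : Fin r → K, v ≠ 0 → ¬ SingAt (C a₀ * F₀ + C a₁ * F₁) v

theorem hasPencil_of {d m : ℕ} (hd : 1 ≤ d) {α₀ α₁ a₀ a₁ : L} {E₀ E₁ : MvPolynomial (Fin r) L}
    (h0 : E₀.IsHomogeneous d) (h1 : E₁.IsHomogeneous d)
    (H : ∀ s t : k, (s, t) ≠ (0, 0) → ∀ v : Fin r → K, v ≠ 0 →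
      ¬ SingAt (traceMap (k := k) (Pol b d m (s • α₀ + t • α₁) (s • a₀ + t • a₁)
        (C (algebraMap k L s) * E₀ + C (algebraMap k L t) * E₁))) v) :
    HasPencil k K r d := by
  refine ⟨_, _, traceMap_hom (k := k) (Pol_hom b hd m α₀ a₀ h0),
    traceMap_hom (k := k) (Pol_hom b hd m α₁ a₁ h1), fun s t hst v hv => ?_⟩
  rw [traceMap_comb, Pol_comb]
  simpa only [Algebra.smul_def] using H s t hst v hv

/-- two independent elements outside of a small subspace -/
theorem exists_two {V : Type*} [AddCommGroup V] [Module k V] [FiniteDimensional k V]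
    (W : Submodule k V) (hW : Module.finrank k W + 2 ≤ Module.finrank k V) :
    ∃ x y : V, ∀ s t : k, (s, t) ≠ (0, 0) → s • x + t • y ∉ W := by
  have h1 : 2 ≤ Module.finrank k (V ⧸ W) := by
    have := W.finrank_quotient_add_finrank; omega
  obtain ⟨f, hf⟩ := exists_linearIndependent_of_le_finrank h1
  obtain ⟨x, hx⟩ := W.mkQ_surjective (f 0)
  obtain ⟨y, hy⟩ := W.mkQ_surjective (f 1)
  refine ⟨x, y, fun s t hst hmem => hst ?_⟩
  have hf2 := Fintype.linearIndependent_iff.1 hf ![s, t] (by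
    rw [Fin.sum_univ_two, ← hx, ← hy]
    simp only [Matrix.cons_val_zero, Matrix.cons_val_one]
    rw [← map_smul, ← map_smul, ← map_add, ← LinearMap.mem_ker, Submodule.ker_mkQ]
    exact hmem)
  have e0 : s = 0 := hf2 0
  have e1 : t = 0 := hf2 1
  rw [e0, e1]

theorem pencilAB {d : ℕ} (hd : 2 ≤ d) (hr : 3 ≤ r) (b : Module.Basis (Fin r) k L)
    (h : (d : K) ≠ 0 ∨ (r : K) ≠ 0) : HasPencil k K r d := by
  have hfr : Module.finrank k L = r := by simpa using Module.finrank_eq_card_basis b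
  have : FiniteDimensional k L := Module.finite_of_finrank_pos (by omega)
  obtain ⟨x, y, hxy⟩ := exists_two (k := k) (⊥ : Submodule k L) (by simp; omega)
  have hxy : ∀ s t : k, (s, t) ≠ (0, 0) → s • x + t • y ≠ 0 := by simpa using hxy
  by_cases hdK : (d : K) = 0
  · have hrK := h.resolve_left (by simpa using hdK)
    refine hasPencil_of (α₀ := x) (α₁ := y) (a₀ := 0) (a₁ := 0) (m := 1) b (by omega)
      (isHomogeneous_zero _ _ _) (isHomogeneous_zero _ _ _) fun s t hst v hv => ?_
    simp only [smul_zero, add_zero, mul_zero]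
    exact nsB b hd (by omega) hdK hrK (hxy s t hst) hv
  · refine hasPencil_of (a₀ := x) (a₁ := y) (α₀ := 0) (α₁ := 0) (m := 0) b (by omega)
      (isHomogeneous_zero _ _ _) (isHomogeneous_zero _ _ _) fun s t hst v hv => ?_
    simp only [smul_zero, add_zero, mul_zero]
    exact nsA b hdK (hxy s t hst) hv

theorem pencilC (hr : 3 ≤ r) (b : Module.Basis (Fin r) k L)
    (h2 : (2 : K) = 0) (hrK : (r : K) = 0) : HasPencil k K r 2 := by
  classical
  have hfr : Module.finrank k L = r := by simpa using Module.finrank_eq_card_basis b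
  have : FiniteDimensional k L := Module.finite_of_finrank_pos (by omega)
  obtain ⟨h, rfl⟩ : ∃ h, r = h + h := by
    by_contra hcon
    have : r = 2 * (r / 2) + 1 := by
      have : r % 2 = 1 := by
        by_contra h; exact hcon ⟨r / 2, by omega⟩
      omega
    rw [this] at hrK; simp [h2] at hrK
  let T : L →ₗ[k] L := LinearMap.id + ((FiniteField.frobeniusAlgHom k L) ^ h : L →ₐ[k] L).toLinearMap
  have hT : ∀ x, T x = x + x ^ Fintype.card k ^ h := by
    intro x
    simp [T, AlgHom.coe_pow, FiniteField.coe_frobeniusAlgHom, pow_iterate]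
  have hker : Module.finrank k (LinearMap.ker T) ≤ h := by
    have hq1 : 1 < Fintype.card k := Fintype.one_lt_card
    have := Fintype.ofFinite L
    have hc : Fintype.card (LinearMap.ker T) = Fintype.card k ^ Module.finrank k (LinearMap.ker T) :=
      Module.card_eq_pow_finrank
    let P : Polynomial L := Polynomial.X ^ (Fintype.card k ^ h) + Polynomial.X
    have hdeg : P.natDegree = Fintype.card k ^ h := by
      have h1 : 1 < Fintype.card k ^ h := Nat.one_lt_pow (by omega) hq1
      rw [Polynomial.natDegree_add_eq_left_of_natDegree_lt] <;> simp [h1]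
    have hle : Fintype.card (LinearMap.ker T) ≤ Fintype.card k ^ h := by
      by_contra! hlt
      have : P = 0 := Polynomial.eq_zero_of_natDegree_lt_card_of_eval_eq_zero P
        (f := fun x : LinearMap.ker T => (x : L)) Subtype.val_injective (by
          intro x
          have := LinearMap.mem_ker.1 x.2
          rw [hT] at this
          simpa [P, add_comm] using this) (by rw [hdeg]; exact hlt)
      rw [this] at hdeg
      have : 0 < Fintype.card k ^ h := by positivity
      simp at hdeg
      omega
    rw [hc] at hle
    exact (Nat.pow_le_pow_iff_right hq1).1 hle
  obtain ⟨x, y, hxy⟩ := exists_two (k := k) (LinearMap.ker T) (by omega)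
  refine hasPencil_of (α₀ := x) (α₁ := y) (a₀ := 0) (a₁ := 0) (m := h) b (by omega)
      (isHomogeneous_zero _ _ _) (isHomogeneous_zero _ _ _) fun s t hst v hv => ?_
  simp only [smul_zero, add_zero, mul_zero]
  refine nsC b rfl ?_ hv
  have := hxy s t hst
  rwa [LinearMap.mem_ker, hT] at this
end Cases

set_option linter.unusedSectionVars false
section Counting
open Finset

theorem card_ker_mul {k V W : Type*} [Field k] [AddCommGroup V] [Module k V] [AddCommGroup W]
    [Module k W] [Finite V] (f : V →ₗ[k] W) (hf : Function.Surjective f) :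
    Nat.card (LinearMap.ker f) * Nat.card W = Nat.card V := by
  have h := Submodule.card_eq_card_quotient_mul_card (LinearMap.ker f)
  have e := Nat.card_congr (f.quotKerEquivOfSurjective hf).toEquiv
  rw [h, ← e, mul_comm]

variable {I : Type*} [Fintype I] [DecidableEq I]

theorem ind_pair (ι : I → ℝ) (h : ∀ i, ι i * ι i = ι i) :
    ∑ i, ∑ j, (if i = j then 0 else ι i * ι j) = (∑ i, ι i) ^ 2 - ∑ i, ι i := by
  have : ∀ i j, (if i = j then 0 else ι i * ι j) = ι i * ι j - (if i = j then ι i else 0) := by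
    intro i j
    split_ifs with hij
    · subst hij; rw [h]; ring
    · ring
  simp_rw [this, sum_sub_distrib, sum_ite_eq, mem_univ, if_true, sq, sum_mul_sum]

theorem ind_triple (ι : I → ℝ) (h : ∀ i, ι i * ι i = ι i) :
    ∑ i, ∑ j, ∑ l, (if i ≠ j ∧ i ≠ l ∧ j ≠ l then ι i * ι j * ι l else 0) =
      ((∑ i, ι i) ^ 2 - ∑ i, ι i) * (∑ i, ι i - 2) := by
  rw [← ind_pair ι h, sum_mul]
  refine sum_congr rfl fun i _ => ?_
  rw [sum_mul]
  refine sum_congr rfl fun j _ => ?_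
  by_cases hij : i = j
  · simp [hij]
  · have : ∀ l, (if i ≠ j ∧ i ≠ l ∧ j ≠ l then ι i * ι j * ι l else 0) =
        ι i * ι j * ι l - (if i = l then ι i * ι j else 0) - (if j = l then ι i * ι j else 0) := by
      intro l
      by_cases h1 : i = l
      · subst h1
        have : ¬ j = i := fun h => hij h.symm
        simp only [ne_eq, not_true, false_and, and_false, if_false, if_true, this]
        linear_combination (-ι j) * h i
      · by_cases h2 : j = l
        · subst h2
          simp only [ne_eq, not_true, and_false, if_false, if_true, h1]
          linear_combination (-ι i) * h j
        · simp [hij, h1, h2]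
    simp_rw [this, sum_sub_distrib, sum_ite_eq, mem_univ, if_true, if_neg hij, ← mul_sum]
    ring

/-- cubic Bonferroni inequality for a natural number -/
theorem bonf (X : ℕ) : 1 - (X : ℝ) + ((X:ℝ) ^ 2 - X) / 2 - (((X:ℝ) ^ 2 - X) * (X - 2)) / 6 ≤
    if X = 0 then 1 else 0 := by
  split_ifs with h
  · subst h; norm_num
  · have h1 : (1:ℝ) ≤ X := by exact_mod_cast Nat.one_le_iff_ne_zero.2 h
    rcases Nat.lt_or_ge X 3 with h3 | h3
    · interval_cases X
      · norm_num at h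
      · norm_num
      · norm_num
    · have h3 : (3:ℝ) ≤ X := by exact_mod_cast h3
      have : 0 ≤ ((X:ℝ) - 1) * ((X - 2) * (X - 3)) :=
        mul_nonneg (by linarith) (mul_nonneg (by linarith) (by linarith))
      nlinarith

theorem num_ineq {q D x σ2 : ℝ} (hD : 1 ≤ D) (hq : 36 * D ^ 2 ≤ q)
    (hσ : σ2 ≤ (q + 1) * D ^ 2 / q ^ 2) :
    (q + 1) * D / q ^ 2 < 1 - x + (x ^ 2 - σ2) / 2 - ((q + 1) / q) ^ 3 / 6 := by
  have hq36 : 36 ≤ q := by nlinarith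
  have hq0 : 0 < q := by linarith
  have h1 : (q + 1) / q ≤ 37 / 36 := by
    rw [div_le_div_iff₀ hq0 (by norm_num)]; linarith
  have h1' : 0 ≤ (q + 1) / q := by positivity
  have h2 : D ^ 2 / q ≤ 1 / 36 := by
    rw [div_le_div_iff₀ hq0 (by norm_num)]; linarith
  have h3 : D / q ≤ 1 / 36 := by
    rw [div_le_div_iff₀ hq0 (by norm_num)]; nlinarith
  have e1 : (q + 1) * D ^ 2 / q ^ 2 = (q + 1) / q * (D ^ 2 / q) := by field_simp
  have e2 : (q + 1) * D / q ^ 2 = (q + 1) / q * (D / q) := by field_simp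
  have b1 : (q + 1) / q * (D ^ 2 / q) ≤ 37 / 36 * (1 / 36) :=
    mul_le_mul h1 h2 (by positivity) (by norm_num)
  have b2 : (q + 1) / q * (D / q) ≤ 37 / 36 * (1 / 36) :=
    mul_le_mul h1 h3 (by positivity) (by norm_num)
  have b3 : ((q + 1) / q) ^ 3 ≤ (37 / 36) ^ 3 := pow_le_pow_left₀ h1' h1 3
  rw [e1] at hσ
  rw [e2]
  nlinarith [sq_nonneg (x - 1)]

variable {k A : Type*} [Field k] [Fintype k] [AddCommGroup A] [Module k A] [Fintype A]
  [DecidableEq A]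

theorem pair_bij {s t s' t' : k} (h : s * t' - s' * t ≠ 0) :
    Function.Bijective (fun ω : A × A => (s • ω.1 + t • ω.2, s' • ω.1 + t' • ω.2)) := by
  rw [← Finite.injective_iff_bijective]
  rintro ⟨x, y⟩ ⟨x', y'⟩ heq
  simp only [Prod.mk.injEq] at heq
  obtain ⟨h1, h2⟩ := heq
  have hx : (s * t' - s' * t) • (x - x') = 0 := by
    have h1' : s • (x - x') + t • (y - y') = 0 := by
      rw [smul_sub, smul_sub]; rw [← sub_eq_zero] at h1; rw [← h1]; abel
    have h2' : s' • (x - x') + t' • (y - y') = 0 := by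
      rw [smul_sub, smul_sub]; rw [← sub_eq_zero] at h2; rw [← h2]; abel
    have : (s * t' - s' * t) • (x - x') =
      t' • (s • (x - x') + t • (y - y')) - t • (s' • (x - x') + t' • (y - y')) := by module
    rw [this, h1', h2']; simp
  have hy : (s * t' - s' * t) • (y - y') = 0 := by
    have h1' : s • (x - x') + t • (y - y') = 0 := by
      rw [smul_sub, smul_sub]; rw [← sub_eq_zero] at h1; rw [← h1]; abel
    have h2' : s' • (x - x') + t' • (y - y') = 0 := by
      rw [smul_sub, smul_sub]; rw [← sub_eq_zero] at h2; rw [← h2]; abel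
    have : (s * t' - s' * t) • (y - y') =
      s • (s' • (x - x') + t' • (y - y')) - s' • (s • (x - x') + t • (y - y')) := by module
    rw [this, h1', h2']; simp
  rw [smul_eq_zero, or_iff_right h, sub_eq_zero] at hx hy
  rw [hx, hy]

theorem card_pair {s t s' t' : k} (h : s * t' - s' * t ≠ 0) (S S' : Finset A) :
    (univ.filter (fun ω : A × A => s • ω.1 + t • ω.2 ∈ S ∧ s' • ω.1 + t' • ω.2 ∈ S')).card
      = S.card * S'.card := by
  rw [← card_product]
  refine card_bij (fun ω _ => (s • ω.1 + t • ω.2, s' • ω.1 + t' • ω.2)) ?_ ?_ ?_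
  · intro ω hω; simpa using hω
  · intro ω _ ω' _ heq; exact (pair_bij h).1 heq
  · intro z hz
    obtain ⟨ω, rfl⟩ := (pair_bij h).2 z
    exact ⟨ω, by simpa using hz, rfl⟩

theorem card_triple [DecidableEq k] {s t s' t' s'' t'' : k} (h : s * t' - s' * t ≠ 0) (h' : s * t'' - s'' * t ≠ 0)
    (f g g' : A →ₗ[k] k) (hf : Function.Surjective f)
    (hg : Function.Surjective (g.prod g')) :
    (univ.filter (fun ω : A × A => f (s • ω.1 + t • ω.2) = 0 ∧ g (s' • ω.1 + t' • ω.2) = 0 ∧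
      g' (s'' • ω.1 + t'' • ω.2) = 0)).card * Fintype.card k ^ 3 = Fintype.card A ^ 2 := by
  let e : k → k → (A × A →ₗ[k] A) := fun s t => s • LinearMap.fst k A A + t • LinearMap.snd k A A
  have he : ∀ s t ω, e s t ω = s • ω.1 + t • ω.2 := by intro s t ω; simp [e]
  let Ψ : A × A →ₗ[k] k × (k × k) := (f ∘ₗ e s t).prod ((g ∘ₗ e s' t').prod (g' ∘ₗ e s'' t''))
  have hΨ : Function.Surjective Ψ := by
    rintro ⟨z1, z2, z3⟩
    obtain ⟨x, hx⟩ := hf z1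
    let Δ := s * t' - s' * t
    let c := (s'' * t' - s' * t'') / Δ
    let c' := (s * t'' - s'' * t) / Δ
    have hc' : c' ≠ 0 := div_ne_zero h' h
    obtain ⟨y, hy⟩ := hg (z2, (z3 - c * g' x) / c')
    obtain ⟨ω, hω⟩ := (pair_bij (A := A) h).2 (x, y)
    simp only [Prod.mk.injEq] at hω
    have hy1 : g y = z2 := congrArg Prod.fst hy
    have hy2 : g' y = (z3 - c * g' x) / c' := congrArg Prod.snd hy
    refine ⟨ω, ?_⟩
    have e3 : s'' • ω.1 + t'' • ω.2 = c • x + c' • y := by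
      rw [← hω.1, ← hω.2]
      have h1 : s'' = c * s + c' * s' := by
        show s'' = (s'' * t' - s' * t'') / (s * t' - s' * t) * s +
          (s * t'' - s'' * t) / (s * t' - s' * t) * s'
        rw [div_mul_eq_mul_div, div_mul_eq_mul_div, ← add_div, eq_div_iff h]; ring
      have h2 : t'' = c * t + c' * t' := by
        show t'' = (s'' * t' - s' * t'') / (s * t' - s' * t) * t +
          (s * t'' - s'' * t) / (s * t' - s' * t) * t'
        rw [div_mul_eq_mul_div, div_mul_eq_mul_div, ← add_div, eq_div_iff h]; ring
      nth_rewrite 1 [h1]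
      nth_rewrite 1 [h2]
      module
    show (f (e s t ω), g (e s' t' ω), g' (e s'' t'' ω)) = _
    rw [he, he, he, hω.1, hω.2, e3, hx, hy1, map_add, map_smul, map_smul, hy2, smul_eq_mul,
      smul_eq_mul, mul_div_cancel₀ _ hc']
    simp
  have := card_ker_mul Ψ hΨ
  rw [Nat.card_prod, Nat.card_prod, Nat.card_prod] at this
  simp only [Nat.card_eq_fintype_card] at this
  rw [pow_three, sq, ← this]
  congr 1
  refine (Nat.subtype_card (p := fun ω => ω ∈ LinearMap.ker Ψ) _ fun ω => ?_).symm
  simp [Ψ, he]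

theorem ite_mul2 (P Q : Prop) [Decidable P] [Decidable Q] :
    (if P then (1:ℝ) else 0) * (if Q then 1 else 0) = if P ∧ Q then 1 else 0 := by
  by_cases P <;> by_cases Q <;> simp_all

theorem ite_mul3 (P Q R : Prop) [Decidable P] [Decidable Q] [Decidable R] :
    (if P then (1:ℝ) else 0) * (if Q then 1 else 0) * (if R then 1 else 0) =
      if P ∧ Q ∧ R then 1 else 0 := by
  by_cases P <;> by_cases Q <;> by_cases R <;> simp_all

set_option maxHeartbeats 1000000 in
/-- The main counting lemma. -/
theorem counting (sv tv : I → k) (hst : ∀ i j, i ≠ j → sv i * tv j - sv j * tv i ≠ 0)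
    (hI : Fintype.card I = Fintype.card k + 1)
    (ks : I → ℕ) (S Z : I → Finset A)
    (hS1 : ∀ i, (S i).card * Fintype.card k ≤ ks i * Fintype.card A)
    (hS3 : ∀ i j l, i ≠ j → i ≠ l → j ≠ l →
      (univ.filter (fun ω : A × A => sv i • ω.1 + tv i • ω.2 ∈ S i ∧
        sv j • ω.1 + tv j • ω.2 ∈ S j ∧ sv l • ω.1 + tv l • ω.2 ∈ S l)).card * Fintype.card k ^ 3
        ≤ ks i * ks j * ks l * Fintype.card A ^ 2)
    (hk : ∑ i, ks i ≤ Fintype.card k + 1) (D : ℕ) (hD : 1 ≤ D) (hkD : ∀ i, ks i ≤ D)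
    (hZ : ∀ i, (Z i).card * Fintype.card k ^ 2 ≤ D * Fintype.card A)
    (hq : 36 * D ^ 2 ≤ Fintype.card k) :
    ∃ ω : A × A, ∀ i, sv i • ω.1 + tv i • ω.2 ∉ S i ∧ sv i • ω.1 + tv i • ω.2 ∉ Z i := by
  set q := Fintype.card k with hqdef
  set Q := Fintype.card A with hQdef
  have hq0 : 0 < q := Fintype.card_pos
  have hQ0 : 0 < Q := Fintype.card_pos
  have hqR : (0:ℝ) < q := by exact_mod_cast hq0
  have hQR : (0:ℝ) < Q := by exact_mod_cast hQ0
  have hpair := fun i j (hij : i ≠ j) (T T' : Finset A) => card_pair (hst i j hij) T T'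
  have hsingle : ∀ i (T : Finset A),
      (univ.filter (fun ω : A × A => sv i • ω.1 + tv i • ω.2 ∈ T)).card = T.card * Q := by
    intro i T
    have : Nontrivial I := by
      rw [← Fintype.one_lt_card_iff_nontrivial]; omega
    obtain ⟨j, hj⟩ := exists_ne i
    have := hpair i j hj.symm T univ
    simpa using this
  let ι : I → A × A → ℝ := fun i ω => if sv i • ω.1 + tv i • ω.2 ∈ S i then 1 else 0
  have hι : ∀ ω i, ι i ω * ι i ω = ι i ω := by
    intro ω i; simp only [ι]; split_ifs <;> simp
  let X : A × A → ℕ := fun ω => (univ.filter (fun i => sv i • ω.1 + tv i • ω.2 ∈ S i)).card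
  have hX : ∀ ω, (X ω : ℝ) = ∑ i, ι i ω := by
    intro ω; simp [X, ι]
  by_contra! hcon
  let x : ℝ := ∑ i, (S i).card / Q
  let σ2 : ℝ := ∑ i, ((S i).card / Q : ℝ) ^ 2
  have hσi : ∀ i, ((S i).card / Q : ℝ) ≤ ks i / q := by
    intro i
    rw [div_le_div_iff₀ hQR hqR]
    exact_mod_cast hS1 i
  have hσ : σ2 ≤ ((q:ℝ) + 1) * D ^ 2 / q ^ 2 := by
    have : σ2 ≤ ∑ i : I, ((D:ℝ) / q) ^ 2 := by
      refine sum_le_sum fun i _ => pow_le_pow_left₀ (by positivity) ((hσi i).trans ?_) 2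
      have := hkD i
      gcongr
    refine this.trans (le_of_eq ?_)
    rw [sum_const, card_univ, hI, nsmul_eq_mul]
    push_cast
    rw [div_pow, mul_div_assoc]
  have num := num_ineq (x := x) (σ2 := σ2) (q := q) (D := D) (by exact_mod_cast hD)
    (by exact_mod_cast hq) hσ
  have s1 : ∀ i, ∑ ω, ι i ω = (S i).card * Q := by
    intro i
    simp only [ι, sum_boole]
    exact_mod_cast hsingle i (S i)
  have s2 : ∀ i j, ∑ ω, (if i = j then 0 else ι i ω * ι j ω) =
      if i = j then 0 else ((S i).card * (S j).card : ℝ) := by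
    intro i j
    split_ifs with hij
    · simp
    · have := hpair i j hij (S i) (S j)
      rw [← Nat.cast_mul, ← this]
      have hp : ∀ ω, ι i ω * ι j ω = if (sv i • ω.1 + tv i • ω.2 ∈ S i ∧
          sv j • ω.1 + tv j • ω.2 ∈ S j) then 1 else 0 := by
        intro ω; exact ite_mul2 _ _
      simp only [hp, sum_boole]
  have s3 : ∀ i j l, ∑ ω, (if i ≠ j ∧ i ≠ l ∧ j ≠ l then ι i ω * ι j ω * ι l ω else 0) ≤
      (ks i * ks j * ks l : ℝ) * (Q ^ 2 / q ^ 3) := by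
    intro i j l
    split_ifs with h
    · have := hS3 i j l h.1 h.2.1 h.2.2
      rw [← mul_div_assoc, le_div_iff₀ (by positivity)]
      have hp : ∀ ω, ι i ω * ι j ω * ι l ω = if (sv i • ω.1 + tv i • ω.2 ∈ S i ∧
          sv j • ω.1 + tv j • ω.2 ∈ S j ∧ sv l • ω.1 + tv l • ω.2 ∈ S l) then 1 else 0 := by
        intro ω; exact ite_mul3 _ _ _
      simp only [hp, sum_boole]
      exact_mod_cast this
    · simp only [sum_const_zero]; positivity
  have hz : ∀ ω, (if X ω = 0 then (1:ℝ) else 0) ≤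
      ∑ i, if sv i • ω.1 + tv i • ω.2 ∈ Z i then (1:ℝ) else 0 := by
    intro ω
    split_ifs with h
    · obtain ⟨i, hi⟩ := hcon ω
      have h0 : ∀ i, sv i • ω.1 + tv i • ω.2 ∉ S i := by
        simpa [X, filter_eq_empty_iff] using h
      have hi := hi (h0 i)
      refine le_trans ?_ (single_le_sum (fun j _ => ?_) (mem_univ i))
      · rw [if_pos hi]
      · split_ifs <;> norm_num
    · exact sum_nonneg fun j _ => by split_ifs <;> norm_num
  have hpt : ∀ ω, 1 - ∑ i, ι i ω + (∑ i, ∑ j, (if i = j then 0 else ι i ω * ι j ω)) / 2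
      - (∑ i, ∑ j, ∑ l, (if i ≠ j ∧ i ≠ l ∧ j ≠ l then ι i ω * ι j ω * ι l ω else 0)) / 6 ≤
      ∑ i, if sv i • ω.1 + tv i • ω.2 ∈ Z i then (1:ℝ) else 0 := by
    intro ω
    refine le_trans ?_ (hz ω)
    rw [ind_pair _ (hι ω), ind_triple _ (hι ω), ← hX]
    exact bonf (X ω)
  have htot := sum_le_sum (fun ω (_ : ω ∈ (univ : Finset (A × A))) => hpt ω)
  rw [sum_sub_distrib, sum_add_distrib, sum_sub_distrib, ← sum_div, ← sum_div] at htot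
  have t0 : ∑ _ω : A × A, (1:ℝ) = Q ^ 2 := by
    simp [sq, hQdef]
  have t1 : ∑ ω, ∑ i, ι i ω = x * Q ^ 2 := by
    rw [sum_comm]; simp_rw [s1, x, sum_mul]
    refine sum_congr rfl fun i _ => ?_
    field_simp
  have t2 : ∑ ω, ∑ i, ∑ j, (if i = j then 0 else ι i ω * ι j ω) = (x ^ 2 - σ2) * Q ^ 2 := by
    rw [sum_comm]
    have : ∀ i, ∑ ω, ∑ j, (if i = j then 0 else ι i ω * ι j ω) =
        ∑ j, if i = j then 0 else ((S i).card * (S j).card : ℝ) := by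
      intro i; rw [sum_comm]; simp_rw [s2]
    simp_rw [this]
    have : ∀ i j, (if i = j then 0 else ((S i).card * (S j).card : ℝ)) =
        (S i).card * (S j).card - (if i = j then ((S i).card ^ 2 : ℝ) else 0) := by
      intro i j; split_ifs with hij
      · subst hij; ring
      · ring
    simp_rw [this, sum_sub_distrib, sum_ite_eq, mem_univ, if_true, ← sum_mul_sum]
    simp only [x, σ2, ← sum_div, div_pow]
    field_simp
  have t3 : ∑ ω, ∑ i, ∑ j, ∑ l, (if i ≠ j ∧ i ≠ l ∧ j ≠ l then ι i ω * ι j ω * ι l ω else 0) ≤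
      (((q:ℝ) + 1) / q) ^ 3 * Q ^ 2 := by
    have h1 : ∑ ω, ∑ i, ∑ j, ∑ l, (if i ≠ j ∧ i ≠ l ∧ j ≠ l then ι i ω * ι j ω * ι l ω else 0) ≤
        ∑ i, ∑ j, ∑ l, (ks i * ks j * ks l : ℝ) * (Q ^ 2 / q ^ 3) := by
      rw [sum_comm]
      refine sum_le_sum fun i _ => ?_
      rw [sum_comm]
      refine sum_le_sum fun j _ => ?_
      rw [sum_comm]
      exact sum_le_sum fun l _ => s3 i j l
    refine h1.trans ?_
    have h2 : ∑ i, ∑ j, ∑ l, (ks i * ks j * ks l : ℝ) * (Q ^ 2 / q ^ 3) =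
        (∑ i, (ks i : ℝ)) ^ 3 * (Q ^ 2 / q ^ 3) := by
      simp_rw [← sum_mul, ← mul_sum, ← sum_mul]
      rw [pow_three, mul_assoc]
      simp_rw [← mul_sum, ← sum_mul]
      ring
    rw [h2, div_pow, div_mul_eq_mul_div, ← mul_div_assoc]
    have h3 : (∑ i, (ks i : ℝ)) ≤ q + 1 := by exact_mod_cast hk
    have h4 : 0 ≤ (∑ i, (ks i : ℝ)) := by positivity
    gcongr
  have t4 : ∑ ω : A × A, ∑ i, (if sv i • ω.1 + tv i • ω.2 ∈ Z i then (1:ℝ) else 0) ≤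
      ((q:ℝ) + 1) * D / q ^ 2 * Q ^ 2 := by
    rw [sum_comm]
    have : ∀ i, ∑ ω : A × A, (if sv i • ω.1 + tv i • ω.2 ∈ Z i then (1:ℝ) else 0) ≤
        D / q ^ 2 * Q ^ 2 := by
      intro i
      rw [sum_boole, hsingle i (Z i)]
      have h : ((Z i).card * q ^ 2 : ℝ) ≤ D * Q := by exact_mod_cast hZ i
      have h' : ((Z i).card : ℝ) ≤ D * Q / q ^ 2 := by
        rw [le_div_iff₀ (by positivity)]; exact h
      push_cast
      calc ((Z i).card : ℝ) * Q ≤ D * Q / q ^ 2 * Q := by gcongr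
        _ = _ := by ring
    refine (sum_le_sum fun i _ => this i).trans (le_of_eq ?_)
    rw [sum_const, card_univ, hI, nsmul_eq_mul]
    push_cast
    ring
  rw [t0, t1, t2] at htot
  have hQ2 : (0:ℝ) < Q ^ 2 := by positivity
  have := mul_lt_mul_of_pos_right num hQ2
  nlinarith

end Counting

set_option linter.unusedSectionVars false
section CaseD
variable {k L K : Type*} [Field k] [Fintype k] [Field L] [Finite L] [Algebra k L]
  [Field K] [Algebra k K] [Algebra L K] [IsScalarTower k L K]
variable {r : ℕ} (b : Module.Basis (Fin r) k L)

/-- the inseparable term -/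
noncomputable def Eb (d p : ℕ) (β : L) : MvPolynomial (Fin r) L :=
  C β * (lf b 0 ^ (d - p) * lf b 1 ^ p)

theorem Eb_hom {d p : ℕ} (hp : p ≤ d) (β : L) : (Eb b d p β).IsHomogeneous d := by
  refine IsHomogeneous.C_mul ?_ _
  have := ((lf_hom b 0).pow (d-p)).mul ((lf_hom b 1).pow p)
  convert this using 1; omega

theorem Eb_pderiv {d p : ℕ} (hp : p ∣ d) (hpL : (p : L) = 0) (β : L) (j : Fin r) :
    pderiv j (Eb b d p β) = 0 := by
  obtain ⟨e, rfl⟩ := hp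
  have h : p * e - p = (e - 1) * p := by rw [Nat.sub_mul, mul_comm, one_mul]
  have hC : (p : MvPolynomial (Fin r) L) = 0 := by
    rw [← map_natCast (C : L →+* MvPolynomial (Fin r) L), hpL, map_zero]
  rw [Eb, h, pow_mul, ← mul_pow, pderiv_C_mul, pderiv_pow, hC]
  simp

/-- multiplicative critical data -/
structure Crit (k : Type*) {L K : Type*} [Field k] [Fintype k] [Field L] [Finite L] [Algebra k L]
    [Field K] [Algebra k K] [Algebra L K] [IsScalarTower k L K]
    (r d : ℕ) (α : L) (u : ℕ → K) : Prop where
  ne : ∀ i, u i ≠ 0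
  per : ∀ i, u (i + r) = u i
  rel : ∀ i, fr k L K (i+1) α * u i ^ (d-1) * u (i+1) = fr k L K i α
  prod : ∏ i ∈ Finset.range r, u i = 1

/-- the linear form attached to critical data -/
noncomputable def eps (k : Type*) {L K : Type*} [Field k] [Fintype k] [Field L] [Finite L]
    [Algebra k L] [Field K] [Algebra k K] [Algebra L K] [IsScalarTower k L K]
    (r p : ℕ) (α : L) (u : ℕ → K) : L × L →ₗ[k] K where
  toFun x := ∑ i ∈ Finset.range r,
    (fr k L K i x.1 + fr k L K i x.2 * u i ^ p) / (fr k L K i α * u i)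
  map_add' x y := by
    rw [← Finset.sum_add_distrib]
    refine Finset.sum_congr rfl fun i _ => ?_
    simp only [Prod.fst_add, Prod.snd_add, map_add]
    ring
  map_smul' c x := by
    simp only [Prod.smul_fst, Prod.smul_snd, fr_smul, RingHom.id_apply, Algebra.smul_def (A := K),
      Finset.mul_sum]
    refine Finset.sum_congr rfl fun i _ => ?_
    ring

theorem eps_apply (p : ℕ) (α : L) (u : ℕ → K) (x : L × L) : eps k r p α u x =
    ∑ i ∈ Finset.range r,
    (fr k L K i x.1 + fr k L K i x.2 * u i ^ p) / (fr k L K i α * u i) := rfl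

theorem bad {d p : ℕ} (hd : 3 ≤ d) (hr0 : 1 ≤ r) (hdK : (d : K) = 0) (hrK : (r : K) = 0)
    (hp : p ∣ d) (hpL : (p : L) = 0) {α a β : L} (hα : α ≠ 0) {v : Fin r → K} (hv : v ≠ 0)
    (h : SingAt (traceMap (k := k) (Pol b d 1 α a (Eb b d p β))) v) :
    ∃ u : ℕ → K, Crit k r d α u ∧ eps k r p α u (a, β) = 0 := by
  obtain ⟨h1, h2⟩ := h
  have hr : Module.finrank k L = r := by simpa using Module.finrank_eq_card_basis b
  have hpd : p ≤ d := Nat.le_of_dvd (by omega) hp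
  obtain ⟨i0, hi0⟩ := Yv_ne b v hv
  have hc := crit_eq b (by omega) hr0 hdK (Eb_pderiv b hp hpL β) h2
  have hcc := crit_const (by omega) hc
  have hY : ∀ i, Yv K b v (i + r) = Yv K b v i := Yv_add b v
  have hA : ∀ i, fr k L K i α ≠ 0 := fun i => fr_ne hα
  have hne : ∀ i, Yv K b v i ≠ 0 := fun i hi =>
    hi0 (crit_zero hd hr0 (A := fun i => fr k L K i α) hA hY hc hi i0)
  have hEv : ∀ i, eval v (map (fr k L K i) (Eb b d p β)) =
      fr k L K i β * (Yv K b v i ^ (d-p) * Yv K b v (i+1) ^ p) := by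
    intro i
    simp only [Eb, map_mul, map_pow, eval_lf, map_C, eval_C, add_zero]
  rw [value_eq] at h1
  simp only [hEv] at h1
  set Y := Yv K b v with hYdef
  set c := fr k L K 0 α * Y 0 ^ (d-1) * Y 1 with hcdef
  have hc0 : c ≠ 0 := mul_ne_zero (mul_ne_zero (hA 0) (pow_ne_zero _ (hne 0))) (hne 1)
  refine ⟨fun i => Y (i+1) / Y i, ⟨fun i => div_ne_zero (hne _) (hne _), fun i => ?_, fun i => ?_, ?_⟩, ?_⟩
  · show Y (i + r + 1) / Y (i + r) = _
    rw [show i + r + 1 = i + 1 + r by ring, hY, hY]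
  · show fr k L K (i+1) α * (Y (i+1) / Y i) ^ (d-1) * (Y (i+1+1) / Y (i+1)) = _
    have h3 := hc i
    have : fr k L K (i+1) α * (Y (i+1) / Y i) ^ (d-1) * (Y (i+1+1) / Y (i+1)) =
      (fr k L K (i+1) α * Y (i+1) ^ (d-2) * Y (i+2)) / Y i ^ (d-1) := by
      have h4 := hne i
      have h5 := hne (i+1)
      rw [div_pow, show d - 1 = d - 2 + 1 by omega, pow_succ (Y (i+1))]
      field_simp
    rw [this, ← h3]
    have h4 := hne i
    field_simp
  · have : ∀ m, ∏ i ∈ Finset.range m, (Y (i+1) / Y i) = Y m / Y 0 := by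
      intro m
      induction m with
      | zero => simp [hne]
      | succ m ih =>
        rw [Finset.prod_range_succ, ih]
        have h4 := hne m
        have h5 := hne 0
        field_simp
    rw [this, ← zero_add r, hY, div_self (hne 0)]
  · rw [eps_apply]
    have key : ∀ i, (fr k L K i a + fr k L K i β * (Y (i+1) / Y i) ^ p) /
        (fr k L K i α * (Y (i+1) / Y i)) = (fr k L K i a * Y i ^ d +
          fr k L K i β * (Y i ^ (d-p) * Y (i+1) ^ p)) / c := by
      intro i
      have h3 := hcc i
      have h4 := hne i
      have h5 := hne (i+1)
      have h6 := hA i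
      have e1 : Y i ^ d = Y i ^ (d - p) * Y i ^ p := by rw [← pow_add]; congr 1; omega
      have e2 : Y i ^ d = Y i ^ (d - 1) * Y i := by rw [← pow_succ]; congr 1; omega
      have e3 : c * Y i = fr k L K i α * Y (i+1) * Y i ^ d := by
        rw [← h3, e2]; ring
      rw [div_eq_div_iff (mul_ne_zero h6 (div_ne_zero h5 h4)) hc0, div_pow]
      have e4 : Y i ^ (d-p) = Y i ^ d / Y i ^ p := by
        rw [e1, mul_div_cancel_right₀ _ (pow_ne_zero _ h4)]
      rw [e4]
      have h7 : Y i ^ p ≠ 0 := pow_ne_zero _ h4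
      field_simp
      linear_combination (fr k L K i a * Y i ^ p + fr k L K i β * Y (i+1) ^ p) * e3
    simp only [key]
    rw [← Finset.sum_div]
    have : ∑ i ∈ Finset.range r, (fr k L K i a * Y i ^ d +
          fr k L K i β * (Y i ^ (d-p) * Y (i+1) ^ p)) = 0 := by
      rw [← h1]
      simp only [← mul_assoc, hcc, add_assoc]
      rw [Finset.sum_add_distrib (f := fun _ => c)]
      simp [hrK]
    rw [this, zero_div]

/-- auxiliary constants -/
noncomputable def Cc (A : ℕ → K) (m : ℕ) : ℕ → K
  | 0 => 1
  | i + 1 => A i / A (i+1) / Cc A m i ^ m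

theorem Cc_ne {A : ℕ → K} (hA : ∀ i, A i ≠ 0) (m i : ℕ) : Cc A m i ≠ 0 := by
  induction i with
  | zero => simp [Cc]
  | succ i ih => exact div_ne_zero (div_ne_zero (hA _) (hA _)) (pow_ne_zero _ ih)

theorem Cc_spec {A u : ℕ → K} (hA : ∀ i, A i ≠ 0) (hu : ∀ i, u i ≠ 0) (m : ℕ)
    (h : ∀ i, A (i+1) * u i ^ m * u (i+1) = A i) (i : ℕ) :
    (Even i → u i = Cc A m i * u 0 ^ (m ^ i)) ∧ (¬ Even i → u i * u 0 ^ (m ^ i) = Cc A m i) := by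
  induction i with
  | zero => simp [Cc]
  | succ i ih =>
    have h1 := h i
    have hC := Cc_ne hA m i
    have hu0 := hu 0
    have e : m ^ (i+1) = m ^ i * m := pow_succ _ _
    have hA1 := hA (i+1)
    have hCm : Cc A m i ^ m ≠ 0 := pow_ne_zero _ hC
    rw [Nat.even_add_one]
    constructor
    · intro hi
      have h2 := ih.2 hi
      simp only [Cc]
      rw [div_div, div_mul_eq_mul_div, eq_div_iff (mul_ne_zero hA1 hCm), ← h1, e, pow_mul, ← h2,
        mul_pow]
      ring
    · intro hi
      rw [not_not] at hi
      have h2 := ih.1 hi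
      simp only [Cc]
      rw [div_div, eq_div_iff (mul_ne_zero hA1 hCm), ← h1, e, pow_mul, h2, mul_pow]
      ring

theorem crit_ext {d : ℕ} {α : L} (hα : α ≠ 0) {u u' : ℕ → K} (hu : Crit k r d α u)
    (hu' : Crit k r d α u') (h : u 0 = u' 0) : u = u' := by
  funext i
  induction i with
  | zero => exact h
  | succ i ih =>
    have h1 := hu.rel i
    rw [← hu'.rel i, ih] at h1
    exact mul_left_cancel₀ (mul_ne_zero (fr_ne hα) (pow_ne_zero _ (hu'.ne i))) h1

theorem crit_finite {d : ℕ} (hd : 3 ≤ d) (hr : 1 ≤ r) {α : L} (hα : α ≠ 0) :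
    {u : ℕ → K | Crit k r d α u}.Finite ∧ {u : ℕ → K | Crit k r d α u}.ncard ≤ (d-1) ^ r + 1 := by
  classical
  set A : ℕ → K := fun i => fr k L K i α
  have hA : ∀ i, A i ≠ 0 := fun i => fr_ne hα
  have hm1 : 1 < (d-1)^r := Nat.one_lt_pow (by omega) (by omega)
  obtain ⟨P, hP0, hPd, hP⟩ : ∃ P : Polynomial K, P ≠ 0 ∧ P.natDegree ≤ (d-1)^r + 1 ∧
      ∀ u : ℕ → K, Crit k r d α u → P.eval (u 0) = 0 := by
    have hC := Cc_ne hA (d-1) r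
    by_cases he : Even r
    · refine ⟨Polynomial.C (Cc A (d-1) r) * Polynomial.X ^ ((d-1)^r) - Polynomial.X, ?_, ?_, ?_⟩
      · intro h
        have := congrArg (fun P => Polynomial.coeff P ((d-1)^r)) h
        simp [Polynomial.coeff_X, hm1.ne, hC] at this
      · refine (Polynomial.natDegree_sub_le _ _).trans (max_le ?_ ?_)
        · exact (Polynomial.natDegree_C_mul_X_pow_le _ _).trans (by omega)
        · rw [Polynomial.natDegree_X]; omega
      · intro u hu
        have := (Cc_spec hA hu.ne (d-1) hu.rel r).1 he
        have h2 := hu.per 0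
        rw [zero_add] at h2
        simp [← this, h2]
    · refine ⟨Polynomial.X ^ ((d-1)^r+1) - Polynomial.C (Cc A (d-1) r), ?_, ?_, ?_⟩
      · exact Polynomial.X_pow_sub_C_ne_zero (by omega) _
      · rw [Polynomial.natDegree_X_pow_sub_C]
      · intro u hu
        have := (Cc_spec hA hu.ne (d-1) hu.rel r).2 he
        have h2 := hu.per 0
        rw [zero_add] at h2
        simp [← this, h2, pow_succ, mul_comm]
  have hmaps : Set.MapsTo (fun u : ℕ → K => u 0) {u : ℕ → K | Crit k r d α u}
      (P.roots.toFinset : Set K) := by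
    intro u hu
    simp [hP0, hP u hu]
  have hinj : Set.InjOn (fun u : ℕ → K => u 0) {u : ℕ → K | Crit k r d α u} :=
    fun u hu u' hu' h => crit_ext hα hu hu' h
  refine ⟨Set.Finite.of_injOn hmaps hinj (Finset.finite_toSet _), ?_⟩
  refine (Set.ncard_le_ncard_of_injOn _ hmaps hinj (Finset.finite_toSet _)).trans ?_
  rw [Set.ncard_coe_finset]
  exact (Multiset.toFinset_card_le _).trans ((Polynomial.card_roots' _).trans hPd)

theorem gam (hr : Module.finrank k L = r) {γ : ℕ → K} (hγ : ∀ i, γ (i + r) = γ i) {κ : K}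
    (h : ∀ a : L, (∑ i ∈ Finset.range r, γ i * fr k L K i a) ^ Fintype.card k =
      κ * ∑ i ∈ Finset.range r, γ i * fr k L K i a) (i : ℕ) :
    γ i ^ Fintype.card k = κ * γ (i+1) := by
  have hr0 : 0 < r := hr ▸ Module.finrank_pos
  let c : ℕ → K := fun i => γ (i + (r-1)) ^ Fintype.card k - κ * γ (i + r)
  have hc : ∀ i, c (i + r) = c i := by
    intro i
    simp only [c]
    rw [show i + r + (r-1) = i + (r-1) + r by ring, hγ, hγ (i+r)]
  have hc1 : ∀ i, c (i+1) = γ i ^ Fintype.card k - κ * γ (i+1) := by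
    intro i
    simp only [c]
    rw [show i + 1 + (r-1) = i + r by omega, hγ, hγ]
  have h0 : ∀ i < r, c i = 0 := by
    refine frob_indep (k := k) (L := L) r hr c fun a => ?_
    simp only [← fr_apply (k := k)]
    rw [← sum_range_shift (fun i => c i * fr k L K i a) r (by
      intro i; rw [hc, fr_add r hr]) 1]
    simp only [hc1, sub_mul, Finset.sum_sub_distrib]
    rw [sub_eq_zero]
    have h1 := h a
    rw [← sum_range_shift (fun i => γ i * fr k L K i a) r (by
      intro i; rw [hγ, fr_add r hr]) 1, Finset.mul_sum] at h1
    rw [sum_range_shift (fun i => γ i * fr k L K i a) r (by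
      intro i; rw [hγ, fr_add r hr]) 1] at h1
    simp only [mul_assoc]
    rw [← h1]
    have h2 := map_sum (FiniteField.frobeniusAlgHom k K) (fun i => γ i * fr k L K i a) (Finset.range r)
    simp only [FiniteField.coe_frobeniusAlgHom] at h2
    rw [h2]
    exact Finset.sum_congr rfl fun i _ => by rw [mul_pow, fr_succ]
  have h1 : c (i+1) = 0 := by
    rw [← Nat.mod_add_div (i+1) r, periodic_mul hc]
    exact h0 _ (Nat.mod_lt _ hr0)
  rw [hc1] at h1
  exact sub_eq_zero.1 h1
end CaseD

set_option linter.unusedSectionVars false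
section CaseD2
variable {k L K : Type*} [Field k] [Fintype k] [Field L] [Fintype L] [Algebra k L]
  [Field K] [Algebra k K] [Algebra L K] [IsScalarTower k L K]
variable {r : ℕ}

open Classical in
/-- rational critical points -/
noncomputable def RatS (k : Type*) {L : Type*} [Fintype k] [Field L] [Fintype L] (r d : ℕ) (α : L) :
    Finset L :=
  Finset.univ.filter fun w => w ^ (∑ i ∈ Finset.range r, Fintype.card k ^ i) = 1 ∧
    α ^ Fintype.card k * w ^ (d - 1) * w ^ Fintype.card k = α

theorem mem_RatS {d : ℕ} {α w : L} : w ∈ RatS k r d α ↔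
    w ^ (∑ i ∈ Finset.range r, Fintype.card k ^ i) = 1 ∧
    α ^ Fintype.card k * w ^ (d - 1) * w ^ Fintype.card k = α := by
  simp [RatS]

theorem theta_pos (hr : 1 ≤ r) : 0 < ∑ i ∈ Finset.range r, Fintype.card k ^ i :=
  Finset.sum_pos (fun i _ => pow_pos Fintype.card_pos _) ⟨0, by simp; omega⟩

theorem RatS_ne (hr : 1 ≤ r) {d : ℕ} {α w : L} (h : w ∈ RatS k r d α) : w ≠ 0 := by
  rintro rfl
  have := (mem_RatS.1 h).1
  rw [zero_pow (theta_pos hr).ne'] at this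
  exact zero_ne_one this

theorem RatS_crit (hr : Module.finrank k L = r) {d : ℕ} {α w : L} (h : w ∈ RatS k r d α) :
    Crit k r d α (fun i => fr k L K i w) := by
  have hr0 : 1 ≤ r := hr ▸ Module.finrank_pos
  have hw := RatS_ne hr0 h
  rw [mem_RatS] at h
  refine ⟨fun i => fr_ne hw, fun i => fr_add r hr i w, fun i => ?_, ?_⟩
  · have := congrArg (fr k L K i) h.2
    rw [map_mul, map_mul, map_pow, map_pow, map_pow, ← fr_succ, ← fr_succ] at this
    exact this
  · simp only [fr_apply, Finset.prod_pow_eq_pow_sum]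
    rw [← map_pow, h.1, map_one]

theorem RatS_card (K : Type*) [Field K] [Algebra k K] [Algebra L K] [IsScalarTower k L K]
    (hr : Module.finrank k L = r) {d : ℕ} (hd : 3 ≤ d) {α : L} (hα : α ≠ 0) :
    (RatS k r d α).card ≤ (d-1)^r + 1 := by
  have hr0 : 1 ≤ r := hr ▸ Module.finrank_pos
  obtain ⟨hf, hc⟩ := crit_finite (k := k) (K := K) hd hr0 hα
  refine le_trans ?_ hc
  rw [← Set.ncard_coe_finset]
  refine Set.ncard_le_ncard_of_injOn (fun w i => fr k L K i w) (fun w hw => RatS_crit hr hw) ?_ hf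
  intro w _ w' _ h
  exact (fr k L K 0).injective (congrFun h 0)

/-- the rational linear form -/
noncomputable def ff (k : Type*) {L : Type*} [Field k] [Field L] [Algebra k L] (ξ η : L) :
    L × L →ₗ[k] k :=
  Algebra.trace k L ∘ₗ (LinearMap.mulLeft k ξ ∘ₗ (LinearMap.fst k L L +
    LinearMap.mulRight k η ∘ₗ LinearMap.snd k L L))

theorem ff_apply (ξ η : L) (x : L × L) : ff k ξ η x = Algebra.trace k L (ξ * (x.1 + x.2 * η)) := rfl

theorem eps_fr (hr : Module.finrank k L = r) (p : ℕ) (α w : L) (x : L × L) :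
    eps k r p α (fun i => fr k L K i w) x = algebraMap k K (ff k (α * w)⁻¹ (w ^ p) x) := by
  rw [eps_apply, ff_apply, trace_fr r hr]
  refine Finset.sum_congr rfl fun i _ => ?_
  simp only [map_mul, map_add, map_inv₀, map_pow]
  rw [div_eq_inv_mul]

theorem trace_nondeg [FiniteDimensional k L] {z : L} (h : ∀ x, Algebra.trace k L (z * x) = 0) :
    z = 0 := by
  have := (traceForm_nondegenerate k L).1 z (by simpa [Algebra.traceForm_apply] using h)
  exact this

theorem ff_surj [FiniteDimensional k L] {ξ : L} (hξ : ξ ≠ 0) (η : L) :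
    Function.Surjective (ff k ξ η) := by
  refine LinearMap.surjective fun h => hξ (trace_nondeg (k := k) fun x => ?_)
  have := LinearMap.congr_fun h (x, 0)
  simpa [ff_apply] using this

theorem ff_pair [FiniteDimensional k L] {ξ η ξ' η' : L} (hξ : ξ ≠ 0) (hξ' : ξ' ≠ 0)
    (h : η = η' → ∀ c c' : k, c • ξ + c' • ξ' = 0 → c = 0 ∧ c' = 0) :
    Function.Surjective ((ff k ξ η).prod (ff k ξ' η')) := by
  by_contra hcon
  rw [← LinearMap.range_eq_top] at hcon
  obtain ⟨f, hf, hle⟩ := Submodule.exists_le_ker_of_lt_top _ (lt_top_iff_ne_top.2 hcon)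
  let c := f (1, 0)
  let c' := f (0, 1)
  have hfc : ∀ x y, f (x, y) = c * x + c' * y := by
    intro x y
    have : (x, y) = x • ((1:k), (0:k)) + y • ((0:k), (1:k)) := by simp
    rw [this, map_add, map_smul, map_smul, smul_eq_mul, smul_eq_mul, mul_comm x, mul_comm y]
  have hz : ∀ x, c * ff k ξ η x + c' * ff k ξ' η' x = 0 := by
    intro x
    rw [← hfc]
    exact LinearMap.mem_ker.1 (hle (LinearMap.mem_range_self _ x))
  have h1 : c • ξ + c' • ξ' = 0 := by
    refine trace_nondeg (k := k) fun x => ?_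
    have := hz (x, 0)
    simp only [ff_apply, zero_mul, add_zero] at this
    rw [add_mul, map_add, smul_mul_assoc, smul_mul_assoc, map_smul, map_smul]
    exact this
  have h2 : c • (ξ * η) + c' • (ξ' * η') = 0 := by
    refine trace_nondeg (k := k) fun x => ?_
    have := hz (0, x)
    simp only [ff_apply, zero_add] at this
    rw [add_mul, map_add, smul_mul_assoc, smul_mul_assoc, map_smul, map_smul]
    rw [mul_assoc, mul_assoc, mul_comm η, mul_comm η']
    exact this
  have h3 : c = 0 ∧ c' = 0 := by
    by_cases hη : η = η'
    · exact h hη c c' h1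
    · have h4 : c • (ξ * (η - η')) = 0 := by
        have : c • (ξ * (η - η')) = (c • (ξ * η) + c' • (ξ' * η')) - (c • ξ + c' • ξ') * η' := by
          simp only [Algebra.smul_def]; ring
        rw [this, h1, h2]; simp
      have hc : c = 0 := by
        rw [smul_eq_zero] at h4
        exact h4.resolve_right (mul_ne_zero hξ (sub_ne_zero.2 hη))
      rw [hc, zero_smul, zero_add, smul_eq_zero] at h1
      exact ⟨hc, h1.resolve_right hξ'⟩
  apply hf
  ext
  · exact h3.1
  · exact h3.2

theorem exists_preim (hr : Module.finrank k L = r) {x : K} (hx : x ^ Fintype.card k ^ r = x) :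
    ∃ w : L, algebraMap L K w = x := by
  classical
  have hcard : Fintype.card L = Fintype.card k ^ r := by
    rw [← hr]; exact Module.card_eq_pow_finrank
  have h1 : 1 < Fintype.card L := Fintype.one_lt_card
  let P : Polynomial K := Polynomial.X ^ (Fintype.card L) - Polynomial.X
  have hP : P ≠ 0 := FiniteField.X_pow_card_sub_X_ne_zero K h1
  have hsub : Finset.univ.image (algebraMap L K) ⊆ P.roots.toFinset := by
    intro y hy
    obtain ⟨w, _, rfl⟩ := Finset.mem_image.1 hy
    rw [Multiset.mem_toFinset, Polynomial.mem_roots hP]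
    simp [P, ← map_pow, FiniteField.pow_card]
  have heq := Finset.eq_of_subset_of_card_le hsub (by
    rw [Finset.card_image_of_injective _ (algebraMap L K).injective, Finset.card_univ]
    refine (Multiset.toFinset_card_le _).trans ((Polynomial.card_roots' _).trans ?_)
    rw [FiniteField.X_pow_card_sub_X_natDegree_eq K h1])
  have hx' : x ∈ P.roots.toFinset := by
    rw [Multiset.mem_toFinset, Polynomial.mem_roots hP]
    simp [P, hcard, hx]
  rw [← heq] at hx'
  obtain ⟨w, _, hw⟩ := Finset.mem_image.1 hx'
  exact ⟨w, hw⟩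

theorem dich (hr : Module.finrank k L = r) {d p : ℕ} [Fact p.Prime] [CharP K p] {α : L}
    (hα : α ≠ 0) {u : ℕ → K} (hu : Crit k r d α u)
    (hrange : Module.finrank k (LinearMap.range (eps k r p α u)) ≤ 1) :
    ∃ w ∈ RatS k r d α, u = fun i => fr k L K i w := by
  have hr0 : 1 ≤ r := hr ▸ Module.finrank_pos
  obtain ⟨⟨l, hl⟩, hl'⟩ := finrank_le_one_iff.1 hrange
  have hscal : ∀ x, eps k r p α u x ^ Fintype.card k = l ^ (Fintype.card k - 1) * eps k r p α u x := by
    intro x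
    obtain ⟨c, hc⟩ := hl' ⟨_, LinearMap.mem_range_self _ x⟩
    have hc : c • l = eps k r p α u x := congrArg Subtype.val hc
    have hk : 1 ≤ Fintype.card k := Fintype.card_pos
    rw [← hc, Algebra.smul_def, mul_pow, ← map_pow, FiniteField.pow_card]
    conv_lhs => rw [← Nat.sub_add_cancel hk, pow_succ]
    ring
  have hne := hu.ne
  have hA : ∀ i, fr k L K i α ≠ 0 := fun i => fr_ne hα
  have g1 := gam (γ := fun i => 1 / (fr k L K i α * u i)) (κ := l ^ (Fintype.card k - 1)) hr
    (by intro i; rw [fr_add r hr, hu.per]) (by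
      intro a
      have := hscal (a, 0)
      simpa only [eps_apply, map_zero, zero_mul, add_zero, div_eq_inv_mul, mul_one] using this)
  have g2 := gam (γ := fun i => u i ^ p / (fr k L K i α * u i)) (κ := l ^ (Fintype.card k - 1)) hr
    (by intro i; rw [fr_add r hr, hu.per]) (by
      intro a
      have := hscal (0, a)
      have e : ∀ i, u i ^ p / (fr k L K i α * u i) * fr k L K i a =
        (fr k L K i 0 + fr k L K i a * u i ^ p) / (fr k L K i α * u i) := by
        intro i; rw [map_zero]; ring
      simpa only [eps_apply, e] using this)
  have step : ∀ i, u (i+1) = u i ^ Fintype.card k := by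
    intro i
    have h1 := g1 i
    have h2 := g2 i
    have h3 : (u i ^ Fintype.card k) ^ p = u (i+1) ^ p := by
      have e1 : u i ^ p / (fr k L K i α * u i) = u i ^ p * (1 / (fr k L K i α * u i)) := by ring
      have e2 : u (i+1) ^ p / (fr k L K (i+1) α * u (i+1)) =
        u (i+1) ^ p * (1 / (fr k L K (i+1) α * u (i+1))) := by ring
      have e3 : (1 / (fr k L K i α * u i)) ^ Fintype.card k ≠ 0 :=
        pow_ne_zero _ (one_div_ne_zero (mul_ne_zero (hA i) (hne i)))
      simp only [e1, e2] at h2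
      rw [mul_left_comm, ← h1, mul_pow, ← pow_mul, mul_comm p, pow_mul] at h2
      exact mul_right_cancel₀ e3 h2
    exact (frobenius_inj K p h3).symm
  have hpow : ∀ i, u i = u 0 ^ Fintype.card k ^ i := by
    intro i
    induction i with
    | zero => simp
    | succ i ih => rw [step, ih, ← pow_mul, ← pow_succ]
  have h0 : u 0 ^ Fintype.card k ^ r = u 0 := by
    rw [← hpow]; have := hu.per 0; rwa [zero_add] at this
  obtain ⟨w, hw⟩ := exists_preim (L := L) hr h0
  have hu' : u = fun i => fr k L K i w := by
    funext i; rw [hpow, fr_apply, hw]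
  refine ⟨w, mem_RatS.2 ⟨?_, ?_⟩, hu'⟩
  · apply (algebraMap L K).injective
    have := hu.prod
    rw [hu'] at this
    simp only [fr_apply, Finset.prod_pow_eq_pow_sum] at this
    rw [map_pow, this, map_one]
  · apply (algebraMap L K).injective
    have := hu.rel 0
    rw [hu'] at this
    simpa [fr_apply] using this

open Classical in
theorem RatS_sum (hr : Module.finrank k L = r) {d : ℕ} :
    ∑ α ∈ Finset.univ.filter (fun α : L => α ≠ 0), (RatS k r d α).card ≤ Fintype.card k ^ r - 1 := by
  have hr0 : 1 ≤ r := hr ▸ Module.finrank_pos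
  have hq1 : 1 < Fintype.card k := Fintype.one_lt_card
  set q := Fintype.card k
  set θ := ∑ i ∈ Finset.range r, q ^ i with hθ
  have hθ0 : 0 < θ := theta_pos (k := k) hr0
  have e : θ * (q - 1) = q ^ r - 1 := by
    have := Nat.geomSum_eq (m := q) (by omega) r
    rw [hθ, this, Nat.div_mul_cancel]
    simpa using Nat.sub_dvd_pow_sub_pow q 1 r
  set W : Finset L := Finset.univ.filter fun w => w ^ θ = 1
  have hW : W.card ≤ θ := by
    have : W ⊆ (Polynomial.nthRoots θ (1:L)).toFinset := by
      intro w hw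
      rw [Multiset.mem_toFinset, Polynomial.mem_nthRoots hθ0]
      simpa [W] using hw
    exact (Finset.card_le_card this).trans ((Multiset.toFinset_card_le _).trans
      (Polynomial.card_nthRoots _ _))
  have h1 : ∀ α, (RatS k r d α).card =
      ∑ w ∈ W, if α ^ q * w ^ (d - 1) * w ^ q = α then 1 else 0 := by
    intro α
    rw [← Finset.sum_filter, Finset.sum_const, smul_eq_mul, mul_one]
    congr 1
    ext w
    simp [mem_RatS, W, q, θ]
  simp only [h1]
  rw [Finset.sum_comm, ← e]
  refine le_trans ?_ (Nat.mul_le_mul_right _ hW)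
  rw [← smul_eq_mul, ← Finset.sum_const]
  refine Finset.sum_le_sum fun w hw => ?_
  rw [← Finset.sum_filter, Finset.sum_const, smul_eq_mul, mul_one]
  have hw : w ^ θ = 1 := by simpa [W] using hw
  have hw0 : w ≠ 0 := by
    rintro rfl
    rw [zero_pow hθ0.ne'] at hw
    exact zero_ne_one hw
  have : (Finset.univ.filter (fun α : L => α ≠ 0)).filter
      (fun α => α ^ q * w ^ (d-1) * w ^ q = α) ⊆
      (Polynomial.nthRoots (q-1) ((w ^ (d-1) * w ^ q)⁻¹)).toFinset := by
    intro α hα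
    simp only [Finset.mem_filter, Finset.mem_univ, true_and] at hα
    rw [Multiset.mem_toFinset, Polynomial.mem_nthRoots (by omega)]
    have h2 : α ^ q = α ^ (q-1) * α := by rw [← pow_succ]; congr 1; omega
    have h3 := hα.2
    rw [h2] at h3
    refine eq_inv_of_mul_eq_one_left (mul_right_cancel₀ hα.1 ?_)
    rw [one_mul]
    linear_combination h3
  exact (Finset.card_le_card this).trans ((Multiset.toFinset_card_le _).trans
      (Polynomial.card_nthRoots _ _))

theorem choose_v {I : Type*} [Fintype I] (hr : Module.finrank k L = r) {d : ℕ} (x : I → L)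
    (hx : ∀ i, x i ≠ 0) (hI : Fintype.card I = Fintype.card k + 1) :
    ∃ v : L, v ≠ 0 ∧ ∑ i, (RatS k r d (v * x i)).card ≤ Fintype.card k + 1 := by
  classical
  have hcard : Fintype.card L = Fintype.card k ^ r := by
    rw [← hr]; exact Module.card_eq_pow_finrank
  set V := Finset.univ.filter (fun α : L => α ≠ 0) with hV
  have hVc : V.card = Fintype.card k ^ r - 1 := by
    rw [hV, Finset.filter_ne', Finset.card_erase_of_mem (Finset.mem_univ _), Finset.card_univ, hcard]
  have hsum : ∑ v ∈ V, ∑ i, (RatS k r d (v * x i)).card ≤ ∑ v ∈ V, (Fintype.card k + 1) := by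
    rw [Finset.sum_comm, Finset.sum_const, hVc, smul_eq_mul, ← hI, mul_comm, ← smul_eq_mul,
      ← Finset.card_univ, ← Finset.sum_const]
    refine Finset.sum_le_sum fun i _ => ?_
    refine le_trans (le_of_eq ?_) (RatS_sum (d := d) hr)
    refine Finset.sum_bij (fun v _ => v * x i) ?_ ?_ ?_ ?_
    · intro v hv
      simp only [V, Finset.mem_filter, Finset.mem_univ, true_and] at hv ⊢
      exact mul_ne_zero hv (hx i)
    · intro v _ v' _ h
      exact mul_right_cancel₀ (hx i) h
    · intro α hα
      simp only [V, Finset.mem_filter, Finset.mem_univ, true_and] at hα ⊢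
      exact ⟨α / x i, div_ne_zero hα (hx i), div_mul_cancel₀ _ (hx i)⟩
    · intro v _; rfl
  obtain ⟨v, hv, h⟩ := Finset.exists_le_of_sum_le ⟨1, by simp [V]⟩ hsum
  exact ⟨v, by simpa [V] using hv, h⟩
end CaseD2

set_option linter.unusedSectionVars false
section CaseD3
variable {k L K : Type*} [Field k] [Fintype k] [Field L] [Fintype L] [Algebra k L]
  [Field K] [Algebra k K] [Algebra L K] [IsScalarTower k L K]
variable {r : ℕ}

theorem union_bound {X Y : Type*} [DecidableEq X] (W : Finset Y) (T : Y → Finset X)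
    (S : Finset X) (hS : ∀ x ∈ S, ∃ w ∈ W, x ∈ T w) (m M N : ℕ) (hW : W.card ≤ N)
    (hT : ∀ w ∈ W, (T w).card * m ≤ M) : S.card * m ≤ N * M := by
  have h1 : S ⊆ W.biUnion T := by
    intro x hx
    obtain ⟨w, hw, hxw⟩ := hS x hx
    exact Finset.mem_biUnion.2 ⟨w, hw, hxw⟩
  calc S.card * m ≤ (∑ w ∈ W, (T w).card) * m :=
        Nat.mul_le_mul_right _ ((Finset.card_le_card h1).trans Finset.card_biUnion_le)
    _ = ∑ w ∈ W, (T w).card * m := Finset.sum_mul _ _ _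
    _ ≤ ∑ _w ∈ W, M := Finset.sum_le_sum hT
    _ = W.card * M := by rw [Finset.sum_const, smul_eq_mul]
    _ ≤ N * M := Nat.mul_le_mul_right _ hW

theorem ker_card_le {A V : Type*} [AddCommGroup A] [Module k A] [Fintype A] [AddCommGroup V]
    [Module k V] (f : A →ₗ[k] V) (hf : 2 ≤ Module.finrank k (LinearMap.range f)) :
    Nat.card (LinearMap.ker f) * Fintype.card k ^ 2 ≤ Fintype.card A := by
  have h := card_ker_mul f.rangeRestrict f.surjective_rangeRestrict
  rw [LinearMap.ker_rangeRestrict] at h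
  have : Finite (LinearMap.range f) := Finite.of_surjective _ f.surjective_rangeRestrict
  have := Fintype.ofFinite (LinearMap.range f)
  have h2 : Nat.card (LinearMap.range f) = Fintype.card k ^ Module.finrank k (LinearMap.range f) := by
    rw [Nat.card_eq_fintype_card]; exact Module.card_eq_pow_finrank
  rw [← Nat.card_eq_fintype_card (α := A), ← h, h2]
  exact Nat.mul_le_mul_left _ (Nat.pow_le_pow_right Fintype.card_pos hf)

theorem SingAt_scale {c : k} (hc : c ≠ 0) {G : MvPolynomial (Fin r) k} {v : Fin r → K}
    (h : SingAt (C c * G) v) : SingAt G v := by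
  have hc' : algebraMap k K c ≠ 0 := by rwa [Ne, map_eq_zero]
  refine ⟨?_, fun j => ?_⟩
  · have := h.1
    simpa [hc'] using this
  · have := h.2 j
    simpa [pderiv_C_mul, hc'] using this

theorem Eb_comb (b : Module.Basis (Fin r) k L) (d p : ℕ) (s t β₀ β₁ : L) :
    C s * Eb b d p β₀ + C t * Eb b d p β₁ = Eb b d p (s * β₀ + t * β₁) := by
  simp only [Eb, map_add, map_mul]; ring

theorem Pol_scale (b : Module.Basis (Fin r) k L) (d p : ℕ) (c α a β : L) :
    Pol b d 1 (c * α) (c * a) (Eb b d p (c * β)) = C c * Pol b d 1 α a (Eb b d p β) := by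
  simp only [Eb, Pol, map_mul]; ring

/-- representatives of the projective line -/
def svf (k : Type*) [Field k] : Option k → k
  | none => 0
  | some _ => 1

/-- representatives of the projective line -/
def tvf (k : Type*) [Field k] : Option k → k
  | none => 1
  | some t => t

theorem svtv (i j : Option k) (hij : i ≠ j) :
    svf k i * tvf k j - svf k j * tvf k i ≠ 0 := by
  rcases i with _ | i <;> rcases j with _ | j
  · exact absurd rfl hij
  · simp [svf, tvf]
  · simp [svf, tvf]
  · simp only [svf, tvf, one_mul]
    intro h
    exact hij (by rw [sub_eq_zero.1 h])

theorem svtv_rep (s t : k) (h : (s, t) ≠ (0, 0)) :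
    ∃ c : k, c ≠ 0 ∧ ∃ i, s = c * svf k i ∧ t = c * tvf k i := by
  by_cases hs : s = 0
  · subst hs
    refine ⟨t, fun ht => h (by rw [ht]), none, by simp [svf], by simp [tvf]⟩
  · exact ⟨s, hs, some (t / s), by simp [svf], by simp [tvf, mul_div_cancel₀ _ hs]⟩

set_option maxHeartbeats 1000000 in
theorem caseD {d p : ℕ} [Fact p.Prime] [CharP K p] (hd : 3 ≤ d) (hr3 : 3 ≤ r)
    (b : Module.Basis (Fin r) k L) (hdK : (d : K) = 0) (hrK : (r : K) = 0)
    (hq : 36 * ((d-1)^r + 1) ^ 2 ≤ Fintype.card k) : HasPencil k K r d := by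
  classical
  have hr : Module.finrank k L = r := by simpa using Module.finrank_eq_card_basis b
  have hr0 : 1 ≤ r := by omega
  have hfd : FiniteDimensional k L := Module.finite_of_finrank_pos (by omega)
  have hpd : p ∣ d := (CharP.cast_eq_zero_iff K p d).1 hdK
  have hpL : (p : L) = 0 := by
    apply (algebraMap L K).injective
    rw [map_natCast, map_zero, CharP.cast_eq_zero]
  have hple : p ≤ d := Nat.le_of_dvd (by omega) hpd
  obtain ⟨x, y, hxy⟩ := exists_two (k := k) (⊥ : Submodule k L) (by simp; omega)
  have hxy : ∀ s t : k, (s, t) ≠ (0, 0) → s • x + t • y ≠ 0 := by simpa using hxy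
  set D := (d-1)^r + 1 with hDdef
  set sv := svf k
  set tv := tvf k
  have hst : ∀ i j, i ≠ j → sv i * tv j - sv j * tv i ≠ 0 := svtv
  have hstne : ∀ i, (sv i, tv i) ≠ (0, 0) := by
    intro i h
    rw [Prod.mk.injEq] at h
    rcases i with _ | i
    · exact one_ne_zero h.2
    · exact one_ne_zero h.1
  have hI : Fintype.card (Option k) = Fintype.card k + 1 := Fintype.card_option
  obtain ⟨v, hv, hvsum⟩ := choose_v (k := k) (d := d) hr (fun i : Option k => sv i • x + tv i • y)
    (fun i => hxy _ _ (hstne i)) hI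
  set α : Option k → L := fun i => v * (sv i • x + tv i • y) with hαdef
  have hα : ∀ i, α i ≠ 0 := fun i => mul_ne_zero hv (hxy _ _ (hstne i))
  let f : Option k → L → (L × L →ₗ[k] k) := fun i w => ff k (α i * w)⁻¹ (w ^ p)
  let S : Option k → Finset (L × L) := fun i =>
    Finset.univ.filter fun ω => ∃ w ∈ RatS k r d (α i), f i w ω = 0
  let Z : Option k → Finset (L × L) := fun i =>
    Finset.univ.filter fun ω => ∃ u : ℕ → K, Crit k r d (α i) u ∧
      2 ≤ Module.finrank k (LinearMap.range (eps k r p (α i) u)) ∧ eps k r p (α i) u ω = 0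
  have hξ : ∀ i, ∀ w ∈ RatS k r d (α i), (α i * w)⁻¹ ≠ 0 := fun i w hw =>
    inv_ne_zero (mul_ne_zero (hα i) (RatS_ne hr0 hw))
  have hpair : ∀ i j, i ≠ j → ∀ w ∈ RatS k r d (α i), ∀ w' ∈ RatS k r d (α j),
      Function.Surjective ((f i w).prod (f j w')) := by
    intro i j hij w hw w' hw'
    refine ff_pair (hξ i w hw) (hξ j w' hw') fun hww c c' hcc => ?_
    have hww' : w = w' := by
      apply (algebraMap L K).injective
      apply frobenius_inj K p
      simp only [frobenius_def, ← map_pow, hww]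
    subst hww'
    have hw0 := RatS_ne hr0 hw
    have h1 : c • α j + c' • α i = 0 := by
      have : c • α j + c' • α i = (α i * α j * w) * (c • (α i * w)⁻¹ + c' • (α j * w)⁻¹) := by
        have h1 := hα i
        have h2 := hα j
        simp only [Algebra.smul_def]
        field_simp
      rw [this, hcc, mul_zero]
    have h2 : (c * sv j + c' * sv i) • x + (c * tv j + c' * tv i) • y = 0 := by
      have : v * ((c * sv j + c' * sv i) • x + (c * tv j + c' * tv i) • y) =
          c • α j + c' • α i := by
        simp only [hαdef, Algebra.smul_def, map_add, map_mul]; ring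
      rw [h1] at this
      exact (mul_eq_zero.1 this).resolve_left hv
    have h3 : c * sv j + c' * sv i = 0 ∧ c * tv j + c' * tv i = 0 := by
      by_contra hcon
      exact hxy _ _ (fun h => hcon (by simpa using h)) h2
    have h4 := hst i j hij
    constructor
    · have : c * (sv i * tv j - sv j * tv i) = 0 := by
        linear_combination sv i * h3.2 - tv i * h3.1
      exact (mul_eq_zero.1 this).resolve_right h4
    · have : c' * (sv i * tv j - sv j * tv i) = 0 := by
        linear_combination tv j * h3.1 - sv j * h3.2
      exact (mul_eq_zero.1 this).resolve_right h4
  have hS1 : ∀ i, (S i).card * Fintype.card k ≤ (RatS k r d (α i)).card * Fintype.card (L × L) := by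
    intro i
    refine union_bound (RatS k r d (α i)) (fun w => Finset.univ.filter fun ω => f i w ω = 0) (S i)
      ?_ _ _ _ le_rfl ?_
    · intro ω hω
      simpa [S] using hω
    · intro w hw
      have := card_ker_mul (f i w) (ff_surj (hξ i w hw) _)
      rw [Nat.card_eq_fintype_card (α := k), Nat.card_eq_fintype_card (α := L × L)] at this
      rw [← this]
      refine le_of_eq ?_
      congr 1
      refine (Nat.subtype_card (p := fun ω => ω ∈ LinearMap.ker (f i w)) _ fun ω => ?_).symm
      simp
  have hS3 : ∀ i j l, i ≠ j → i ≠ l → j ≠ l →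
      (Finset.univ.filter (fun ω : (L × L) × (L × L) => sv i • ω.1 + tv i • ω.2 ∈ S i ∧
        sv j • ω.1 + tv j • ω.2 ∈ S j ∧ sv l • ω.1 + tv l • ω.2 ∈ S l)).card * Fintype.card k ^ 3
        ≤ (RatS k r d (α i)).card * (RatS k r d (α j)).card * (RatS k r d (α l)).card
          * Fintype.card (L × L) ^ 2 := by
    intro i j l hij hil hjl
    refine union_bound (RatS k r d (α i) ×ˢ RatS k r d (α j) ×ˢ RatS k r d (α l))
      (fun w => Finset.univ.filter fun ω : (L × L) × (L × L) =>
        f i w.1 (sv i • ω.1 + tv i • ω.2) = 0 ∧ f j w.2.1 (sv j • ω.1 + tv j • ω.2) = 0 ∧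
        f l w.2.2 (sv l • ω.1 + tv l • ω.2) = 0) _ ?_ _ _ _ ?_ ?_
    · intro ω hω
      simp only [S, Finset.mem_filter, Finset.mem_univ, true_and] at hω
      obtain ⟨⟨w, hw, h1⟩, ⟨w', hw', h2⟩, ⟨w'', hw'', h3⟩⟩ := hω
      refine ⟨(w, w', w''), ?_, ?_⟩
      · simp only [Finset.mem_product]; exact ⟨hw, hw', hw''⟩
      · simp only [Finset.mem_filter, Finset.mem_univ, true_and]; exact ⟨h1, h2, h3⟩
    · rw [Finset.card_product, Finset.card_product, mul_assoc]
    · rintro ⟨w, w', w''⟩ hw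
      simp only [Finset.mem_product] at hw
      exact le_of_eq (card_triple (hst i j hij) (hst i l hil) (f i w) (f j w') (f l w'')
        (ff_surj (hξ i w hw.1) _) (hpair j l hjl w' hw.2.1 w'' hw.2.2))
  have hZ : ∀ i, (Z i).card * Fintype.card k ^ 2 ≤ D * Fintype.card (L × L) := by
    intro i
    obtain ⟨hf, hc⟩ := crit_finite (k := k) (K := K) hd hr0 (hα i)
    refine union_bound (hf.toFinset.filter fun u =>
      2 ≤ Module.finrank k (LinearMap.range (eps k r p (α i) u)))
      (fun u => Finset.univ.filter fun ω => eps k r p (α i) u ω = 0) (Z i)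
      ?_ _ _ _ ?_ ?_
    · intro ω hω
      simp only [Z, Finset.mem_filter, Finset.mem_univ, true_and] at hω
      obtain ⟨u, h1, h2, h3⟩ := hω
      refine ⟨u, ?_, ?_⟩
      · simp only [Finset.mem_filter, Set.Finite.mem_toFinset]; exact ⟨h1, h2⟩
      · simp only [Finset.mem_filter, Finset.mem_univ, true_and]; exact h3
    · refine (Finset.card_filter_le _ _).trans ?_
      rwa [← Set.ncard_eq_toFinset_card _ hf]
    · intro u hu
      have := ker_card_le (eps k r p (α i) u) (Finset.mem_filter.1 hu).2
      refine le_trans (le_of_eq ?_) this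
      congr 1
      refine (Nat.subtype_card (p := fun ω => ω ∈ LinearMap.ker (eps k r p (α i) u)) _
        fun ω => ?_).symm
      simp
  obtain ⟨ω, hω⟩ := counting sv tv hst hI (fun i => (RatS k r d (α i)).card) S Z hS1 hS3 hvsum D
    (by omega) (fun i => RatS_card K hr hd (hα i)) hZ hq
  refine hasPencil_of (α₀ := v * x) (α₁ := v * y) (a₀ := ω.1.1) (a₁ := ω.2.1) (m := 1) b (by omega)
    (Eb_hom b hple ω.1.2) (Eb_hom b hple ω.2.2) fun s t hst' z hz hsing => ?_
  obtain ⟨c, hc, i, rfl, rfl⟩ := svtv_rep s t hst'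
  rw [Eb_comb] at hsing
  have e1 : (c * svf k i) • (v * x) + (c * tvf k i) • (v * y) = algebraMap k L c * α i := by
    simp only [hαdef, Algebra.smul_def, map_mul, sv, tv]; ring
  have e2 : (c * svf k i) • ω.1.1 + (c * tvf k i) • ω.2.1 =
      algebraMap k L c * (sv i • ω.1 + tv i • ω.2).1 := by
    rw [Prod.fst_add, Prod.smul_fst, Prod.smul_fst]
    simp only [Algebra.smul_def, map_mul, sv, tv]; ring
  have e3 : algebraMap k L (c * svf k i) * ω.1.2 + algebraMap k L (c * tvf k i) * ω.2.2 =
      algebraMap k L c * (sv i • ω.1 + tv i • ω.2).2 := by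
    rw [Prod.snd_add, Prod.smul_snd, Prod.smul_snd]
    simp only [Algebra.smul_def, map_mul, sv, tv]; ring
  rw [e1, e2, e3, Pol_scale, traceMap_C_mul] at hsing
  have hsing := SingAt_scale hc hsing
  obtain ⟨u, hu, hu0⟩ := bad (p := p) b hd hr0 hdK hrK hpd hpL (hα i) hz hsing
  obtain ⟨h1, h2⟩ := hω i
  rcases Nat.lt_or_ge (Module.finrank k (LinearMap.range (eps k r p (α i) u))) 2 with hlt | hge
  · obtain ⟨w, hw, rfl⟩ := dich hr (hα i) hu (by omega)
    apply h1
    simp only [S, Finset.mem_filter, Finset.mem_univ, true_and]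
    refine ⟨w, hw, ?_⟩
    have h3 : eps k r p (α i) (fun i => fr k L K i w) (sv i • ω.1 + tv i • ω.2) = 0 := hu0
    rw [eps_fr hr, map_eq_zero] at h3
    exact h3
  · apply h2
    simp only [Z, Finset.mem_filter, Finset.mem_univ, true_and]
    exact ⟨u, hu, hge, hu0⟩
end CaseD3

theorem numeric (n d : ℕ) (hn : 2 ≤ n) (hd : 3 ≤ d) (Q : ℕ)
    (hq : (Q : ℝ) >
      ((1 + Real.sqrt 2) / 2) ^ 2 *
        (((n + 1) * (d - 1) ^ n : ℕ) : ℝ) ^ 2 *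
        ((((n + 1) * (d - 1) ^ n : ℕ) : ℝ) - 1) ^ 2 *
        ((((n + 1) * (d - 1) ^ n : ℕ) : ℝ) - 2) ^ 2) :
    36 * ((d-1)^(n+1) + 1) ^ 2 ≤ Q := by
  set N := (n + 1) * (d - 1) ^ n with hN
  have hm : 2 ≤ d - 1 := by omega
  have h4 : 4 ≤ (d-1)^n := by
    calc 4 = 2 ^ 2 := by norm_num
      _ ≤ (d-1)^2 := Nat.pow_le_pow_left hm 2
      _ ≤ (d-1)^n := Nat.pow_le_pow_right (by omega) hn
  have hN12 : 12 ≤ N := by nlinarith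
  have hD : (d-1)^(n+1) + 1 ≤ N ^ 2 := by
    have h1 : (d-1)^(n+1) ≤ (d-1)^n * (d-1)^n := by
      rw [← pow_add]; exact Nat.pow_le_pow_right (by omega) (by omega)
    have h2 : 3 * (d-1)^n ≤ N := by rw [hN]; exact Nat.mul_le_mul_right _ (by omega)
    nlinarith
  have hs : 1 ≤ Real.sqrt 2 := by rw [Real.one_le_sqrt]; norm_num
  have hs2 : 1 ≤ ((1 + Real.sqrt 2) / 2) ^ 2 := by
    have : 1 ≤ (1 + Real.sqrt 2) / 2 := by linarith
    nlinarith
  have hNR : (12:ℝ) ≤ N := by exact_mod_cast hN12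
  have e : ((N:ℝ) ^ 2 / 2) ^ 2 ≤ (((N:ℝ) - 1) * (N - 2)) ^ 2 := by
    apply pow_le_pow_left₀ (by positivity)
    nlinarith
  have h5 : (36:ℝ) * ((N:ℝ)^2)^2 ≤ (N:ℝ)^2 * (((N:ℝ) - 1) * (N - 2)) ^ 2 := by
    have h6 : (144:ℝ) ≤ (N:ℝ)^2 := by nlinarith
    have h7 : (0:ℝ) ≤ ((N:ℝ)^2)^2 := by positivity
    calc (36:ℝ) * ((N:ℝ)^2)^2 ≤ (N:ℝ)^2 * ((N:ℝ) ^ 2 / 2) ^ 2 := by nlinarith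
      _ ≤ _ := by gcongr
  have h8 : (N:ℝ)^2 * (((N:ℝ) - 1) * (N - 2)) ^ 2 ≤ Q := by
    have h9 : (0:ℝ) ≤ (N:ℝ)^2 * (((N:ℝ) - 1) * (N - 2)) ^ 2 := by positivity
    have h10 := mul_le_mul_of_nonneg_right hs2 h9
    refine le_trans ?_ hq.le
    calc _ = 1 * ((N:ℝ)^2 * (((N:ℝ) - 1) * (N - 2)) ^ 2) := by ring
      _ ≤ _ := h10
      _ = _ := by ring
  have h11 : 36 * (N ^ 2) ^ 2 ≤ Q := by exact_mod_cast h5.trans h8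
  calc 36 * ((d-1)^(n+1) + 1) ^ 2 ≤ 36 * (N ^ 2) ^ 2 := by gcongr
    _ ≤ Q := h11

theorem pencil_of_smooth_hypersurfaces_exists
    (n d : ℕ) (hn : 2 ≤ n) (hd : 2 ≤ d)
    (F : Type) [Field F] [Fintype F]
    (hq : (Fintype.card F : ℝ) >
      ((1 + Real.sqrt 2) / 2) ^ 2 *
        (((n + 1) * (d - 1) ^ n : ℕ) : ℝ) ^ 2 *
        ((((n + 1) * (d - 1) ^ n : ℕ) : ℝ) - 1) ^ 2 *
        ((((n + 1) * (d - 1) ^ n : ℕ) : ℝ) - 2) ^ 2) :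
    ∃ F₀ F₁ : MvPolynomial (Fin (n + 1)) F,
      F₀.IsHomogeneous d ∧ F₁.IsHomogeneous d ∧
      LinearIndependent F ![F₀, F₁] ∧
      ∀ a₀ a₁ : F, (a₀, a₁) ≠ (0, 0) →
        ∀ v : Fin (n + 1) → AlgebraicClosure F, v ≠ 0 →
          ¬ (eval v (map (algebraMap F (AlgebraicClosure F)) (C a₀ * F₀ + C a₁ * F₁)) = 0 ∧
            ∀ i : Fin (n + 1),
              eval v (map (algebraMap F (AlgebraicClosure F))
                (pderiv i (C a₀ * F₀ + C a₁ * F₁))) = 0) := by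
  have key : HasPencil F (AlgebraicClosure F) (n+1) d := by
    obtain ⟨p, hpc⟩ := CharP.exists F
    have hp : Fact p.Prime := ⟨CharP.char_is_prime F p⟩
    have hpK : CharP (AlgebraicClosure F) p :=
      charP_of_injective_algebraMap (algebraMap F (AlgebraicClosure F)).injective p
    let L := FiniteField.Extension F p (n+1)
    have hfin : Finite L := Module.finite_of_finite F
    letI : Fintype L := Fintype.ofFinite L
    let φ : L →ₐ[F] AlgebraicClosure F := IsAlgClosed.lift
    letI : Algebra L (AlgebraicClosure F) := φ.toRingHom.toAlgebra
    have : IsScalarTower F L (AlgebraicClosure F) :=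
      IsScalarTower.of_algebraMap_eq fun x => (φ.commutes x).symm
    let b : Module.Basis (Fin (n+1)) F L :=
      Module.finBasisOfFinrankEq F L (FiniteField.finrank_extension F p (n+1))
    by_cases h : (d : AlgebraicClosure F) ≠ 0 ∨ ((n+1 : ℕ) : AlgebraicClosure F) ≠ 0
    · exact pencilAB hd (by omega) b h
    · push Not at h
      rcases Nat.lt_or_ge 2 d with h3 | h3
      · exact caseD (p := p) h3 (by omega) b h.1 h.2 (numeric n d hn h3 _ hq)
      · obtain rfl : d = 2 := by omega
        exact pencilC (by omega) b (by exact_mod_cast h.1) h.2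
  obtain ⟨F₀, F₁, h0, h1, h2⟩ := key
  refine ⟨F₀, F₁, h0, h1, ?_, h2⟩
  rw [LinearIndependent.pair_iff]
  intro s t hst
  by_contra hcon
  refine h2 s t (fun h => hcon (by simpa using h)) 1 one_ne_zero ?_
  have : C s * F₀ + C t * F₁ = 0 := by rw [← hst, smul_eq_C_mul, smul_eq_C_mul]
  rw [this]
  simp [SingAt]
end

section
/- Let 𝔽_q be a finite field with q elements and let F ∈ 𝔽_q[x,y,z] be a homogeneous polynomial of degree δ ≥ 2 whose image in K[x,y,z], where K is an algebraic closure of 𝔽_q, is irreducible (i.e., the plane curve C = {F = 0} is geometrically irreducible). If q > ((1+√2)/2)^2 · δ² · (δ-1)² · (δ-2)², then there exists a nonzero linear form ℓ ∈ 𝔽_q[x,y,z] such that for every nonzero vector v ∈ 𝔽_q³ with ℓ(v) = 0 one has F(v) ≠ 0; that is, there is an 𝔽_q-line L ⊂ ℙ² such that C ∩ L contains no 𝔽_q-points. -/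
open MvPolynomial

namespace Stepanov

/-- coordinate ring of the affine plane curve `f = 0` -/
abbrev CR {k : Type} [Field k] (f : MvPolynomial (Fin 2) k) : Type :=
  MvPolynomial (Fin 2) k ⧸ Ideal.span {f}

/-- the quotient map -/
noncomputable abbrev qm {k : Type} [Field k] (f : MvPolynomial (Fin 2) k) :
    MvPolynomial (Fin 2) k →ₐ[k] CR f := Ideal.Quotient.mkₐ k _

/-- elements represented by polynomials of degree at most `n` -/
noncomputable def filt {k : Type} [Field k] (f : MvPolynomial (Fin 2) k) (n : ℕ) :
    Submodule k (CR f) :=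
  (restrictTotalDegree (Fin 2) k n).map (qm f).toLinearMap

theorem mem_filt {k : Type} [Field k] (f : MvPolynomial (Fin 2) k) (n : ℕ) (a : CR f) :
    a ∈ filt f n ↔ ∃ p : MvPolynomial (Fin 2) k, p.totalDegree ≤ n ∧ qm f p = a := by
  simp [filt, mem_restrictTotalDegree]

theorem filt_mono {k : Type} [Field k] (f : MvPolynomial (Fin 2) k) {m n : ℕ} (h : m ≤ n) :
    filt f m ≤ filt f n := by
  intro a ha
  rw [mem_filt] at *
  obtain ⟨p, hp, rfl⟩ := ha
  exact ⟨p, hp.trans h, rfl⟩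

theorem filt_mul {k : Type} [Field k] (f : MvPolynomial (Fin 2) k) {m n : ℕ} {a b : CR f}
    (ha : a ∈ filt f m) (hb : b ∈ filt f n) : a * b ∈ filt f (m + n) := by
  rw [mem_filt] at *
  obtain ⟨p, hp, rfl⟩ := ha
  obtain ⟨r, hr, rfl⟩ := hb
  exact ⟨p * r, (totalDegree_mul _ _).trans (by omega), by rw [map_mul]⟩

theorem exists_filt {k : Type} [Field k] (f : MvPolynomial (Fin 2) k) (a : CR f) :
    ∃ n, a ∈ filt f n := by
  obtain ⟨p, rfl⟩ := Ideal.Quotient.mk_surjective a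
  exact ⟨p.totalDegree, (mem_filt _ _ _).2 ⟨p, le_rfl, rfl⟩⟩

instance {k : Type} [Field k] (f : MvPolynomial (Fin 2) k) (n : ℕ) :
    Module.Finite k (filt f n) := by
  unfold filt; infer_instance

theorem finrank_poly (k : Type) [Field k] (n : ℕ) :
    2 * Module.finrank k (restrictTotalDegree (Fin 2) k n) = (n + 1) * (n + 2) := by
  have e1 : Module.finrank k (restrictTotalDegree (Fin 2) k n)
      = Nat.card {s : Fin 2 →₀ ℕ | (s.sum fun _ e => e) ≤ n} := by
    have := (basisRestrictSupport k {s : Fin 2 →₀ ℕ | (s.sum fun _ e => e) ≤ n})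
    rw [← Module.finrank_eq_nat_card_basis this]
    rfl
  have e2 : Nat.card {s : Fin 2 →₀ ℕ | (s.sum fun _ e => e) ≤ n}
      = (Finset.sigma (Finset.range (n + 1)) fun i => Finset.range (i + 1)).card := by
    rw [← Nat.card_eq_finsetCard]
    refine Nat.card_congr ⟨fun s => ⟨⟨s.1 0 + s.1 1, s.1 0⟩, ?_⟩,
      fun t => ⟨Finsupp.equivFunOnFinite.symm ![t.1.2, t.1.1 - t.1.2], ?_⟩, ?_, ?_⟩
    · have := s.2
      simp [Finsupp.sum_fintype] at this
      simp
      omega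
    · have := t.2
      rw [Finset.mem_sigma, Finset.mem_range, Finset.mem_range] at this
      have h3 : t.1.2 + (t.1.1 - t.1.2) = t.1.1 := by omega
      simp [Finsupp.sum_fintype, h3]
      omega
    · intro s
      ext i
      fin_cases i <;> simp
    · rintro ⟨⟨i, j⟩, h⟩
      simp at h
      have : j + (i - j) = i := by omega
      simp [this]
  rw [e1, e2, Finset.card_sigma]
  clear e1 e2
  simp only [Finset.card_range]
  induction n with
  | zero => simp
  | succ n ih => rw [Finset.sum_range_succ, mul_add, ih]; ring

theorem finrank_filt {k : Type} [Field k] {f : MvPolynomial (Fin 2) k} (hf : f ≠ 0) {d : ℕ}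
    (hd : f.totalDegree = d) {n : ℕ} (hn : d ≤ n) :
    2 * Module.finrank k (filt f n) + d * d = 2 * d * n + 3 * d := by
  let φ : restrictTotalDegree (Fin 2) k n →ₗ[k] filt f n :=
    ((qm f).toLinearMap.restrict (p := restrictTotalDegree (Fin 2) k n) (q := filt f n)
      fun x hx => Submodule.mem_map_of_mem hx)
  have hs : Function.Surjective φ := by
    rintro ⟨a, ha⟩
    obtain ⟨p, hp, rfl⟩ := ha
    exact ⟨⟨p, hp⟩, rfl⟩
  let ψ : restrictTotalDegree (Fin 2) k (n - d) →ₗ[k] restrictTotalDegree (Fin 2) k n :=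
    (LinearMap.mulLeft k f).restrict fun x hx => by
      rw [mem_restrictTotalDegree] at *
      exact (totalDegree_mul _ _).trans (by omega)
  have hi : Function.Injective ψ := by
    intro a b hab
    have := congrArg Subtype.val hab
    exact Subtype.ext (mul_left_cancel₀ hf this)
  have hr : LinearMap.range ψ = LinearMap.ker φ := by
    ext ⟨p, hp⟩
    rw [LinearMap.mem_ker]
    constructor
    · rintro ⟨⟨r, hr⟩, h⟩
      have := congrArg Subtype.val h
      change f * r = p at this
      apply Subtype.ext
      change qm f p = 0
      exact Ideal.Quotient.eq_zero_iff_mem.2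
        (this ▸ Ideal.mul_mem_right _ _ (Ideal.mem_span_singleton_self f))
    · intro h
      have : qm f p = 0 := congrArg Subtype.val h
      obtain ⟨r, rfl⟩ := Ideal.mem_span_singleton.1 (Ideal.Quotient.eq_zero_iff_mem.1 this)
      refine ⟨⟨r, ?_⟩, rfl⟩
      rw [mem_restrictTotalDegree] at *
      by_cases h0 : r = 0
      · simp [h0]
      · rw [totalDegree_mul_of_isDomain hf h0] at hp
        omega
  have h1 := LinearMap.finrank_range_add_finrank_ker φ
  rw [← hr, LinearMap.finrank_range_of_inj hi, LinearMap.range_eq_top.2 hs, finrank_top] at h1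
  have h2 := finrank_poly k n
  have h3 := finrank_poly k (n - d)
  obtain ⟨e, rfl⟩ := Nat.exists_eq_add_of_le hn
  rw [Nat.add_sub_cancel_left] at *
  nlinarith

/-- elements linearly independent modulo a product of proper ideals -/
theorem exists_indep {k A : Type} [Field k] [CommRing A] [IsDomain A] [IsNoetherianRing A]
    [Algebra k A] (L : Multiset (Ideal A)) (hL : ∀ I ∈ L, I ≠ ⊤) (hL0 : ∀ I ∈ L, I ≠ ⊥) :
    ∀ n, L.card = n →
    ∃ v : Fin n → A, ∀ c : Fin n → k, ∑ i, c i • v i ∈ L.prod → c = 0 := by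
  induction L using Multiset.induction_on with
  | empty =>
    rintro n rfl
    exact ⟨Fin.elim0, fun c _ => by ext i; exact i.elim0⟩
  | cons I L ih =>
    rintro n hn
    rw [Multiset.card_cons] at hn
    obtain ⟨n, rfl⟩ : ∃ n', n = n' + 1 := ⟨_, hn.symm⟩
    obtain ⟨v, hv⟩ := ih (fun I hI => hL I (by simp [hI])) (fun I hI => hL0 I (by simp [hI])) n
      (by omega)
    have hp0 : L.prod ≠ ⊥ := by
      intro h
      have : (0 : Ideal A) ∈ L := Multiset.prod_eq_zero_iff.1 h
      exact hL0 0 (Multiset.mem_cons_of_mem this) rfl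
    have hex : ∃ w ∈ L.prod, w ∉ I * L.prod := by
      by_contra! hcon
      obtain ⟨r, hr1, hr2⟩ := Submodule.exists_sub_one_mem_and_smul_eq_zero_of_fg_of_le_smul I
        L.prod (IsNoetherian.noetherian _) hcon
      obtain ⟨x, hx, hx0⟩ := Submodule.exists_mem_ne_zero_of_ne_bot hp0
      have h0 : r = 0 := by
        have := hr2 x hx
        rw [smul_eq_mul, mul_eq_zero] at this
        exact this.resolve_right hx0
      apply hL I (by simp)
      rw [Ideal.eq_top_iff_one]
      simpa [h0] using hr1
    obtain ⟨w, hw1, hw2⟩ := hex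
    refine ⟨Fin.cons w v, fun c hc => ?_⟩
    rw [Multiset.prod_cons, Fin.sum_univ_succ] at hc
    simp only [Fin.cons_zero, Fin.cons_succ] at hc
    have h1 : ∑ i : Fin n, c i.succ • v i ∈ L.prod := by
      have h2 := (Ideal.mul_le_right : I * L.prod ≤ L.prod) hc
      rwa [Ideal.add_mem_iff_right] at h2
      rw [Algebra.smul_def]
      exact Ideal.mul_mem_left _ _ hw1
    have h3 := hv _ h1
    have h4 : ∀ i : Fin n, c i.succ = 0 := fun i => congrFun h3 i
    simp only [h4, zero_smul, Finset.sum_const_zero, add_zero] at hc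
    have h5 : c 0 = 0 := by
      by_contra h
      apply hw2
      have := Ideal.mul_mem_left _ (algebraMap k A (c 0)⁻¹) hc
      rwa [← Algebra.smul_def, smul_smul, inv_mul_cancel₀ h, one_smul] at this
    ext i
    refine Fin.cases h5 h4 i

theorem prod_eq_bot {A : Type} [CommRing A] {L : Multiset (Ideal A)} (h : ⊥ ∈ L) :
    L.prod = ⊥ := Multiset.prod_eq_zero h

theorem bezout_list {k : Type} [Field k] {f : MvPolynomial (Fin 2) k} (hf : Irreducible f) {d : ℕ}
    (hd : f.totalDegree = d) {n : ℕ} {g : CR f} (hg : g ∈ filt f n) (hg0 : g ≠ 0)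
    (L : Multiset (Ideal (CR f))) (hL : ∀ I ∈ L, I ≠ ⊤) (hgL : g ∈ L.prod) : L.card ≤ d * n := by
  have hprime : (Ideal.span {f}).IsPrime :=
    (Ideal.span_singleton_prime hf.ne_zero).2 hf.prime
  have hL0 : ∀ I ∈ L, I ≠ ⊥ := by
    rintro I hI rfl
    apply hg0
    rw [prod_eq_bot hI] at hgL
    exact hgL
  obtain ⟨v, hv⟩ := exists_indep (k := k) L hL hL0 _ rfl
  choose N hN using fun i => exists_filt f (v i)
  let M := d + ∑ i, N i
  have hvM : ∀ i, v i ∈ filt f (M + n) := fun i => by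
    refine filt_mono f ?_ (hN i)
    have := Finset.single_le_sum (f := N) (fun _ _ => Nat.zero_le _) (Finset.mem_univ i)
    omega
  let Φ : ((Fin L.card → k) × filt f M) →ₗ[k] filt f (M + n) :=
    LinearMap.codRestrict _ (LinearMap.coprod (Fintype.linearCombination k v)
      ((LinearMap.mulLeft k g).comp (filt f M).subtype)) (by
        rintro ⟨c, h⟩
        simp only [LinearMap.coprod_apply, Fintype.linearCombination_apply, LinearMap.comp_apply]
        refine Submodule.add_mem _ (Submodule.sum_mem _ fun i _ => Submodule.smul_mem _ _ (hvM i)) ?_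
        have := filt_mul f hg h.2
        rw [add_comm] at this
        exact this)
  have hΦ : Function.Injective Φ := by
    rw [← LinearMap.ker_eq_bot, LinearMap.ker_eq_bot']
    rintro ⟨c, h⟩ hch
    have h1 : ∑ i, c i • v i + g * (h : CR f) = 0 := congrArg Subtype.val hch
    have h2 : ∑ i, c i • v i ∈ L.prod := by
      rw [eq_neg_of_add_eq_zero_left h1]
      exact neg_mem (Ideal.mul_mem_right _ _ hgL)
    have h3 := hv c h2
    subst h3
    have h4 : g * (h : CR f) = 0 := by simpa using h1
    have h5 : h = 0 := Subtype.ext ((mul_eq_zero.1 h4).resolve_left hg0)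
    rw [h5]; rfl
  have h1 := LinearMap.finrank_le_finrank_of_injective hΦ
  rw [Module.finrank_prod, Module.finrank_fin_fun] at h1
  have h2 := finrank_filt hf.ne_zero hd (n := M) (by omega)
  have h3 := finrank_filt hf.ne_zero hd (n := M + n) (by omega)
  nlinarith

/-- affine rational points -/
abbrev Pts {k : Type} [Field k] (f : MvPolynomial (Fin 2) k) : Type := {P : Fin 2 → k // eval P f = 0}

/-- evaluation at a rational point -/
noncomputable def evP {k : Type} [Field k] {f : MvPolynomial (Fin 2) k} (P : Pts f) : CR f →ₐ[k] k :=
  Ideal.Quotient.liftₐ _ (aeval P.1) (fun a ha => by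
    obtain ⟨r, rfl⟩ := Ideal.mem_span_singleton.1 ha
    rw [map_mul, aeval_eq_eval, P.2, zero_mul])

@[simp] theorem evP_qm {k : Type} [Field k] {f : MvPolynomial (Fin 2) k} (P : Pts f)
    (p : MvPolynomial (Fin 2) k) : evP P (qm f p) = eval P.1 p := by
  rw [← coe_aeval_eq_eval]; rfl

/-- the maximal ideal of a rational point -/
noncomputable def mP {k : Type} [Field k] {f : MvPolynomial (Fin 2) k} (P : Pts f) : Ideal (CR f) :=
  RingHom.ker (evP P)

theorem mem_mP {k : Type} [Field k] {f : MvPolynomial (Fin 2) k} (P : Pts f) (a : CR f) :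
    a ∈ mP P ↔ evP P a = 0 := Iff.rfl

theorem mP_isMaximal {k : Type} [Field k] {f : MvPolynomial (Fin 2) k} (P : Pts f) :
    (mP P).IsMaximal := by
  apply RingHom.ker_isMaximal_of_surjective
  intro c
  exact ⟨algebraMap k _ c, by simp⟩

theorem mP_injective {k : Type} [Field k] {f : MvPolynomial (Fin 2) k} :
    Function.Injective (mP (f := f)) := by
  intro P Q h
  apply Subtype.ext
  funext i
  have : qm f (X i - C (P.1 i)) ∈ mP P := by rw [mem_mP, evP_qm]; simp
  rw [h, mem_mP, evP_qm] at this
  simp [sub_eq_zero] at this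
  exact this.symm

theorem bezout {k : Type} [Field k] {f : MvPolynomial (Fin 2) k} (hf : Irreducible f) {d : ℕ}
    (hd : f.totalDegree = d) {n : ℕ} {g : CR f} (hg : g ∈ filt f n) (hg0 : g ≠ 0)
    (S : Finset (Pts f)) (e : ℕ) (hS : ∀ P ∈ S, g ∈ mP P ^ e) : e * S.card ≤ d * n := by
  have hco : Pairwise (Function.onFun IsCoprime (mP (f := f))) := by
    intro P Q hPQ
    have := mP_isMaximal P
    have := mP_isMaximal Q
    exact Ideal.isCoprime_of_isMaximal (mP_injective.ne hPQ)
  have h1 : g ∈ ∏ P ∈ S, mP P ^ e := by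
    rw [Ideal.prod_eq_iInf_of_pairwise_isCoprime]
    · simpa [Submodule.mem_iInf] using hS
    · intro P _ Q _ hPQ
      exact (hco hPQ).pow
  let L : Multiset (Ideal (CR f)) := S.val.bind fun P => Multiset.replicate e (mP P)
  have hLp : L.prod = ∏ P ∈ S, mP P ^ e := by
    simp [L, Multiset.prod_bind]
  have hLl : L.card = e * S.card := by
    simp [L, Multiset.card_bind, mul_comm]
  rw [← hLl]
  refine bezout_list hf hd hg hg0 L ?_ (hLp ▸ h1)
  intro I hI
  simp only [L, Multiset.mem_bind] at hI
  obtain ⟨P, _, h2⟩ := hI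
  rw [Multiset.eq_of_mem_replicate h2]
  exact (mP_isMaximal P).ne_top

end Stepanov


namespace Stepanov

/-- polynomials in two pairs of coordinates -/
abbrev P4 (k : Type) [Field k] : Type := MvPolynomial (Fin 2 ⊕ Fin 2) k

theorem geom_deg {k : Type} [Field k] (a b : Fin 2 ⊕ Fin 2) (n : ℕ) :
    (∑ i ∈ Finset.range n, (X a : P4 k) ^ i * X b ^ (n - 1 - i)).totalDegree ≤ n - 1 := by
  apply totalDegree_finsetSum_le
  intro i hi
  refine (totalDegree_mul _ _).trans ?_
  rw [totalDegree_X_pow, totalDegree_X_pow]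
  have := Finset.mem_range.1 hi
  omega

theorem mono_eq {k : Type} [Field k] (s : Fin 2 →₀ ℕ) (c : k) {S : Type} [CommRing S] [Algebra k S]
    (u : Fin 2 → S) : aeval u (monomial s c) = algebraMap k S c * (u 0 ^ s 0 * u 1 ^ s 1) := by
  rw [aeval_monomial, Finsupp.prod_fintype _ _ (by simp)]
  simp

theorem sum_le_sub_one {k : Type} [Field k] {p : MvPolynomial (Fin 2) k} {s : Fin 2 →₀ ℕ}
    (hs : s ∈ p.support) : s 0 + s 1 ≤ p.totalDegree := by
  have := le_totalDegree hs
  rwa [Finsupp.sum_fintype _ _ (by simp), Fin.sum_univ_two] at this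

/-- divided difference in the second variable -/
theorem exists_diff_one {k : Type} [Field k] (p : MvPolynomial (Fin 2) k) {d : ℕ}
    (hd : p.totalDegree ≤ d) :
    ∃ Ψ : P4 k, Ψ.totalDegree ≤ d - 1 ∧
      (X (.inr 1) - X (.inl 1)) * Ψ =
        aeval ![X (.inl 0), X (.inr 1)] p - aeval ![X (.inl 0), X (.inl 1)] p ∧
      ∀ P : Fin 2 → k, eval (Sum.elim P P) Ψ = eval P (pderiv 1 p) := by
  refine ⟨∑ s ∈ p.support, C (coeff s p) * (X (.inl 0) ^ s 0 *
    ∑ i ∈ Finset.range (s 1), X (.inr 1) ^ i * X (.inl 1) ^ (s 1 - 1 - i)), ?_, ?_, ?_⟩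
  · apply totalDegree_finsetSum_le
    intro s hs
    refine (totalDegree_mul _ _).trans ?_
    rw [totalDegree_C, zero_add]
    by_cases h0 : s 1 = 0
    · simp [h0]
    refine (totalDegree_mul _ _).trans ?_
    rw [totalDegree_X_pow]
    have := geom_deg (k := k) (.inr 1) (.inl 1) (s 1)
    have := sum_le_sub_one hs
    omega
  · conv_rhs => rw [p.as_sum]
    rw [map_sum, map_sum, ← Finset.sum_sub_distrib, Finset.mul_sum]
    refine Finset.sum_congr rfl fun s _ => ?_
    rw [mono_eq, mono_eq]
    have := geom_sum₂_mul (X (.inr 1) : P4 k) (X (.inl 1)) (s 1)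
    simp only [Matrix.cons_val_zero, Matrix.cons_val_one, algebraMap_eq]
    linear_combination C (coeff s p) * X (.inl 0) ^ s 0 * this
  · intro P
    conv_rhs => rw [p.as_sum]
    simp only [map_sum]
    refine Finset.sum_congr rfl fun s _ => ?_
    rw [pderiv_monomial, eval_monomial, Finsupp.prod_fintype _ _ (by simp)]
    have : ∀ i ∈ Finset.range (s 1), P 1 ^ i * P 1 ^ (s 1 - 1 - i) = P 1 ^ (s 1 - 1) := by
      intro i hi
      rw [← pow_add]
      have := Finset.mem_range.1 hi
      congr 1; omega
    simp [Finset.sum_congr rfl this]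
    ring

/-- divided difference in the first variable -/
theorem exists_diff_zero {k : Type} [Field k] (p : MvPolynomial (Fin 2) k) {d : ℕ}
    (hd : p.totalDegree ≤ d) :
    ∃ Ψ : P4 k, Ψ.totalDegree ≤ d - 1 ∧
      (X (.inr 0) - X (.inl 0)) * Ψ =
        aeval ![X (.inr 0), X (.inr 1)] p - aeval ![X (.inl 0), X (.inr 1)] p := by
  refine ⟨∑ s ∈ p.support, C (coeff s p) * (X (.inr 1) ^ s 1 *
    ∑ i ∈ Finset.range (s 0), X (.inr 0) ^ i * X (.inl 0) ^ (s 0 - 1 - i)), ?_, ?_⟩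
  · apply totalDegree_finsetSum_le
    intro s hs
    refine (totalDegree_mul _ _).trans ?_
    rw [totalDegree_C, zero_add]
    by_cases h0 : s 0 = 0
    · simp [h0]
    refine (totalDegree_mul _ _).trans ?_
    rw [totalDegree_X_pow]
    have := geom_deg (k := k) (.inr 0) (.inl 0) (s 0)
    have := sum_le_sub_one hs
    omega
  · conv_rhs => rw [p.as_sum]
    rw [map_sum, map_sum, ← Finset.sum_sub_distrib, Finset.mul_sum]
    refine Finset.sum_congr rfl fun s _ => ?_
    rw [mono_eq, mono_eq]
    have := geom_sum₂_mul (X (.inr 0) : P4 k) (X (.inl 0)) (s 0)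
    simp only [Matrix.cons_val_zero, Matrix.cons_val_one, algebraMap_eq]
    linear_combination C (coeff s p) * X (.inr 1) ^ s 1 * this

/-- restriction to the graph of Frobenius -/
noncomputable def eF {k : Type} [Field k] [Fintype k] (f : MvPolynomial (Fin 2) k) :
    P4 k →ₐ[k] CR f :=
  aeval (Sum.elim (fun i => qm f (X i)) (fun i => qm f (X i) ^ Fintype.card k))

/-- restriction to the diagonal -/
noncomputable def eD {k : Type} [Field k] (f : MvPolynomial (Fin 2) k) : P4 k →ₐ[k] CR f :=
  aeval (Sum.elim (fun i => qm f (X i)) (fun i => qm f (X i)))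

/-- first coordinates -/
noncomputable def inL (k : Type) [Field k] : MvPolynomial (Fin 2) k →ₐ[k] P4 k := rename Sum.inl

/-- second coordinates -/
noncomputable def inR (k : Type) [Field k] : MvPolynomial (Fin 2) k →ₐ[k] P4 k := rename Sum.inr

theorem eF_inL {k : Type} [Field k] [Fintype k] (f p : MvPolynomial (Fin 2) k) :
    eF f (inL k p) = qm f p := by
  have : (eF f).comp (inL k) = qm f := by
    apply algHom_ext
    intro i
    simp [eF, inL]
  exact DFunLike.congr_fun this p

theorem eF_inR {k : Type} [Field k] [Fintype k] (f p : MvPolynomial (Fin 2) k) :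
    eF f (inR k p) = qm f p ^ Fintype.card k := by
  have : (eF f).comp (inR k) = (FiniteField.frobeniusAlgHom k (CR f)).comp (qm f) := by
    apply algHom_ext
    intro i
    simp [eF, inR]
  exact DFunLike.congr_fun this p

theorem eD_inL {k : Type} [Field k] (f p : MvPolynomial (Fin 2) k) :
    eD f (inL k p) = qm f p := by
  have : (eD f).comp (inL k) = qm f := by
    apply algHom_ext
    intro i
    simp [eD, inL]
  exact DFunLike.congr_fun this p

theorem eD_inR {k : Type} [Field k] (f p : MvPolynomial (Fin 2) k) :
    eD f (inR k p) = qm f p := by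
  have : (eD f).comp (inR k) = qm f := by
    apply algHom_ext
    intro i
    simp [eD, inR]
  exact DFunLike.congr_fun this p

/-- lift of the restriction to the diagonal -/
noncomputable def rho (k : Type) [Field k] : P4 k →ₐ[k] P4 k :=
  rename (Sum.elim Sum.inl Sum.inl)

theorem eF_rho {k : Type} [Field k] [Fintype k] (f : MvPolynomial (Fin 2) k) (p : P4 k) :
    eF f (rho k p) = eD f p := by
  have : (eF f).comp (rho k) = eD f := by
    apply algHom_ext
    rintro (i | i) <;> simp [eF, rho, eD]
  exact DFunLike.congr_fun this p

theorem eD_mem_filt {k : Type} [Field k] (f : MvPolynomial (Fin 2) k) {p : P4 k} {n : ℕ}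
    (hp : p.totalDegree ≤ n) : eD f p ∈ filt f n := by
  rw [mem_filt]
  refine ⟨rename (Sum.elim id id) p, (totalDegree_rename_le _ _).trans hp, ?_⟩
  have : (qm f).comp (rename (Sum.elim id id)) = eD f := by
    apply algHom_ext
    rintro (i | i) <;> simp [eD]
  exact DFunLike.congr_fun this p

theorem exists_PsiTheta {k : Type} [Field k] [Fintype k] (f : MvPolynomial (Fin 2) k) {d : ℕ}
    (hd : f.totalDegree = d) : ∃ Ψ Θ : P4 k, Ψ.totalDegree ≤ d - 1 ∧ Θ.totalDegree ≤ d - 1 ∧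
      (eF f (X (.inr 1)) - eF f (X (.inl 1))) * eF f Ψ =
        (eF f (X (.inr 0)) - eF f (X (.inl 0))) * eF f Θ ∧
      ∀ P : Pts f, evP P (eF f Ψ) = eval P.1 (pderiv 1 f) := by
  obtain ⟨Ψ, h1, h2, h3⟩ := exists_diff_one f hd.le
  obtain ⟨Θ, h4, h5⟩ := exists_diff_zero f hd.le
  have hl : aeval ![X (.inl 0), X (.inl 1)] f = inL k f := by
    have : aeval ![X (.inl 0), X (.inl 1)] = inL k := by
      apply algHom_ext
      intro i
      fin_cases i <;> simp [inL]
    rw [this]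
  have hr : aeval ![X (.inr 0), X (.inr 1)] f = inR k f := by
    have : aeval ![X (.inr 0), X (.inr 1)] = inR k := by
      apply algHom_ext
      intro i
      fin_cases i <;> simp [inR]
    rw [this]
  have hq0 : qm f f = 0 := Ideal.Quotient.eq_zero_iff_mem.2 (Ideal.mem_span_singleton_self f)
  refine ⟨Ψ, -Θ, h1, by rwa [totalDegree_neg], ?_, ?_⟩
  · rw [hl] at h2
    rw [hr] at h5
    have h6 := congrArg (eF f) h2
    have h7 := congrArg (eF f) h5
    rw [map_sub, eF_inL, hq0, map_mul, map_sub] at h6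
    rw [map_sub, eF_inR, hq0, map_mul, map_sub, zero_pow Fintype.card_ne_zero] at h7
    rw [h6, map_neg]
    linear_combination h7
  · intro P
    rw [← h3]
    have : (evP P).comp (eF f) = aeval (Sum.elim P.1 P.1) := by
      apply algHom_ext
      rintro (i | i)
      · simp [eF]
        exact (evP_qm P (X i)).trans (eval_X i)
      · simp [eF, FiniteField.pow_card]
        exact (evP_qm P (X i)).trans (eval_X i)
    exact DFunLike.congr_fun this Ψ

theorem exists_T_mono {k : Type} [Field k] [Fintype k] (f : MvPolynomial (Fin 2) k) {d : ℕ}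
    (hd2 : 2 ≤ d) {Ψ Θ : P4 k} (h1 : Ψ.totalDegree ≤ d - 1) (h2 : Θ.totalDegree ≤ d - 1)
    (h3 : (eF f (X (.inr 1)) - eF f (X (.inl 1))) * eF f Ψ =
        (eF f (X (.inr 0)) - eF f (X (.inl 0))) * eF f Θ) (μ : Fin 2 ⊕ Fin 2 →₀ ℕ) :
    ∃ t : P4 k, t.totalDegree ≤ (μ.sum fun _ e => e) + (d - 2) ∧
      (eF f (monomial μ 1) - eD f (monomial μ 1)) * eF f Ψ =
        (eF f (X (.inr 0)) - eF f (X (.inl 0))) * eF f t := by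
  have hzero : ∃ t : P4 k, t.totalDegree ≤ ((0 : Fin 2 ⊕ Fin 2 →₀ ℕ).sum fun _ e => e) + (d - 2) ∧
      (eF f (monomial 0 1) - eD f (monomial 0 1)) * eF f Ψ =
        (eF f (X (.inr 0)) - eF f (X (.inl 0))) * eF f t :=
    ⟨0, by simp, by simp⟩
  have hadd : ∀ μ ν : Fin 2 ⊕ Fin 2 →₀ ℕ,
    (∃ t : P4 k, t.totalDegree ≤ (μ.sum fun _ e => e) + (d - 2) ∧
      (eF f (monomial μ 1) - eD f (monomial μ 1)) * eF f Ψ =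
        (eF f (X (.inr 0)) - eF f (X (.inl 0))) * eF f t) →
    (∃ t : P4 k, t.totalDegree ≤ (ν.sum fun _ e => e) + (d - 2) ∧
      (eF f (monomial ν 1) - eD f (monomial ν 1)) * eF f Ψ =
        (eF f (X (.inr 0)) - eF f (X (.inl 0))) * eF f t) →
    (∃ t : P4 k, t.totalDegree ≤ ((μ + ν).sum fun _ e => e) + (d - 2) ∧
      (eF f (monomial (μ + ν) 1) - eD f (monomial (μ + ν) 1)) * eF f Ψ =
        (eF f (X (.inr 0)) - eF f (X (.inl 0))) * eF f t) := by
    rintro μ ν ⟨t, ht, ht'⟩ ⟨u, hu, hu'⟩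
    refine ⟨monomial μ 1 * u + t * rho k (monomial ν 1), ?_, ?_⟩
    · rw [Finsupp.sum_add_index' (by simp) (by simp)]
      refine (totalDegree_add _ _).trans (max_le ?_ ?_)
      · refine (totalDegree_mul _ _).trans ?_
        rw [totalDegree_monomial _ one_ne_zero]
        omega
      · refine (totalDegree_mul _ _).trans ?_
        have : (rho k (monomial ν 1)).totalDegree ≤ _ := totalDegree_rename_le _ _
        rw [totalDegree_monomial _ one_ne_zero] at this
        omega
    · have : (monomial (μ + ν) (1 : k)) = monomial μ 1 * monomial ν 1 := by simp [monomial_mul]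
      rw [this]
      simp only [map_mul, map_add, eF_rho]
      linear_combination eF f (monomial μ 1) * hu' + eD f (monomial ν 1) * ht'
  have hsingle : ∀ v, ∃ t : P4 k,
      t.totalDegree ≤ ((Finsupp.single v 1 : Fin 2 ⊕ Fin 2 →₀ ℕ).sum fun _ e => e) + (d - 2) ∧
      (eF f (monomial (Finsupp.single v 1) 1) - eD f (monomial (Finsupp.single v 1) 1)) * eF f Ψ =
        (eF f (X (.inr 0)) - eF f (X (.inl 0))) * eF f t := by
    intro v
    change ∃ t : P4 k, _ ∧ (eF f (X v) - eD f (X v)) * eF f Ψ = _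
    rw [Finsupp.sum_single_index rfl]
    rcases v with i | i
    · exact ⟨0, by simp, by simp [eF, eD]⟩
    · have hD : eD f (X (.inr i)) = eF f (X (.inl i)) := by simp [eD, eF]
      rw [hD]
      fin_cases i
      · exact ⟨Ψ, by omega, rfl⟩
      · exact ⟨Θ, by omega, h3⟩
  induction μ using Finsupp.induction_linear with
  | zero => exact hzero
  | add μ ν h h' => exact hadd μ ν h h'
  | single v e =>
    induction e with
    | zero => rw [Finsupp.single_zero]; exact hzero
    | succ e ih => rw [Finsupp.single_add]; exact hadd _ _ ih (hsingle v)

theorem exists_T {k : Type} [Field k] [Fintype k] (f : MvPolynomial (Fin 2) k) {d : ℕ}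
    (hd2 : 2 ≤ d) (hd : f.totalDegree = d) : ∃ (U : CR f) (T : P4 k →ₗ[k] P4 k),
      (∀ P : Pts f, evP P U = eval P.1 (pderiv 1 f)) ∧
      (∀ (n : ℕ) (p : P4 k), p.totalDegree ≤ n → (T p).totalDegree ≤ n + (d - 2)) ∧
      ∀ p : P4 k, (eF f p - eD f p) * U =
        (qm f (X 0) ^ Fintype.card k - qm f (X 0)) * eF f (T p) := by
  obtain ⟨Ψ, Θ, h1, h2, h3, h4⟩ := exists_PsiTheta f hd
  choose t ht ht' using exists_T_mono f hd2 h1 h2 h3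
  let T : P4 k →ₗ[k] P4 k := (basisMonomials (Fin 2 ⊕ Fin 2) k).constr k t
  have hT : ∀ μ, T (monomial μ 1) = t μ := fun μ => by
    have := (basisMonomials (Fin 2 ⊕ Fin 2) k).constr_basis k t μ
    rwa [coe_basisMonomials] at this
  have hmon : ∀ (μ : Fin 2 ⊕ Fin 2 →₀ ℕ) (c : k), monomial μ c = c • monomial μ (1 : k) := by
    intro μ c; simp [smul_monomial]
  refine ⟨eF f Ψ, T, h4, ?_, ?_⟩
  · intro n p hp
    rw [p.as_sum, map_sum]
    apply totalDegree_finsetSum_le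
    intro μ hμ
    rw [hmon, map_smul, hT]
    refine (totalDegree_smul_le _ _).trans ((ht μ).trans ?_)
    have := le_totalDegree hμ
    omega
  · intro p
    have hx : qm f (X 0) ^ Fintype.card k - qm f (X 0) = eF f (X (.inr 0)) - eF f (X (.inl 0)) := by
      simp [eF]
    rw [hx]
    conv_lhs => rw [p.as_sum]
    conv_rhs => rw [p.as_sum]
    simp only [map_sum]
    rw [← Finset.sum_sub_distrib, Finset.sum_mul, Finset.mul_sum]
    refine Finset.sum_congr rfl fun μ _ => ?_
    rw [hmon, map_smul, map_smul, map_smul, map_smul, hT, ← smul_sub, smul_mul_assoc, ht',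
      mul_smul_comm]

end Stepanov


namespace Stepanov

theorem filt_pow {k : Type} [Field k] (f : MvPolynomial (Fin 2) k) {m : ℕ} {a : CR f}
    (ha : a ∈ filt f m) (q : ℕ) : a ^ q ∈ filt f (m * q) := by
  rw [mem_filt] at *
  obtain ⟨p, hp, rfl⟩ := ha
  refine ⟨p ^ q, (totalDegree_pow _ _).trans ?_, by rw [map_pow]⟩
  rw [mul_comm]
  exact Nat.mul_le_mul_right _ hp

theorem iter_deg {k : Type} [Field k] {T : P4 k →ₗ[k] P4 k} {e : ℕ}
    (hT : ∀ (n : ℕ) (p : P4 k), p.totalDegree ≤ n → (T p).totalDegree ≤ n + e)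
    (i : ℕ) (n : ℕ) (p : P4 k) (hp : p.totalDegree ≤ n) : ((T ^ i) p).totalDegree ≤ n + i * e := by
  induction i with
  | zero => simpa using hp
  | succ i ih =>
    rw [pow_succ', Module.End.mul_apply]
    refine (hT _ _ ih).trans ?_
    rw [add_mul]; omega

theorem iter_id {k : Type} [Field k] [Fintype k] {f : MvPolynomial (Fin 2) k}
    {T : P4 k →ₗ[k] P4 k} {U w : CR f}
    (hT : ∀ p : P4 k, (eF f p - eD f p) * U = w * eF f (T p)) (M : ℕ) (G : P4 k)
    (hG : ∀ i < M, eD f ((T ^ i) G) = 0) : eF f G * U ^ M = w ^ M * eF f ((T ^ M) G) := by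
  induction M with
  | zero => simp
  | succ M ih =>
    have h1 := ih fun i hi => hG i (by omega)
    have h2 := hT ((T ^ M) G)
    rw [hG M (by omega)] at h2
    rw [pow_succ' T, Module.End.mul_apply]
    linear_combination U * h1 + w ^ M * h2

theorem mem_pow_of_mul {A : Type} [CommRing A] {m : Ideal A} (hm : m.IsMaximal) {g U : A} {M : ℕ}
    (hU : U ∉ m) (h : g * U ^ M ∈ m ^ M) : g ∈ m ^ M := by
  obtain ⟨v, hv⟩ := hm.exists_inv hU
  obtain ⟨w, hw, hvw⟩ := hv
  have h1 : IsCoprime m (Ideal.span {U}) := by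
    rw [Ideal.isCoprime_iff_exists]
    exact ⟨w, hw, v * U, Ideal.mem_span_singleton'.2 ⟨v, rfl⟩, by rw [add_comm]; exact hvw⟩
  have h2 := h1.pow (m := M) (n := M)
  rw [Ideal.span_singleton_pow, Ideal.isCoprime_iff_exists] at h2
  obtain ⟨a, ha, b, hb, hab⟩ := h2
  obtain ⟨c, rfl⟩ := Ideal.mem_span_singleton'.1 hb
  have : g = g * a + c * (g * U ^ M) := by linear_combination (-g) * hab
  rw [this]
  exact add_mem (Ideal.mul_mem_left _ _ ha) (Ideal.mul_mem_left _ _ h)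

theorem sub_pow_card {k A : Type} [Field k] [Fintype k] [CommRing A] [Algebra k A] (a b : A) :
    (a - b) ^ Fintype.card k = a ^ Fintype.card k - b ^ Fintype.card k :=
  map_sub (FiniteField.frobeniusAlgHom k A) a b

theorem gen_smul {k A : Type} [Field k] [CommRing A] [Algebra k A] (c e : k) (s t : A) :
    (c * e) • s - c • (s * t) = c • (s * (algebraMap k A e - t)) := by
  simp only [Algebra.smul_def, map_mul]
  ring

theorem gen_mem {k A : Type} [Field k] [CommRing A] [Algebra k A] {I : Ideal A} (c : k) (s : A)
    {x : A} (hx : x ∈ I) : c • (s * x) ∈ I := by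
  rw [Algebra.smul_def]
  exact Ideal.mul_mem_left _ _ (Ideal.mul_mem_left _ _ hx)

theorem gen_pow_one {A : Type} [CommRing A] {I : Ideal A} {x : A} (hx : x ∈ I) : x ∈ I ^ 1 := by
  rwa [pow_one]

/-- nonvanishing of restriction to the graph of Frobenius -/
theorem graph_inj {k : Type} [Field k] [Fintype k] {f : MvPolynomial (Fin 2) k}
    (hf : Irreducible f) {d : ℕ} (hd : f.totalDegree = d) {l m a b : ℕ}
    (bs : Module.Basis (Fin a) k (filt f l)) (bt : Module.Basis (Fin b) k (filt f m))
    (hl : d * l < Fintype.card k) (hN : d * m < Nat.card (Pts f)) (c : Fin a × Fin b → k)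
    (hc : ∑ x, c x • ((bs x.1 : CR f) * (bt x.2 : CR f) ^ Fintype.card k) = 0) : c = 0 := by
  classical
  have h1 : ∀ P : Pts f, ∀ i, ∑ j, c (i, j) * evP P (bt j) = 0 := by
    intro P
    set g : CR f := ∑ i, (∑ j, c (i, j) * evP P (bt j)) • (bs i : CR f) with hg
    have hgf : g ∈ filt f l := Submodule.sum_mem _ fun i _ => Submodule.smul_mem _ _ (bs i).2
    have hgm : g ∈ mP P ^ Fintype.card k := by
      have : g = ∑ x, c x • ((bs x.1 : CR f) *
          (algebraMap k (CR f) (evP P (bt x.2)) - (bt x.2 : CR f)) ^ Fintype.card k) := by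
        have e1 : g = g - ∑ x, c x • ((bs x.1 : CR f) * (bt x.2 : CR f) ^ Fintype.card k) := by
          rw [hc, sub_zero]
        rw [e1, hg, Fintype.sum_prod_type, Fintype.sum_prod_type, ← Finset.sum_sub_distrib]
        refine Finset.sum_congr rfl fun i _ => ?_
        rw [Finset.sum_smul, ← Finset.sum_sub_distrib]
        refine Finset.sum_congr rfl fun j _ => ?_
        rw [sub_pow_card (k := k), ← map_pow, FiniteField.pow_card]
        exact gen_smul _ _ _ _
      rw [this]
      refine Ideal.sum_mem _ fun x _ => ?_
      refine gen_mem _ _ (Ideal.pow_mem_pow ?_ _)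
      rw [mem_mP, map_sub, AlgHom.commutes]
      simp
    have hg0 : g = 0 := by
      by_contra h
      have := bezout hf hd hgf h {P} (Fintype.card k) (by simpa using hgm)
      simp at this
      omega
    have hli := (Fintype.linearIndependent_iff.1 bs.linearIndependent)
      (fun i => ∑ j, c (i, j) * evP P (bt j)) (by
        apply Subtype.ext
        simpa [hg] using hg0)
    exact hli
  funext ⟨i, j⟩
  have h2 : ∑ j, c (i, j) • (bt j) = 0 := by
    by_contra h
    have : Finite (Pts f) := inferInstance
    have := Fintype.ofFinite (Pts f)
    have h3 := bezout hf hd (n := m) (g := ((∑ j, c (i, j) • (bt j) : filt f m) : CR f))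
      (Subtype.coe_prop _) (fun h' => h (Subtype.ext h')) Finset.univ 1 (by
        intro P _
        refine gen_pow_one ?_
        rw [mem_mP]
        have := h1 P i
        simpa using this)
    rw [Finset.card_univ, ← Nat.card_eq_fintype_card] at h3
    omega
  exact (Fintype.linearIndependent_iff.1 bt.linearIndependent) (fun j => c (i, j)) h2 j

theorem stepanov {k : Type} [Field k] [Fintype k] {f : MvPolynomial (Fin 2) k}
    (hf : Irreducible f) {d : ℕ} (hd2 : 2 ≤ d) (hd : f.totalDegree = d) {l m M : ℕ}
    (hl : d * l < Fintype.card k) (hN : d * m < Nat.card (Pts f))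
    (hdim : ∑ i : Fin M, Module.finrank k (filt f (l + m + i * (d - 2))) <
      Module.finrank k (filt f l) * Module.finrank k (filt f m)) (S : Finset (Pts f))
    (hS : ∀ P ∈ S, eval P.1 (pderiv 1 f) ≠ 0) : M * S.card ≤ d * (l + m * Fintype.card k) := by
  classical
  obtain ⟨U, T, hU, hTd, hT⟩ := exists_T f hd2 hd
  let bs := Module.finBasis k (filt f l)
  let bt := Module.finBasis k (filt f m)
  choose sp hsp hsp' using fun i => (mem_filt f l _).1 (bs i).2
  choose tp htp htp' using fun i => (mem_filt f m _).1 (bt i).2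
  let G : (Fin (Module.finrank k (filt f l)) × Fin (Module.finrank k (filt f m)) → k) →ₗ[k] P4 k :=
    Fintype.linearCombination k fun x => inL k (sp x.1) * inR k (tp x.2)
  have hGdeg : ∀ c, (G c).totalDegree ≤ l + m := by
    intro c
    simp only [G, Fintype.linearCombination_apply]
    apply totalDegree_finsetSum_le
    intro x _
    refine (totalDegree_smul_le _ _).trans ((totalDegree_mul _ _).trans ?_)
    exact add_le_add ((totalDegree_rename_le _ _).trans (hsp _))
      ((totalDegree_rename_le _ _).trans (htp _))
  let Φ : (Fin (Module.finrank k (filt f l)) × Fin (Module.finrank k (filt f m)) → k) →ₗ[k]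
      ((i : Fin M) → filt f (l + m + i * (d - 2))) :=
    LinearMap.pi fun i => LinearMap.codRestrict _
      ((eD f).toLinearMap.comp ((T ^ (i : ℕ)).comp G)) fun c =>
        eD_mem_filt f (iter_deg hTd i _ _ (hGdeg c))
  have hker : LinearMap.ker Φ ≠ ⊥ := by
    apply LinearMap.ker_ne_bot_of_finrank_lt
    rw [Module.finrank_pi_fintype, Module.finrank_fintype_fun_eq_card, Fintype.card_prod,
      Fintype.card_fin, Fintype.card_fin]
    exact hdim
  obtain ⟨c, hc, hc0⟩ := Submodule.exists_mem_ne_zero_of_ne_bot hker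
  have hG0 : ∀ i < M, eD f ((T ^ i) (G c)) = 0 := by
    intro i hi
    have := congrFun (LinearMap.mem_ker.1 hc) ⟨i, hi⟩
    exact congrArg Subtype.val this
  have hkey := iter_id hT M (G c) hG0
  have hg : eF f (G c) = ∑ x, c x • ((bs x.1 : CR f) * (bt x.2 : CR f) ^ Fintype.card k) := by
    simp only [G, Fintype.linearCombination_apply]
    rw [map_sum]
    refine Finset.sum_congr rfl fun x _ => ?_
    rw [map_smul, map_mul, eF_inL, eF_inR, hsp', htp']
  have hg0 : eF f (G c) ≠ 0 := by
    intro h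
    rw [hg] at h
    exact hc0 (graph_inj hf hd bs bt hl hN c h)
  have hgf : eF f (G c) ∈ filt f (l + m * Fintype.card k) := by
    rw [hg]
    exact Submodule.sum_mem _ fun x _ => Submodule.smul_mem _ _
      (filt_mul f (bs x.1).2 (filt_pow f (bt x.2).2 _))
  refine bezout hf hd hgf hg0 S M fun P hP => ?_
  refine mem_pow_of_mul (U := U) (mP_isMaximal P) ?_ ?_
  · rw [mem_mP, hU]
    exact hS P hP
  · rw [hkey]
    refine Ideal.mul_mem_right _ _ (Ideal.pow_mem_pow ?_ _)
    rw [mem_mP, map_sub, map_pow, FiniteField.pow_card, sub_self]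

theorem card_bad {k : Type} [Field k] [Fintype k] {f : MvPolynomial (Fin 2) k}
    (hf : Irreducible f) {d : ℕ} (hd2 : 2 ≤ d) (hd : f.totalDegree = d) (hy : pderiv 1 f ≠ 0)
    (S : Finset (Pts f)) (hS : ∀ P ∈ S, eval P.1 (pderiv 1 f) = 0) : S.card ≤ d * (d - 1) := by
  have hdeg : (pderiv 1 f).totalDegree ≤ d - 1 := by
    rw [totalDegree_eq]
    apply Finset.sup_le
    intro s hs
    have h1 : coeff s (pderiv 1 f) ≠ 0 := mem_support_iff.1 hs
    rw [coeff_pderiv] at h1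
    have h2 : s + Finsupp.single 1 1 ∈ f.support := mem_support_iff.2 (left_ne_zero_of_mul h1)
    have h3 := sum_le_sub_one h2
    simp at h3
    rw [Finsupp.card_toMultiset, Finsupp.sum_fintype _ _ (by simp), Fin.sum_univ_two]
    simp only [id]
    omega
  have h0 : qm f (pderiv 1 f) ≠ 0 := by
    intro h
    obtain ⟨r, hr⟩ := Ideal.mem_span_singleton.1 (Ideal.Quotient.eq_zero_iff_mem.1 h)
    have hr0 : r ≠ 0 := by rintro rfl; exact hy (by rw [hr, mul_zero])
    rw [hr, totalDegree_mul_of_isDomain hf.ne_zero hr0] at hdeg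
    omega
  have := bezout hf hd ((mem_filt f (d - 1) _).2 ⟨_, hdeg, rfl⟩) h0 S 1 (by
    intro P hP
    refine gen_pow_one ?_
    rw [mem_mP, evP_qm]
    exact hS P hP)
  omega

end Stepanov


namespace Stepanov

theorem num_a {d M : ℤ} (hd : 4 ≤ d) (hM : 29 * (d * (d - 1) * (d - 2)) ≤ 25 * M) :
    2 * d * (d - 1) ≤ M := by
  nlinarith [mul_nonneg (mul_nonneg (by linarith : 0 ≤ d) (by linarith : 0 ≤ d - 1))
    (by linarith : 0 ≤ d - 4)]

theorem num_dim {d M q L X : ℤ} (hd : 4 ≤ d) (hM : 2 * d * (d - 1) ≤ M) (hq : M * M ≤ q)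
    (hL : q - d ≤ L) (hX : 2 * M + 2 * d ^ 2 - 5 * d + 4 ≤ 2 * X) :
    2 * (M * (2 * (L + X) - (d ^ 2 - 3 * d)) + d * (d - 2) * (M * (M - 1))) <
      (2 * L - (d ^ 2 - 3 * d)) * (2 * X - (d ^ 2 - 3 * d)) := by
  have h0 : 0 ≤ M - 2 * d * (d - 1) := by linarith
  have hM0 : 24 ≤ M := by nlinarith
  have h1 : 0 < 4 * M ^ 2 - (2 * d ^ 2 - 6 * d + 8) * M - (d ^ 2 - d) * (d ^ 2 - 2 * d + 4) := by
    have a1 : d ^ 2 - 3 * d + 4 ≤ M := by nlinarith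
    have a2 : d ^ 2 - 2 * d + 4 ≤ M := by nlinarith
    have a3 : d ^ 2 - d ≤ M := by nlinarith
    have b1 := mul_le_mul_of_nonneg_right a1 (by linarith : 0 ≤ M)
    have b2 : (d ^ 2 - d) * (d ^ 2 - 2 * d + 4) ≤ M * M :=
      mul_le_mul a3 a2 (by nlinarith) (by linarith)
    nlinarith
  have hLM : 0 ≤ L - (M * M - d) := by linarith
  have hXM : 0 ≤ 2 * X - (2 * M + 2 * d ^ 2 - 5 * d + 4) := by linarith
  have c1 : 0 ≤ 2 * (M * M - d) - (d ^ 2 - 3 * d) - 2 * M := by nlinarith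
  have c2 : 0 ≤ 2 * d ^ 2 - 4 * d + 8 := by nlinarith
  nlinarith [mul_nonneg hLM c2, mul_nonneg c1 hXM, mul_nonneg hLM hXM]

theorem num_fin {d M q X N : ℤ} (hd : 4 ≤ d) (hM : 29 * (d * (d - 1) * (d - 2)) ≤ 25 * M)
    (hq : M * M ≤ q) (hX : 2 * X ≤ 2 * M + 2 * d ^ 2 - 3 * d + 3)
    (hN : M * (N - d * (d - 1)) ≤ q - 1 + X * q) :
    50 * (d - 2) * (N + d - q - 1) ≤ 47 * q := by
  have hM2 := num_a hd hM
  have hM0 : 24 ≤ M := by nlinarith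
  have hq0 : 0 < q := by nlinarith
  have e1 : 2 * M * (N + d - q - 1) ≤ (2 * d ^ 2 - 3 * d + 5) * q + 2 * M * (d ^ 2 - 1) := by
    nlinarith [mul_le_mul_of_nonneg_right hX hq0.le]
  have e2 : 50 * (d - 2) * (2 * d ^ 2 - 3 * d + 5) ≤ 90 * M := by
    have : 0 ≤ (d - 2) * (d - 4) * (d - 1) := by
      apply mul_nonneg (mul_nonneg _ _) <;> linarith
    nlinarith [mul_nonneg (by linarith : 0 ≤ d - 2) (by linarith : 0 ≤ d - 4)]
  have e3 : 100 * (d - 2) * (d ^ 2 - 1) ≤ 4 * q := by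
    set W := d * (d - 1) * (d - 2) with hW
    have hW0 : 24 ≤ W := by
      have : 12 ≤ d * (d - 1) := by nlinarith
      nlinarith
    have f1 : 841 * (W * W) ≤ 625 * (M * M) := by nlinarith
    have f2 : (d - 2) * (d ^ 2 - 1) * 4 ≤ 5 * W := by
      rw [hW]
      nlinarith [mul_nonneg (mul_nonneg (by linarith : 0 ≤ d - 2) (by linarith : 0 ≤ d - 4))
        (by linarith : 0 ≤ d - 1)]
    nlinarith
  have hpos : 0 < 2 * M := by linarith
  have e4 : 2 * M * (50 * (d - 2) * (N + d - q - 1)) ≤ 2 * M * (47 * q) := by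
    have := mul_le_mul_of_nonneg_left e1 (by linarith : 0 ≤ 50 * (d - 2))
    nlinarith [mul_le_mul_of_nonneg_right e2 hq0.le, mul_le_mul_of_nonneg_left e3 (by linarith : 0 ≤ M)]
  exact le_of_mul_le_mul_left e4 hpos

theorem sum_dim {k : Type} [Field k] {f : MvPolynomial (Fin 2) k} (hf : f ≠ 0) {d : ℕ}
    (hd2 : 2 ≤ d) (hd : f.totalDegree = d) {n : ℕ} (hn : d ≤ n) (M : ℕ) :
    (2 * ((∑ i : Fin M, Module.finrank k (filt f (n + i * (d - 2))) : ℕ) : ℤ)) =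
      M * (2 * (d * n) - ((d : ℤ) ^ 2 - 3 * d)) + d * (d - 2) * (M * (M - 1)) := by
  rw [Fin.sum_univ_eq_sum_range (fun i => Module.finrank k (filt f (n + i * (d - 2)))) M]
  induction M with
  | zero => simp
  | succ M ih =>
    rw [Finset.sum_range_succ]
    have h := finrank_filt hf hd (n := n + M * (d - 2)) (by omega)
    zify [hd2] at h
    push_cast
    push_cast at ih
    linear_combination ih + h

theorem affine_bound_aux {k : Type} [Field k] [Fintype k] {f : MvPolynomial (Fin 2) k}
    (hf : Irreducible f) {d : ℕ} (hd4 : 4 ≤ d) (hd : f.totalDegree = d)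
    (hy : pderiv 1 f ≠ 0) {M : ℕ} (hq : M * M ≤ Fintype.card k)
    (hM : 29 * ((d : ℤ) * (d - 1) * (d - 2)) ≤ 25 * M) :
    50 * ((d : ℤ) - 2) * (Nat.card (Pts f) + d - Fintype.card k - 1) ≤ 47 * Fintype.card k := by
  classical
  set q := Fintype.card k with hqdef
  have hd4' : (4 : ℤ) ≤ d := by exact_mod_cast hd4
  have hqz : (M : ℤ) * M ≤ q := by exact_mod_cast hq
  have hM2 := num_a hd4' hM
  have hM24 : (24 : ℤ) ≤ M := by nlinarith
  have hdM : (d : ℤ) * (d + 1) ≤ M := by nlinarith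
  have hMq : (M : ℤ) + M ≤ q := by nlinarith
  have hdd : (M : ℤ) * 24 ≤ q := by nlinarith
  obtain ⟨l, hl1, hl2⟩ : ∃ l : ℕ, d * l < q ∧ q ≤ d * l + d := by
    refine ⟨(q - 1) / d, ?_, ?_⟩
    · have := Nat.mul_div_le (q - 1) d
      have : 0 < q := by zify; linarith
      omega
    · have := Nat.lt_mul_div_succ (q - 1) (by omega : 0 < d)
      rw [mul_add] at this
      omega
  obtain ⟨m, hm1, hm2⟩ : ∃ m : ℕ, 2 * M + 2 * d ^ 2 + 4 ≤ 2 * (d * m) + 5 * d ∧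
      2 * (d * m) + 3 * d ≤ 2 * M + 2 * d ^ 2 + 3 := by
    have h5 : 5 * d ≤ 2 * M + 2 * d ^ 2 + 4 := by nlinarith
    obtain ⟨A, hA⟩ := Nat.exists_eq_add_of_le h5
    refine ⟨(A + 2 * d - 1) / (2 * d), ?_, ?_⟩
    · have := Nat.lt_mul_div_succ (A + 2 * d - 1) (by omega : 0 < 2 * d)
      rw [mul_add, mul_assoc] at this
      omega
    · have := Nat.mul_div_le (A + 2 * d - 1) (2 * d)
      rw [mul_assoc] at this
      omega
  have hdl : d ≤ l := by
    by_contra h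
    have : d * l ≤ d * d := Nat.mul_le_mul_left _ (by omega)
    zify at this hl2
    nlinarith
  have hdm : d ≤ m := by
    by_contra h
    have : d * m ≤ d * d := Nat.mul_le_mul_left _ (by omega)
    zify at this hm1
    nlinarith
  zify at hm1 hm2
  by_cases hN : d * m < Nat.card (Pts f)
  · have hdim : ∑ i : Fin M, Module.finrank k (filt f (l + m + i * (d - 2))) <
        Module.finrank k (filt f l) * Module.finrank k (filt f m) := by
      have h1 := sum_dim hf.ne_zero (by omega) hd (n := l + m) (by omega) M
      have h2 := finrank_filt hf.ne_zero hd hdl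
      have h3 := finrank_filt hf.ne_zero hd hdm
      have h4 := num_dim (L := (d : ℤ) * l) (X := (d : ℤ) * m) hd4' hM2 hqz
        (by zify at hl2; linarith) (by linarith)
      zify at h2 h3
      have e2 : 2 * ((d : ℤ) * l) - (d ^ 2 - 3 * d) = 2 * Module.finrank k (filt f l) := by linarith
      have e3 : 2 * ((d : ℤ) * m) - (d ^ 2 - 3 * d) = 2 * Module.finrank k (filt f m) := by linarith
      rw [e2, e3, ← mul_add (d : ℤ)] at h4
      push_cast at h1
      zify
      linarith
    let _ := Fintype.ofFinite (Pts f)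
    have g1 := stepanov hf (by omega) hd hl1 hN hdim
      (Finset.univ.filter fun P => eval P.1 (pderiv 1 f) ≠ 0) (by simp)
    have g2 := card_bad hf (by omega) hd hy
      (Finset.univ.filter fun P => ¬ eval P.1 (pderiv 1 f) ≠ 0) (by simp)
    have g3 := Finset.card_filter_add_card_filter_not (s := (Finset.univ : Finset (Pts f)))
      (fun P => eval P.1 (pderiv 1 f) ≠ 0)
    rw [Finset.card_univ, ← Nat.card_eq_fintype_card] at g3
    refine num_fin (M := M) (X := (d : ℤ) * m) hd4' hM hqz (by linarith) ?_
    zify [(by omega : 1 ≤ d)] at g1 g2 g3 hl1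
    rw [← hqdef] at g1
    have : (M : ℤ) * (Nat.card (Pts f) - d * (d - 1)) ≤ M *
        (Finset.univ.filter fun P : Pts f => eval P.1 (pderiv 1 f) ≠ 0).card :=
      mul_le_mul_of_nonneg_left (by linarith) (by linarith)
    linarith
  · have : (Nat.card (Pts f) : ℤ) ≤ d * m := by exact_mod_cast not_lt.1 hN
    have : (Nat.card (Pts f) : ℤ) + d - q - 1 ≤ 0 := by nlinarith
    nlinarith

end Stepanov


namespace Stepanov

theorem pderiv_zero_dvd {k : Type} [Field k] {p : ℕ} [CharP k p] {f : MvPolynomial (Fin 2) k}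
    {j : Fin 2} (h : pderiv j f = 0) {s : Fin 2 →₀ ℕ} (hs : s ∈ f.support) : p ∣ s j := by
  rcases Nat.eq_zero_or_pos (s j) with h0 | h0
  · rw [h0]; exact dvd_zero _
  have h1 : s - Finsupp.single j 1 + Finsupp.single j 1 = s := by
    ext i
    by_cases hi : i = j
    · subst hi
      simp
      omega
    · simp [Finsupp.single_apply, Ne.symm hi]
  have h2 := congrArg (coeff (s - Finsupp.single j 1)) h
  rw [coeff_pderiv, h1, coeff_zero] at h2
  have h3 : (((s - Finsupp.single j 1 : Fin 2 →₀ ℕ) j : ℕ) : k) + 1 = ((s j : ℕ) : k) := by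
    simp only [Finsupp.tsub_apply, Finsupp.single_eq_same]
    rw [Nat.cast_sub h0]
    simp
  rw [h3] at h2
  exact (CharP.cast_eq_zero_iff k p _).1
    ((mul_eq_zero.1 h2).resolve_left (mem_support_iff.1 hs))

theorem pderiv_ne {k : Type} [Field k] [Fintype k] {f : MvPolynomial (Fin 2) k}
    (hf : Irreducible f) : pderiv 0 f ≠ 0 ∨ pderiv 1 f ≠ 0 := by
  by_contra! h
  obtain ⟨p, hp⟩ := CharP.exists k
  have hpp : Fact p.Prime := ⟨CharP.char_is_prime k p⟩
  have hdvd : ∀ s ∈ f.support, ∀ j, p ∣ s j := by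
    intro s hs j
    fin_cases j
    · exact pderiv_zero_dvd h.1 hs
    · exact pderiv_zero_dvd h.2 hs
  have key : f = (∑ s ∈ f.support, monomial (s.mapRange (· / p) (by simp))
      ((frobeniusEquiv k p).symm (coeff s f))) ^ p := by
    rw [sum_pow_char]
    conv_lhs => rw [f.as_sum]
    refine Finset.sum_congr rfl fun s hs => ?_
    rw [monomial_pow]
    have e1 : p • (s.mapRange (· / p) (by simp)) = s := by
      ext j
      simp [Nat.mul_div_cancel' (hdvd s hs j)]
    rw [e1]
    simp
  rw [key] at hf
  exact not_irreducible_pow hpp.out.ne_one hf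

theorem affine_bound {k : Type} [Field k] [Fintype k] {f : MvPolynomial (Fin 2) k}
    (hf : Irreducible f) {d : ℕ} (hd4 : 4 ≤ d) (hd : f.totalDegree = d)
    {M : ℕ} (hq : M * M ≤ Fintype.card k)
    (hM : 29 * ((d : ℤ) * (d - 1) * (d - 2)) ≤ 25 * M) :
    50 * ((d : ℤ) - 2) * (Nat.card (Pts f) + d - Fintype.card k - 1) ≤ 47 * Fintype.card k := by
  rcases pderiv_ne hf with h | h
  · let σ := Equiv.swap (0 : Fin 2) 1
    have h1 : Irreducible (renameEquiv k σ f) := (MulEquiv.irreducible_iff (renameEquiv k σ)).2 hf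
    have h2 : (renameEquiv k σ f).totalDegree = d := by rw [totalDegree_renameEquiv, hd]
    have h3 : pderiv 1 (renameEquiv k σ f) ≠ 0 := by
      have e : (1 : Fin 2) = σ 0 := by simp [σ]
      rw [e, renameEquiv_apply, pderiv_rename σ.injective]
      intro h4
      exact h (rename_injective _ σ.injective (by rw [h4, map_zero]))
    have h4 := affine_bound_aux h1 hd4 h2 h3 hq hM
    have h5 : Nat.card (Pts (renameEquiv k σ f)) = Nat.card (Pts f) := by
      refine Nat.card_congr ((σ.arrowCongr (Equiv.refl k)).subtypeEquiv fun a => ?_)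
      rw [renameEquiv_apply, eval_rename]
      have : a ∘ σ = (σ.arrowCongr (Equiv.refl k)) a := by
        funext i; simp [σ, Equiv.arrowCongr]
      rw [this]
    rw [h5] at h4
    exact h4
  · exact affine_bound_aux hf hd4 hd h hq hM

end Stepanov


namespace Stepanov

/-- dehomogenization -/
noncomputable def deh (k : Type) [Field k] : MvPolynomial (Fin 3) k →ₐ[k] MvPolynomial (Fin 2) k :=
  aeval ![X 0, X 1, 1]

/-- exponent of the homogenized monomial -/
noncomputable def hexp (n : ℕ) (s : Fin 2 →₀ ℕ) : Fin 3 →₀ ℕ :=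
  Finsupp.equivFunOnFinite.symm ![s 0, s 1, n - (s 0 + s 1)]

/-- homogenization in degree `n` -/
noncomputable def hmg (k : Type) [Field k] (n : ℕ) :
    MvPolynomial (Fin 2) k →ₗ[k] MvPolynomial (Fin 3) k :=
  (basisMonomials (Fin 2) k).constr k fun s => monomial (hexp n s) 1

theorem hmg_monomial {k : Type} [Field k] (n : ℕ) (s : Fin 2 →₀ ℕ) (c : k) :
    hmg k n (monomial s c) = monomial (hexp n s) c := by
  have h1 : monomial s c = c • (basisMonomials (Fin 2) k) s := by
    simp [smul_monomial]
  rw [h1, map_smul, hmg, Module.Basis.constr_basis, smul_monomial]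
  simp

theorem deh_monomial {k : Type} [Field k] (t : Fin 3 →₀ ℕ) (c : k) :
    deh k (monomial t c) = monomial (Finsupp.equivFunOnFinite.symm ![t 0, t 1]) c := by
  rw [deh, aeval_monomial, Finsupp.prod_fintype _ _ (by simp), Fin.prod_univ_three,
    monomial_eq, Finsupp.prod_fintype _ _ (by simp), Fin.prod_univ_two]
  simp [algebraMap_eq]

theorem deh_hmg {k : Type} [Field k] (n : ℕ) (g : MvPolynomial (Fin 2) k) :
    deh k (hmg k n g) = g := by
  induction g using MvPolynomial.induction_on' with
  | monomial s c =>
    rw [hmg_monomial, deh_monomial]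
    congr 2
    ext i
    fin_cases i <;> simp [hexp]
  | add p q hp hq => rw [map_add, map_add, hp, hq]

theorem hmg_hom {k : Type} [Field k] {n : ℕ} {g : MvPolynomial (Fin 2) k}
    (hg : g.totalDegree ≤ n) : (hmg k n g).IsHomogeneous n := by
  rw [g.as_sum, map_sum]
  refine IsHomogeneous.sum _ _ _ fun s hs => ?_
  rw [hmg_monomial]
  apply isHomogeneous_monomial
  have := sum_le_sub_one hs
  rw [Finsupp.degree_eq_sum, Fin.sum_univ_three]
  simp [hexp]
  omega

theorem hmg_deh {k : Type} [Field k] {n : ℕ} {P : MvPolynomial (Fin 3) k}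
    (hP : P.IsHomogeneous n) : hmg k n (deh k P) = P := by
  conv_lhs => rw [P.as_sum, map_sum, map_sum]
  conv_rhs => rw [P.as_sum]
  refine Finset.sum_congr rfl fun s hs => ?_
  have h1 := hP.degree_eq_sum_deg_support hs
  rw [← Finsupp.degree_apply, Finsupp.degree_eq_sum, Fin.sum_univ_three] at h1
  rw [deh_monomial, hmg_monomial]
  congr 2
  ext i
  fin_cases i <;> simp [hexp]
  omega

theorem hmg_mul {k : Type} [Field k] {a b : ℕ} {g h : MvPolynomial (Fin 2) k}
    (hg : g.totalDegree ≤ a) (hh : h.totalDegree ≤ b) :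
    hmg k (a + b) (g * h) = hmg k a g * hmg k b h := by
  rw [← hmg_deh ((hmg_hom hg).mul (hmg_hom hh)), map_mul (deh k), deh_hmg, deh_hmg]

theorem not_unit_hom {k : Type} [Field k] {n : ℕ} (hn : 1 ≤ n) {P : MvPolynomial (Fin 3) k}
    (hP : P.IsHomogeneous n) : ¬ IsUnit P := by
  intro h
  have h0 := h.ne_zero
  have h1 := hP.totalDegree h0
  obtain ⟨Q, hQ⟩ := h.exists_right_inv
  have hQ0 : Q ≠ 0 := by rintro rfl; simp at hQ
  have := totalDegree_mul_of_isDomain h0 hQ0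
  rw [hQ, totalDegree_one] at this
  omega

theorem deh_deg {k : Type} [Field k] {n : ℕ} {P : MvPolynomial (Fin 3) k}
    (hP : P.IsHomogeneous n) : (deh k P).totalDegree ≤ n := by
  rw [P.as_sum, map_sum]
  apply totalDegree_finsetSum_le
  intro s hs
  have h1 := hP.degree_eq_sum_deg_support hs
  rw [← Finsupp.degree_apply, Finsupp.degree_eq_sum, Fin.sum_univ_three] at h1
  rw [deh_monomial]
  refine (totalDegree_monomial_le _ _).trans ?_
  rw [Finsupp.sum_fintype _ _ (by simp), Fin.sum_univ_two]
  simp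
  omega

theorem deh_irr {k : Type} [Field k] {d : ℕ} (hd : 2 ≤ d) {P : MvPolynomial (Fin 3) k}
    (hP : P.IsHomogeneous d) (hi : Irreducible P) :
    Irreducible (deh k P) ∧ (deh k P).totalDegree = d := by
  have hdeg : (deh k P).totalDegree = d := by
    by_contra hne
    have hlt : (deh k P).totalDegree ≤ d - 1 := by
      have := deh_deg hP
      omega
    have h1 : P = hmg k 1 1 * hmg k (d - 1) (deh k P) := by
      rw [← hmg_mul (by simp) hlt, one_mul, Nat.add_sub_cancel' (by omega), hmg_deh hP]
    rcases hi.isUnit_or_isUnit h1 with h | h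
    · exact not_unit_hom le_rfl (hmg_hom (by simp)) h
    · exact not_unit_hom (by omega) (hmg_hom hlt) h
  refine ⟨⟨?_, ?_⟩, hdeg⟩
  · intro h
    have h0 := h.ne_zero
    obtain ⟨Q, hQ⟩ := h.exists_right_inv
    have hQ0 : Q ≠ 0 := by rintro rfl; simp at hQ
    have := totalDegree_mul_of_isDomain h0 hQ0
    rw [hQ, totalDegree_one] at this
    omega
  · intro g h hgh
    have hg0 : g ≠ 0 := by rintro rfl; rw [hgh] at hdeg; simp at hdeg; omega
    have hh0 : h ≠ 0 := by rintro rfl; rw [hgh] at hdeg; simp at hdeg; omega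
    have h1 := totalDegree_mul_of_isDomain hg0 hh0
    rw [← hgh, hdeg] at h1
    have h2 : P = hmg k g.totalDegree g * hmg k h.totalDegree h := by
      rw [← hmg_mul le_rfl le_rfl, ← h1, ← hgh, hmg_deh hP]
    rcases hi.isUnit_or_isUnit h2 with h | h
    · left; have := h.map (deh k); rwa [deh_hmg] at this
    · right; have := h.map (deh k); rwa [deh_hmg] at this

theorem eval_deh {k : Type} [Field k] (P : MvPolynomial (Fin 3) k) (x : Fin 2 → k) :
    eval x (deh k P) = eval ![x 0, x 1, 1] P := by
  have : (aeval x).comp (deh k) = aeval (R := k) (S₁ := k) ![x 0, x 1, 1] := by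
    apply algHom_ext
    intro i
    fin_cases i <;> simp [deh]
  have h := DFunLike.congr_fun this P
  simpa [coe_aeval_eq_eval] using h

theorem irr_of_map {k K : Type} [Field k] [Field K] [Algebra k K] {P : MvPolynomial (Fin 3) k}
    (h : Irreducible (map (algebraMap k K) P)) : Irreducible P := by
  have hu : ∀ a : MvPolynomial (Fin 3) k, IsUnit (map (algebraMap k K) a) → IsUnit a := by
    intro a ha
    have h0 := ha.ne_zero
    obtain ⟨Q, hQ⟩ := ha.exists_right_inv
    have hQ0 : Q ≠ 0 := by rintro rfl; simp at hQ
    have := totalDegree_mul_of_isDomain h0 hQ0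
    rw [hQ, totalDegree_one, totalDegree, support_map_of_injective _ (algebraMap k K).injective,
      ← totalDegree] at this
    have h1 : a = C (coeff 0 a) := (totalDegree_eq_zero_iff_eq_C).1 (by omega)
    rw [h1]
    refine IsUnit.map C (IsUnit.mk0 _ ?_)
    intro h2
    rw [h2, map_zero] at h1
    rw [h1, map_zero] at h0
    exact h0 rfl
  refine ⟨fun hP => h.not_isUnit (hP.map _), fun a b hab => ?_⟩
  rw [hab, map_mul] at h
  exact (h.isUnit_or_isUnit rfl).imp (hu _) (hu _)

end Stepanov


namespace Stepanov

/-- common kernel of some linear forms -/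
def orth {k : Type} [Field k] {n : ℕ} (u : Fin n → Fin 3 → k) : Submodule k (Fin 3 → k) :=
  LinearMap.ker (Matrix.of u).mulVecLin

theorem mem_orth {k : Type} [Field k] {n : ℕ} (u : Fin n → Fin 3 → k) (a : Fin 3 → k) :
    a ∈ orth u ↔ ∀ i, u i ⬝ᵥ a = 0 := by
  rw [orth, LinearMap.mem_ker, Matrix.mulVecLin_apply, funext_iff]
  rfl

theorem finrank_orth {k : Type} [Field k] {n : ℕ} {u : Fin n → Fin 3 → k}
    (hu : LinearIndependent k u) : Module.finrank k (orth u) + n = 3 := by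
  have h1 := LinearMap.finrank_range_add_finrank_ker (Matrix.of u).mulVecLin
  have h2 : (Matrix.of u).rank = n := by
    have := LinearIndependent.rank_matrix (M := Matrix.of u) hu
    rwa [Fintype.card_fin] at this
  rw [Matrix.rank] at h2
  rw [h2] at h1
  rw [orth]
  simp at h1
  omega

/-- the linear form with coefficients `a` -/
noncomputable def lin {k : Type} [Field k] (a : Fin 3 → k) : MvPolynomial (Fin 3) k :=
  ∑ i, C (a i) * X i

theorem lin_hom {k : Type} [Field k] (a : Fin 3 → k) : (lin a).IsHomogeneous 1 := by
  refine IsHomogeneous.sum _ _ _ fun i _ => ?_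
  simpa using (isHomogeneous_C (Fin 3) (a i)).mul (isHomogeneous_X k i)

theorem eval_lin {k : Type} [Field k] (a v : Fin 3 → k) : eval v (lin a) = a ⬝ᵥ v := by
  simp [lin, dotProduct]

theorem lin_ne {k : Type} [Field k] {a : Fin 3 → k} (ha : a ≠ 0) : lin a ≠ 0 := by
  intro h
  apply ha
  funext i
  have := eval_lin a (Pi.single i 1)
  rw [h] at this
  simpa using this.symm

theorem eval_smul_hom {k : Type} [Field k] {d : ℕ} {P : MvPolynomial (Fin 3) k}
    (hP : P.IsHomogeneous d) (c : k) (v : Fin 3 → k) : eval (c • v) P = c ^ d * eval v P := by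
  rw [eval_eq, eval_eq, Finset.mul_sum]
  refine Finset.sum_congr rfl fun s hs => ?_
  rw [hP.degree_eq_sum_deg_support hs]
  simp only [Pi.smul_apply, smul_eq_mul, mul_pow, Finset.prod_mul_distrib, Finset.prod_pow_eq_pow_sum]
  ring

/-- an irreducible form of degree at least two does not vanish at all points of a line -/
theorem exists_ne {k : Type} [Field k] [Fintype k] {d : ℕ} (hd : 2 ≤ d) (hdq : d ≤ Fintype.card k)
    {P : MvPolynomial (Fin 3) k} (hP : P.IsHomogeneous d) (hi : Irreducible P)
    {a : Fin 3 → k} (ha : a ≠ 0) : ∃ w : Fin 3 → k, a ⬝ᵥ w = 0 ∧ eval w P ≠ 0 := by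
  by_contra! h
  obtain ⟨j, hj⟩ := Function.ne_iff.1 ha
  let c : Fin 3 → k := Pi.single j (a j)⁻¹
  have hc : a ⬝ᵥ c = 1 := by simpa [c] using mul_inv_cancel₀ hj
  let g : Fin 3 → MvPolynomial (Fin 3) k := fun i => X i - C (c i) * lin a
  let R : MvPolynomial (Fin 3) k := aeval g P
  have hg : ∀ i, (g i).IsHomogeneous 1 := fun i =>
    (isHomogeneous_X k i).sub (by simpa using (isHomogeneous_C (Fin 3) (c i)).mul (lin_hom a))
  have hR : R.IsHomogeneous d := by
    have := hP.aeval g hg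
    rw [one_mul] at this
    exact this
  have hR0 : R = 0 := by
    refine hR.eq_zero_of_forall_eval_eq_zero_of_le_card (fun r => ?_) (by simpa using hdq)
    have e : eval r R = eval (fun i => eval r (g i)) P := by
      have := DFunLike.congr_fun (comp_aeval (R := k) g (aeval (R := k) (S₁ := k) r)) P
      simpa [R, coe_aeval_eq_eval] using this
    rw [e]
    apply h
    have : (fun i => eval r (g i)) = r - (a ⬝ᵥ r) • c := by
      funext i
      simp [g, eval_lin]
      ring
    rw [this, dotProduct_sub, dotProduct_smul, hc]
    simp
  have hdvd : lin a ∣ P := by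
    rw [← Ideal.mem_span_singleton, ← Ideal.Quotient.eq_zero_iff_mem]
    have e1 : Ideal.Quotient.mkₐ k (Ideal.span {lin a}) P
        = Ideal.Quotient.mkₐ k (Ideal.span {lin a}) R := by
      have h1 := DFunLike.congr_fun (comp_aeval (R := k) g
        (Ideal.Quotient.mkₐ k (Ideal.span {lin a}))) P
      have h2 := DFunLike.congr_fun (comp_aeval (R := k) X
        (Ideal.Quotient.mkₐ k (Ideal.span {lin a}))) P
      have h3 : (fun i => Ideal.Quotient.mkₐ k (Ideal.span {lin a}) (g i)) =
          fun i => Ideal.Quotient.mkₐ k (Ideal.span {lin a}) (X i) := by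
        funext i
        refine Ideal.Quotient.eq.2 ?_
        simp only [g, sub_sub_cancel_left]
        exact neg_mem (Ideal.mul_mem_left _ _ (Ideal.mem_span_singleton_self _))
      rw [h3] at h1
      rw [AlgHom.comp_apply] at h1 h2
      rw [aeval_X_left, AlgHom.id_apply] at h2
      rw [h2]
      exact h1.symm
    rw [hR0, map_zero] at e1
    exact e1
  obtain ⟨Q, hQ⟩ := hdvd
  rcases hi.isUnit_or_isUnit hQ with hu | hu
  · exact not_unit_hom le_rfl (lin_hom a) hu
  · have h0 := hi.ne_zero
    have hl0 := lin_ne ha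
    have h1 := totalDegree_mul_of_isDomain hl0 hu.ne_zero
    rw [← hQ, hP.totalDegree h0, (lin_hom a).totalDegree hl0,
      (isUnit_iff_totalDegree_of_isReduced.1 hu).2] at h1
    omega

theorem coeff_line {k : Type} [Field k] {d : ℕ} {P : MvPolynomial (Fin 3) k}
    (hP : P.IsHomogeneous d) (u w : Fin 3 → k) :
    (aeval (fun i => Polynomial.C (u i) + Polynomial.C (w i) * Polynomial.X) P).coeff d
      = eval w P := by
  rw [aeval_def, eval₂_eq', eval_eq', Polynomial.finsetSum_coeff]
  refine Finset.sum_congr rfl fun s hs => ?_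
  have h1 := hP.degree_eq_sum_deg_support hs
  rw [← Finsupp.degree_apply, Finsupp.degree_eq_sum, Fin.sum_univ_three] at h1
  have hn : ∀ i, (Polynomial.C (u i) + Polynomial.C (w i) * Polynomial.X).natDegree ≤ 1 := by
    intro i; compute_degree
  have hp : ∀ i, ((Polynomial.C (u i) + Polynomial.C (w i) * Polynomial.X) ^ s i).natDegree ≤ s i :=
    fun i => Polynomial.natDegree_pow_le.trans (by simpa using Nat.mul_le_mul_left (s i) (hn i))
  have hc : ∀ i, ((Polynomial.C (u i) + Polynomial.C (w i) * Polynomial.X) ^ s i).coeff (s i)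
      = w i ^ s i := by
    intro i
    have := Polynomial.coeff_pow_of_natDegree_le (m := s i) (hn i)
    rw [mul_one] at this
    rw [this]
    simp
  rw [Fin.prod_univ_three, Fin.prod_univ_three, h1, Polynomial.algebraMap_apply,
    Polynomial.coeff_C_mul, Polynomial.coeff_mul_add_eq_of_natDegree_le _ (hp 2),
    Polynomial.coeff_mul_add_eq_of_natDegree_le (hp 0) (hp 1), hc, hc, hc]
  · rfl
  · exact Polynomial.natDegree_mul_le.trans (add_le_add (hp 0) (hp 1))

theorem line_le {k : Type} [Field k] [Fintype k] [DecidableEq k] {d : ℕ} (hd : 2 ≤ d)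
    (hdq : d ≤ Fintype.card k)
    {P : MvPolynomial (Fin 3) k} (hP : P.IsHomogeneous d) (hi : Irreducible P)
    {a : Fin 3 → k} (ha : a ≠ 0) :
    (Finset.univ.filter fun v : Fin 3 → k => (v ≠ 0 ∧ eval v P = 0) ∧ a ⬝ᵥ v = 0).card
      ≤ (Fintype.card k - 1) * d := by
  obtain ⟨w, hw, hPw⟩ := exists_ne hd hdq hP hi ha
  have hw0 : w ≠ 0 := by
    rintro rfl
    have := eval_smul_hom hP 0 0
    rw [smul_zero, zero_pow (by omega), zero_mul] at this
    exact hPw this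
  have hli : LinearIndependent k ![a] := .of_subsingleton 0 ha
  have hfr := finrank_orth hli
  have hmem : ∀ v, v ∈ orth ![a] ↔ a ⬝ᵥ v = 0 := by
    intro v; rw [mem_orth]; simp
  have hrank : 1 < Module.rank k (orth ![a]) := by
    rw [← Module.finrank_eq_rank]
    exact_mod_cast (by omega : 1 < Module.finrank k (orth ![a]))
  obtain ⟨u, hu⟩ := exists_linearIndependent_pair_of_one_lt_rank hrank
    (x := (⟨w, (hmem w).2 hw⟩ : orth ![a])) (fun h => hw0 (congrArg Subtype.val h))
  have hspan := hu.span_eq_top_of_card_eq_finrank' (by simp; omega)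
  set p : Polynomial k :=
    aeval (fun i => Polynomial.C (u.1 i) + Polynomial.C (w i) * Polynomial.X) P with hp
  have hp0 : p ≠ 0 := by
    intro h
    have := coeff_line hP u.1 w
    rw [← hp, h, Polynomial.coeff_zero] at this
    exact hPw this.symm
  have hpd : p.natDegree ≤ d := by
    have := aeval_natDegree_le (m := d) (n := 1) P hP.totalDegree_le
      (fun i => Polynomial.C (u.1 i) + Polynomial.C (w i) * Polynomial.X)
      (fun i => by compute_degree)
    simpa using this
  have hpe : ∀ t, p.eval t = eval (u.1 + t • w) P := by
    intro t
    have := DFunLike.congr_fun (comp_aeval (R := k)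
      (fun i => Polynomial.C (u.1 i) + Polynomial.C (w i) * Polynomial.X)
      (Polynomial.aeval (R := k) (A := k) t)) P
    rw [AlgHom.comp_apply, ← hp, Polynomial.coe_aeval_eq_eval] at this
    have e2 : (fun i => Polynomial.eval t (Polynomial.C (u.1 i) + Polynomial.C (w i) * Polynomial.X))
        = u.1 + t • w := by
      funext i
      simp
      ring
    rw [e2] at this
    rw [this]
    exact DFunLike.congr_fun (coe_aeval_eq_eval (u.1 + t • w)) P
  have hsub : (Finset.univ.filter fun v : Fin 3 → k => (v ≠ 0 ∧ eval v P = 0) ∧ a ⬝ᵥ v = 0) ⊆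
      (((Finset.univ : Finset k).erase 0) ×ˢ p.roots.toFinset).image
        fun x => x.1 • (u.1 + x.2 • w) := by
    intro v hv
    simp only [Finset.mem_filter, Finset.mem_univ, true_and] at hv
    obtain ⟨⟨hv0, hPv⟩, hav⟩ := hv
    have h1 : (⟨v, (hmem v).2 hav⟩ : orth ![a]) ∈ Submodule.span k
      (Set.range ![(⟨w, (hmem w).2 hw⟩ : orth ![a]), u]) := by rw [hspan]; trivial
    rw [Matrix.range_cons, Matrix.range_cons, Matrix.range_empty, Set.union_empty,
      Set.singleton_union, Submodule.mem_span_pair] at h1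
    obtain ⟨β, α, h2⟩ := h1
    have h3 : β • w + α • u.1 = v := congrArg Subtype.val h2
    have hα : α ≠ 0 := by
      rintro rfl
      rw [zero_smul, add_zero] at h3
      rw [← h3, eval_smul_hom hP] at hPv
      have hβ : β = 0 := by
        by_contra hb
        exact (mul_ne_zero (pow_ne_zero _ hb) hPw) hPv
      rw [hβ, zero_smul] at h3
      exact hv0 h3.symm
    have h4 : α • (u.1 + (β / α) • w) = v := by
      rw [smul_add, smul_smul, mul_div_cancel₀ _ hα, add_comm]
      exact h3
    refine Finset.mem_image.2 ⟨(α, β / α), ?_, h4⟩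
    rw [Finset.mem_product]
    refine ⟨by simp [hα], ?_⟩
    rw [Multiset.mem_toFinset, Polynomial.mem_roots hp0, Polynomial.IsRoot, hpe]
    rw [← h4, eval_smul_hom hP] at hPv
    exact (mul_eq_zero.1 hPv).resolve_left (pow_ne_zero _ hα)
  refine (Finset.card_le_card hsub).trans (Finset.card_image_le.trans ?_)
  rw [Finset.card_product, Finset.card_erase_of_mem (Finset.mem_univ _), Finset.card_univ]
  exact Nat.mul_le_mul_left _
    ((Multiset.toFinset_card_le _).trans ((Polynomial.card_roots' p).trans hpd))

end Stepanov


namespace Stepanov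

theorem card_orth {k : Type} [Field k] [Fintype k] [DecidableEq k] {n : ℕ} {u : Fin n → Fin 3 → k}
    (hu : LinearIndependent k u) :
    (((Finset.univ : Finset (Fin 3 → k)).erase 0).filter fun a => ∀ i, u i ⬝ᵥ a = 0).card + 1
      = Fintype.card k ^ (3 - n) := by
  classical
  have h1 := finrank_orth hu
  have h2 : Fintype.card (orth u) = Fintype.card k ^ Module.finrank k (orth u) :=
    Module.card_eq_pow_finrank
  have h3 : Module.finrank k (orth u) = 3 - n := by omega
  rw [← h3, ← h2, Fintype.card_subtype, Finset.filter_erase,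
    Finset.card_erase_add_one (by simp)]
  congr 1
  ext a
  simp [mem_orth]

/-- nonzero zeros of a form -/
noncomputable def zer {k : Type} [Field k] [Fintype k] [DecidableEq k] (P : MvPolynomial (Fin 3) k) :
    Finset (Fin 3 → k) := Finset.univ.filter fun v => v ≠ 0 ∧ eval v P = 0

theorem mem_zer {k : Type} [Field k] [Fintype k] [DecidableEq k] {P : MvPolynomial (Fin 3) k}
    {v : Fin 3 → k} : v ∈ zer P ↔ v ≠ 0 ∧ eval v P = 0 := by simp [zer]

theorem one_lt_card {k : Type} [Field k] [Fintype k] : 1 < Fintype.card k := Fintype.one_lt_card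

theorem card_single {k : Type} [Field k] [Fintype k] [DecidableEq k] {v : Fin 3 → k} (hv : v ≠ 0) :
    (((((Finset.univ : Finset (Fin 3 → k)).erase 0).filter fun a => a ⬝ᵥ v = 0).card : ℕ) : ℝ)
      = (Fintype.card k : ℝ) ^ 2 - 1 := by
  have hli : LinearIndependent k ![v] := .of_subsingleton 0 hv
  have h := card_orth hli
  rw [Finset.filter_congr (q := fun a => a ⬝ᵥ v = 0)
    (fun a _ => by simp [dotProduct_comm v])] at h
  have h' : ((_ : ℕ) : ℝ) = _ := congrArg (Nat.cast (R := ℝ)) h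
  push_cast at h'
  linarith

theorem card_pair {k : Type} [Field k] [Fintype k] [DecidableEq k] {v w : Fin 3 → k}
    (hv : LinearIndependent k ![v, w]) :
    (((((Finset.univ : Finset (Fin 3 → k)).erase 0).filter
      fun a => a ⬝ᵥ v = 0 ∧ a ⬝ᵥ w = 0).card : ℕ) : ℝ) = (Fintype.card k : ℝ) - 1 := by
  have h := card_orth hv
  rw [Finset.filter_congr (q := fun a => a ⬝ᵥ v = 0 ∧ a ⬝ᵥ w = 0)
    (fun a _ => by rw [Fin.forall_fin_two]; simp [dotProduct_comm v, dotProduct_comm w])] at h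
  have h' : ((_ : ℕ) : ℝ) = _ := congrArg (Nat.cast (R := ℝ)) h
  push_cast at h'
  norm_num at h'
  linarith

theorem scal_card {k : Type} [Field k] [Fintype k] [DecidableEq k] {d : ℕ}
    {P : MvPolynomial (Fin 3) k} (hP : P.IsHomogeneous d) {v : Fin 3 → k} (hv : v ∈ zer P) :
    ((((zer P).filter fun w => ∃ c : k, c • v = w).card : ℕ) : ℝ) = (Fintype.card k : ℝ) - 1 := by
  rw [mem_zer] at hv
  have e : ((zer P).filter fun w => ∃ c : k, c • v = w)
      = ((Finset.univ : Finset k).erase 0).image fun c => c • v := by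
    ext w
    simp only [Finset.mem_filter, mem_zer, Finset.mem_image, Finset.mem_erase, Finset.mem_univ,
      and_true]
    constructor
    · rintro ⟨⟨h1, h2⟩, c, rfl⟩
      exact ⟨c, fun h => h1 (by rw [h, zero_smul]), rfl⟩
    · rintro ⟨c, hc, rfl⟩
      exact ⟨⟨smul_ne_zero hc hv.1, by rw [eval_smul_hom hP, hv.2, mul_zero]⟩, c, rfl⟩
  rw [e, Finset.card_image_of_injective _ (smul_left_injective k hv.1),
    Finset.card_erase_of_mem (Finset.mem_univ _), Finset.card_univ,
    Nat.cast_sub one_lt_card.le, Nat.cast_one]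

theorem first_moment {k : Type} [Field k] [Fintype k] [DecidableEq k]
    (P : MvPolynomial (Fin 3) k) :
    ∑ a ∈ (Finset.univ : Finset (Fin 3 → k)).erase 0,
      ((((zer P).filter fun v => a ⬝ᵥ v = 0).card : ℕ) : ℝ)
      = (zer P).card * ((Fintype.card k : ℝ) ^ 2 - 1) := by
  have h := Finset.sum_card_bipartiteAbove_eq_sum_card_bipartiteBelow
    (s := (Finset.univ : Finset (Fin 3 → k)).erase 0) (t := zer P) (fun a v => a ⬝ᵥ v = 0)
  have h' := congrArg (Nat.cast (R := ℝ)) h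
  push_cast at h'
  refine h'.trans ?_
  simp only [Finset.bipartiteBelow]
  rw [Finset.sum_congr rfl (fun v hv => card_single (mem_zer.1 hv).1), Finset.sum_const,
    nsmul_eq_mul]

theorem second_moment {k : Type} [Field k] [Fintype k] [DecidableEq k] {d : ℕ}
    {P : MvPolynomial (Fin 3) k} (hP : P.IsHomogeneous d) :
    ∑ a ∈ (Finset.univ : Finset (Fin 3 → k)).erase 0,
      ((((zer P).filter fun v => a ⬝ᵥ v = 0).card : ℕ) : ℝ) ^ 2
      = (zer P).card * (((Fintype.card k : ℝ) - 1) * ((Fintype.card k : ℝ) ^ 2 - 1) +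
        ((zer P).card - ((Fintype.card k : ℝ) - 1)) * ((Fintype.card k : ℝ) - 1)) := by
  have h := Finset.sum_card_bipartiteAbove_eq_sum_card_bipartiteBelow
    (s := (Finset.univ : Finset (Fin 3 → k)).erase 0) (t := zer P ×ˢ zer P)
    (fun a v => a ⬝ᵥ v.1 = 0 ∧ a ⬝ᵥ v.2 = 0)
  have h' := congrArg (Nat.cast (R := ℝ)) h
  push_cast at h'
  have e1 : ∀ a : Fin 3 → k, ((((zer P).filter fun v => a ⬝ᵥ v = 0).card : ℕ) : ℝ) ^ 2 =
      ((Finset.bipartiteAbove (fun (a : Fin 3 → k) (v : (Fin 3 → k) × (Fin 3 → k)) =>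
        a ⬝ᵥ v.1 = 0 ∧ a ⬝ᵥ v.2 = 0) (zer P ×ˢ zer P) a).card : ℝ) := by
    intro a
    rw [sq, ← Nat.cast_mul, ← Finset.card_product, Finset.bipartiteAbove,
      ← Finset.filter_product (fun v => a ⬝ᵥ v = 0) (fun v => a ⬝ᵥ v = 0)]
  rw [Finset.sum_congr rfl (fun a _ => e1 a), h', Finset.sum_product]
  have e2 : ∀ v ∈ zer P, ∑ w ∈ zer P,
      ((Finset.bipartiteBelow (fun (a : Fin 3 → k) (v : (Fin 3 → k) × (Fin 3 → k)) =>
        a ⬝ᵥ v.1 = 0 ∧ a ⬝ᵥ v.2 = 0) ((Finset.univ : Finset (Fin 3 → k)).erase 0) (v, w)).card : ℝ)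
      = (((Fintype.card k : ℝ) - 1) * ((Fintype.card k : ℝ) ^ 2 - 1) +
        ((zer P).card - ((Fintype.card k : ℝ) - 1)) * ((Fintype.card k : ℝ) - 1)) := by
    intro v hv
    have hv0 := (mem_zer.1 hv).1
    rw [← Finset.sum_filter_add_sum_filter_not (zer P) (fun w => ∃ c : k, c • v = w)]
    congr 1
    · rw [← scal_card hP hv, ← nsmul_eq_mul, ← Finset.sum_const]
      refine Finset.sum_congr rfl fun w hw => ?_
      obtain ⟨hw1, c, rfl⟩ := Finset.mem_filter.1 hw
      rw [← card_single hv0, Finset.bipartiteBelow]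
      congr 2
      ext a
      simp +contextual
    · have e3 : ((((zer P).filter fun w => ¬ ∃ c : k, c • v = w).card : ℕ) : ℝ)
          = (zer P).card - ((Fintype.card k : ℝ) - 1) := by
        have := Finset.card_filter_add_card_filter_not (s := zer P) (fun w => ∃ c : k, c • v = w)
        rw [← scal_card hP hv, ← this]
        push_cast
        ring
      rw [← e3, ← nsmul_eq_mul, ← Finset.sum_const]
      refine Finset.sum_congr rfl fun w hw => ?_
      have hw2 := (Finset.mem_filter.1 hw).2
      have : LinearIndependent k ![v, w] := (LinearIndependent.pair_iff' hv0).2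
        fun c hc => hw2 ⟨c, hc⟩
      rw [← card_pair this, Finset.bipartiteBelow]
  rw [Finset.sum_congr rfl e2, Finset.sum_const, nsmul_eq_mul]

/-- if every line meets the curve, a quadratic inequality holds -/
theorem quad_ineq {k : Type} [Field k] [Fintype k] [DecidableEq k] {d : ℕ} (hd : 2 ≤ d)
    (hdq : d ≤ Fintype.card k) {P : MvPolynomial (Fin 3) k} (hP : P.IsHomogeneous d)
    (hi : Irreducible P)
    (H : ∀ a : Fin 3 → k, a ≠ 0 → ∃ v, v ≠ 0 ∧ a ⬝ᵥ v = 0 ∧ eval v P = 0) {N q : ℝ}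
    (hq : q = Fintype.card k) (hN : ((zer P).card : ℝ) = (q - 1) * N) :
    N ^ 2 - N - d * N * (q + 1) + d * (q ^ 2 + q + 1) ≤ 0 := by
  have hq1 : 1 < q := by rw [hq]; exact_mod_cast one_lt_card
  have h1 := first_moment P
  have h2 := second_moment hP
  rw [← hq, hN] at h1 h2
  have hterm : ∀ a ∈ (Finset.univ : Finset (Fin 3 → k)).erase 0,
      (((((zer P).filter fun v => a ⬝ᵥ v = 0).card : ℕ) : ℝ) - (q - 1)) *
      (((((zer P).filter fun v => a ⬝ᵥ v = 0).card : ℕ) : ℝ) - (q - 1) * d) ≤ 0 := by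
    intro a ha
    have ha0 : a ≠ 0 := (Finset.mem_erase.1 ha).1
    apply mul_nonpos_of_nonneg_of_nonpos
    · obtain ⟨v, hv0, hav, hPv⟩ := H a ha0
      have hv : v ∈ zer P := mem_zer.2 ⟨hv0, hPv⟩
      rw [hq, ← scal_card hP hv, sub_nonneg]
      norm_cast
      apply Finset.card_le_card
      intro w hw
      obtain ⟨hw1, c, rfl⟩ := Finset.mem_filter.1 hw
      exact Finset.mem_filter.2 ⟨hw1, by rw [dotProduct_smul, hav, smul_zero]⟩
    · have := line_le hd hdq hP hi ha0
      have e : (zer P).filter (fun v => a ⬝ᵥ v = 0) = Finset.univ.filter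
          fun v : Fin 3 → k => (v ≠ 0 ∧ eval v P = 0) ∧ a ⬝ᵥ v = 0 := by
        rw [zer, Finset.filter_filter]
      rw [← e] at this
      have h' : ((_ : ℕ) : ℝ) ≤ ((_ : ℕ) : ℝ) := Nat.cast_le.2 this
      rw [Nat.cast_mul, Nat.cast_sub one_lt_card.le, ← hq, Nat.cast_one] at h'
      linarith
  have hs := Finset.sum_nonpos hterm
  have hA : ((((Finset.univ : Finset (Fin 3 → k)).erase 0).card : ℕ) : ℝ) = q ^ 3 - 1 := by
    rw [Finset.card_erase_of_mem (Finset.mem_univ _), Finset.card_univ, Fintype.card_fun,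
      Fintype.card_fin, Nat.cast_sub (Nat.one_le_pow _ _ (by linarith [one_lt_card (k := k)])), hq]
    push_cast
    rfl
  have hexp : ∀ x : ℝ, (x - (q - 1)) * (x - (q - 1) * d) =
      x ^ 2 - ((q - 1) * (1 + d)) * x + (q - 1) ^ 2 * d := fun x => by ring
  simp only [hexp] at hs
  rw [Finset.sum_add_distrib, Finset.sum_sub_distrib, ← Finset.mul_sum, h1, h2, Finset.sum_const,
    nsmul_eq_mul, hA] at hs
  have hfac : (q - 1) ^ 3 * (N ^ 2 - N - d * N * (q + 1) + d * (q ^ 2 + q + 1)) ≤ 0 := by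
    linarith
  have : 0 < (q - 1) ^ 3 := by have : 0 < q - 1 := by linarith
                               positivity
  by_contra! h
  linarith [mul_pos this h]

/-- upper bound for the number of zeros via affine points -/
theorem zer_le {k : Type} [Field k] [Fintype k] [DecidableEq k] {d : ℕ} (hd : 2 ≤ d)
    (hdq : d ≤ Fintype.card k) {P : MvPolynomial (Fin 3) k} (hP : P.IsHomogeneous d)
    (hi : Irreducible P) :
    (zer P).card ≤ (Fintype.card k - 1) * (Nat.card (Pts (deh k P)) + d) := by
  let _ := Fintype.ofFinite (Pts (deh k P))
  obtain ⟨a0, ha0⟩ : ∃ a0 : Fin 3 → k, a0 = ![0, 0, 1] := ⟨_, rfl⟩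
  have h0 := Finset.card_filter_add_card_filter_not (s := zer P) (fun v => a0 ⬝ᵥ v = 0)
  have h1 := line_le hd hdq hP hi (a := a0) (by
    intro h; rw [ha0] at h; have := congrFun h 2; simp at this)
  have e : (zer P).filter (fun v => a0 ⬝ᵥ v = 0) = Finset.univ.filter
      fun v : Fin 3 → k => (v ≠ 0 ∧ eval v P = 0) ∧ a0 ⬝ᵥ v = 0 := by
    rw [zer, Finset.filter_filter]
  rw [← e] at h1
  have hsub : ((zer P).filter fun v => ¬ a0 ⬝ᵥ v = 0) ⊆
      (((Finset.univ : Finset k).erase 0) ×ˢ (Finset.univ : Finset (Pts (deh k P)))).image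
        fun x => x.1 • ![x.2.1 0, x.2.1 1, 1] := by
    intro v hv
    obtain ⟨hv1, hv2⟩ := Finset.mem_filter.1 hv
    have hv2' : v 2 ≠ 0 := by
      intro h; apply hv2; simp [ha0, dotProduct, Fin.sum_univ_three, h]
    have e2 : v 2 • ![v 0 / v 2, v 1 / v 2, 1] = v := by
      funext i
      fin_cases i
      · simp [mul_div_cancel₀ _ hv2']
      · simp [mul_div_cancel₀ _ hv2']
      · simp
    refine Finset.mem_image.2 ⟨(v 2, ⟨![v 0 / v 2, v 1 / v 2], ?_⟩), ?_, ?_⟩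
    · rw [eval_deh]
      have h3 := (mem_zer.1 hv1).2
      rw [← e2, eval_smul_hom hP] at h3
      simpa [hv2'] using h3
    · simp [hv2']
    · simpa using e2
  have h2 := (Finset.card_le_card hsub).trans Finset.card_image_le
  rw [Finset.card_product, Finset.card_erase_of_mem (Finset.mem_univ _), Finset.card_univ,
    Finset.card_univ, ← Nat.card_eq_fintype_card (α := Pts (deh k P))] at h2
  rw [mul_add]
  omega

end Stepanov


namespace Stepanov

theorem const_bound : (1457 / 1000 : ℝ) ≤ ((1 + Real.sqrt 2) / 2) ^ 2 := by
  have h : (14142 / 10000 : ℝ) ≤ Real.sqrt 2 := by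
    apply Real.le_sqrt_of_sq_le
    norm_num
  nlinarith

theorem num_end {d q N : ℝ} (hd : 4 ≤ d) (hq : 50 * d ≤ q)
    (hN : 50 * (d - 2) * (N - q - 1) ≤ 47 * q) :
    0 < N ^ 2 - N - d * N * (q + 1) + d * (q ^ 2 + q + 1) := by
  obtain ⟨E, hE⟩ : ∃ E, E = N - q - 1 := ⟨_, rfl⟩
  have hN' : N = q + 1 + E := by linarith
  subst hN'
  rw [← hE] at hN
  have key : (q + 1 + E) ^ 2 - (q + 1 + E) - d * (q + 1 + E) * (q + 1) + d * (q ^ 2 + q + 1)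
      = (q * q - (d - 1) * q) + E ^ 2 - E * ((d - 2) * q + (d - 1)) := by ring
  rw [key]
  have hq0 : 200 ≤ q := by linarith
  have h1 : (d - 1) * q * 50 ≤ q * q := by nlinarith
  have hqq : 0 < q * q := by positivity
  rcases le_total E 0 with h | h
  · have h3 : 0 ≤ (d - 2) * q + (d - 1) := by nlinarith
    nlinarith [mul_nonneg (neg_nonneg.2 h) h3, sq_nonneg E]
  · have h2 : 50 * (E * ((d - 2) * q)) ≤ 47 * (q * q) := by nlinarith
    have h3 : E * (d - 1) ≤ 2 * (E * (d - 2)) := by nlinarith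
    have h4 : 200 * q ≤ q * q := by nlinarith
    nlinarith [sq_nonneg E]

theorem num_M {W M q : ℝ} (hW : 24 ≤ W) (hM : 0 ≤ M) (h1 : 1457 / 1000 * W ^ 2 < q)
    (h2 : q < (M + 1) * (M + 1)) : 29 * W ≤ 25 * M := by
  by_contra! h
  have h3 : 25 * (M + 1) ≤ 3005 / 100 * W := by linarith
  have h4 : (25 * (M + 1)) * (25 * (M + 1)) ≤ (3005 / 100 * W) * (3005 / 100 * W) :=
    mul_self_le_mul_self (by linarith) h3
  nlinarith

theorem main_aux {k : Type} [Field k] [Fintype k] (P : MvPolynomial (Fin 3) k) (d : ℕ)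
    (hd : 2 ≤ d) (hP : P.IsHomogeneous d) (hi : Irreducible P)
    (hq : (1457 / 1000 : ℝ) * ((d : ℝ) * (d - 1) * (d - 2)) ^ 2 < Fintype.card k) :
    ∃ a : Fin 3 → k, a ≠ 0 ∧ ∀ v, v ≠ 0 → a ⬝ᵥ v = 0 → eval v P ≠ 0 := by
  classical
  by_contra! H
  have hc := one_lt_card (k := k)
  have hcR : (1 : ℝ) < Fintype.card k := by exact_mod_cast hc
  have hdR : (2 : ℝ) ≤ d := by exact_mod_cast hd
  have hW : 3 ≤ d → (d : ℝ) ≤ d * (d - 1) * (d - 2) := by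
    intro h3
    have h3R : (3 : ℝ) ≤ d := by exact_mod_cast h3
    have e1 : (1 : ℝ) ≤ (d - 1) * (d - 2) := by nlinarith
    nlinarith
  have hdq : d ≤ Fintype.card k := by
    rcases Nat.lt_or_ge d 3 with h | h
    · omega
    · have := hW h
      have h3R : (3 : ℝ) ≤ d := by exact_mod_cast h
      have : (d : ℝ) ≤ Fintype.card k := by nlinarith
      exact_mod_cast this
  have hq1 : (Fintype.card k : ℝ) - 1 ≠ 0 := by linarith
  have quad := quad_ineq hd hdq hP hi
    (fun a ha => by obtain ⟨v, h1, h2, h3⟩ := H a ha; exact ⟨v, h1, h2, h3⟩)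
    (N := ((zer P).card : ℝ) / ((Fintype.card k : ℝ) - 1)) rfl (by field_simp)
  have hNle : ((zer P).card : ℝ) / ((Fintype.card k : ℝ) - 1) ≤ Nat.card (Pts (deh k P)) + d := by
    rw [div_le_iff₀ (by linarith)]
    have h : (((zer P).card : ℕ) : ℝ) ≤ ((_ : ℕ) : ℝ) := Nat.cast_le.2 (zer_le hd hdq hP hi)
    rw [Nat.cast_mul, Nat.cast_sub hc.le] at h
    push_cast at h
    linarith
  set N := ((zer P).card : ℝ) / ((Fintype.card k : ℝ) - 1) with hN
  set q : ℝ := (Fintype.card k : ℝ) with hqd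
  have hq2 : (2 : ℝ) ≤ q := by rw [hqd]; exact_mod_cast hc
  rcases Nat.lt_or_ge d 4 with h4 | h4
  · have : d = 2 ∨ d = 3 := by omega
    rcases this with rfl | rfl
    · push_cast at quad
      nlinarith [sq_nonneg (2 * N - (2 * q + 3))]
    · push_cast at quad hq
      have : (52 : ℝ) < q := by nlinarith
      nlinarith [sq_nonneg (2 * N - (3 * q + 4))]
  · have h4R : (4 : ℝ) ≤ d := by exact_mod_cast h4
    obtain ⟨hf, hfd⟩ := deh_irr hd hP hi
    have hW24 : (24 : ℝ) ≤ d * (d - 1) * (d - 2) := by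
      have : (12 : ℝ) ≤ d * (d - 1) := by nlinarith
      nlinarith
    have hM1 : 29 * ((d : ℝ) * (d - 1) * (d - 2)) ≤ 25 * (Nat.sqrt (Fintype.card k) : ℝ) := by
      refine num_M hW24 (Nat.cast_nonneg _) hq ?_
      rw [hqd]
      exact_mod_cast Nat.lt_succ_sqrt (Fintype.card k)
    have hM2 : 29 * ((d : ℤ) * (d - 1) * (d - 2)) ≤ 25 * (Nat.sqrt (Fintype.card k) : ℤ) := by
      exact_mod_cast hM1
    have hb := affine_bound hf h4 hfd (Nat.sqrt_le _) hM2
    have hbR : 50 * ((d : ℝ) - 2) * (Nat.card (Pts (deh k P)) + d - q - 1) ≤ 47 * q := by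
      rw [hqd]
      exact_mod_cast hb
    have h50 : 50 * (d : ℝ) ≤ q := by
      have e0 : (6 : ℝ) ≤ (d - 1) * (d - 2) := by nlinarith
      have e3 : (6 * (d : ℝ)) ≤ (d : ℝ) * (d - 1) * (d - 2) := by
        nlinarith [mul_le_mul_of_nonneg_left e0 (by linarith : (0 : ℝ) ≤ d)]
      have e5 : (24 : ℝ) ≤ (d : ℝ) * (d - 1) * (d - 2) := by linarith
      have e4 : 24 * ((d : ℝ) * (d - 1) * (d - 2)) ≤ ((d : ℝ) * (d - 1) * (d - 2)) ^ 2 := by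
        rw [sq]; exact mul_le_mul_of_nonneg_right e5 (by linarith)
      linarith
    have := num_end h4R h50 (N := N) (le_trans (mul_le_mul_of_nonneg_left (by linarith) (by linarith)) hbR)
    linarith

end Stepanov

/-- Proposition 2.1: a geometrically irreducible plane curve of degree `δ ≥ 2` over `𝔽_q`,
with `q` large compared to `δ`, misses all `𝔽_q`-points of some `𝔽_q`-line. -/
theorem line_avoiding_rational_points_of_geometrically_irreducible_curve
    (F : Type) [Field F] [Fintype F]
    (P : MvPolynomial (Fin 3) F) (δ : ℕ) (hδ : 2 ≤ δ)
    (hhom : P.IsHomogeneous δ)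
    (hirr : Irreducible (map (algebraMap F (AlgebraicClosure F)) P))
    (hq : (Fintype.card F : ℝ) >
      ((1 + Real.sqrt 2) / 2) ^ 2 * (δ : ℝ) ^ 2 * ((δ : ℝ) - 1) ^ 2 * ((δ : ℝ) - 2) ^ 2) :
    ∃ ℓ : MvPolynomial (Fin 3) F, ℓ ≠ 0 ∧ ℓ.IsHomogeneous 1 ∧
      ∀ v : Fin 3 → F, v ≠ 0 → eval v ℓ = 0 → eval v P ≠ 0 := by
  have hi := Stepanov.irr_of_map hirr
  obtain ⟨a, ha, h⟩ := Stepanov.main_aux P δ hδ hhom hi (by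
    refine lt_of_le_of_lt ?_ hq
    have := mul_le_mul_of_nonneg_right Stepanov.const_bound
      (sq_nonneg ((δ : ℝ) * (δ - 1) * (δ - 2)))
    refine this.trans (le_of_eq ?_)
    ring)
  exact ⟨Stepanov.lin a, Stepanov.lin_ne ha, Stepanov.lin_hom a,
    fun v hv hl => h v hv (by rw [← Stepanov.eval_lin]; exact hl)⟩
end
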